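/- arXiv:1012.0936 — 3 statements merged into one kernel-verified Lean document; each statement's English description precedes it below -/
import Mathlib

section
/- Assume in addition that X is spectrally positive: almost surely, for every t > 0 the jump X(t) − X(t−) is nonnegative (X has no negative jumps), and X does not have nondecreasing sample paths. Let ψ̂(θ) := log E[e^{−θ Y(1)}], which is finite for all θ ≥ 0 and satisfies ψ̂'(0) = −E[Y(1)] = 1, and let Φ̂(q) := sup{θ ≥ 0 : ψ̂(θ) = q} be its right inverse. Let e_q be an exponentially distributed random variable with parameter q > 0, independent of X and of Q_e. Then for all x > 0 and q > 0 with x ≠ Φ̂(q): E[exp(−x · max(0, Q_e + Y̲(e_q)))] = (x/ψ̂(x)) · (Φ̂(q)/q) · ((q − ψ̂(x))/(Φ̂(q) − x)). -/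
open MeasureTheory ProbabilityTheory Filter Set

set_option linter.unusedSectionVars false

section RW
variable {Ω : Type*} [MeasurableSpace Ω] {μ : Measure Ω} [IsProbabilityMeasure μ]

/-- partial sums -/
def RS (ξ : ℕ → Ω → ℝ) (k : ℕ) (ω : Ω) : ℝ := ∑ j ∈ Finset.range k, ξ j ω

def RB (ξ : ℕ → Ω → ℝ) (y : ℝ) (n : ℕ) : Set Ω := {ω | ∀ j ≤ n, -y ≤ RS ξ j ω}

def RA (ξ : ℕ → Ω → ℝ) (y : ℝ) (n : ℕ) : Set Ω :=
  {ω | (∀ j < n, -y ≤ RS ξ j ω) ∧ RS ξ n ω < -y}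

lemma RS_zero (ξ : ℕ → Ω → ℝ) (ω : Ω) : RS ξ 0 ω = 0 := by simp [RS]

lemma RS_succ (ξ : ℕ → Ω → ℝ) (k : ℕ) (ω : Ω) : RS ξ (k+1) ω = RS ξ k ω + ξ k ω := by
  simp [RS, Finset.sum_range_succ]

lemma RS_succ' (ξ : ℕ → Ω → ℝ) (k : ℕ) (ω : Ω) :
    RS ξ (k+1) ω = ξ 0 ω + RS (fun j => ξ (j+1)) k ω := by
  simp [RS, Finset.sum_range_succ', add_comm]

lemma RS_meas {ξ : ℕ → Ω → ℝ} (hm : ∀ k, Measurable (ξ k)) (k : ℕ) : Measurable (RS ξ k) := by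
  unfold RS; exact Finset.measurable_sum _ fun i _ => hm i

lemma RB_meas {ξ : ℕ → Ω → ℝ} (hm : ∀ k, Measurable (ξ k)) (y : ℝ) (n : ℕ) :
    MeasurableSet (RB ξ y n) := by
  have : RB ξ y n = ⋂ j, ⋂ (_ : j ≤ n), {ω | -y ≤ RS ξ j ω} := by ext; simp [RB]
  rw [this]
  exact MeasurableSet.iInter fun j => MeasurableSet.iInter fun _ =>
    measurableSet_le measurable_const (RS_meas hm j)

lemma RA_meas {ξ : ℕ → Ω → ℝ} (hm : ∀ k, Measurable (ξ k)) (y : ℝ) (n : ℕ) :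
    MeasurableSet (RA ξ y n) := by
  have : RA ξ y n = (⋂ j, ⋂ (_ : j < n), {ω | -y ≤ RS ξ j ω}) ∩ {ω | RS ξ n ω < -y} := by
    ext; simp [RA]
  rw [this]
  exact (MeasurableSet.iInter fun j => MeasurableSet.iInter fun _ =>
    measurableSet_le measurable_const (RS_meas hm j)).inter
      (measurableSet_lt (RS_meas hm n) measurable_const)

lemma indep_of_past {ξ : ℕ → Ω → ℝ} (hm : ∀ k, Measurable (ξ k)) (hi : iIndepFun ξ μ)
    (s t : Set ℕ) (hst : Disjoint s t) {F G : Ω → ℝ}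
    (hF : Measurable[⨆ i ∈ s, MeasurableSpace.comap (ξ i) inferInstance] F)
    (hG : Measurable[⨆ i ∈ t, MeasurableSpace.comap (ξ i) inferInstance] G) :
    IndepFun F G μ := by
  rw [IndepFun_iff_Indep]
  have h := indep_iSup_of_disjoint (μ := μ) (m := fun i => MeasurableSpace.comap (ξ i) inferInstance)
    (fun i => (hm i).comap_le) (by exact hi) hst
  exact indep_of_indep_of_le_left (indep_of_indep_of_le_right h hG.comap_le) hF.comap_le

lemma meas_past (ξ : ℕ → Ω → ℝ) (s : Set ℕ) (i : ℕ) (hi : i ∈ s) :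
    Measurable[⨆ i ∈ s, MeasurableSpace.comap (ξ i) inferInstance] (ξ i) :=
  (comap_measurable (ξ i)).mono
    (le_iSup₂ (f := fun i (_ : i ∈ s) => MeasurableSpace.comap (ξ i) inferInstance) i hi) le_rfl

lemma exp_RS_integrable {ξ : ℕ → Ω → ℝ} (hm : ∀ k, Measurable (ξ k)) (hi : iIndepFun ξ μ)
    (Φ : ℝ) (hint : ∀ k, Integrable (fun ω => Real.exp (-(Φ * ξ k ω))) μ) (k : ℕ) :
    Integrable (fun ω => Real.exp (-(Φ * RS ξ k ω))) μ := by
  induction k with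
  | zero => simp [RS]
  | succ k ih =>
    have hind : IndepFun (fun ω => Real.exp (-(Φ * RS ξ k ω))) (fun ω => Real.exp (-(Φ * ξ k ω))) μ := by
      refine indep_of_past hm hi (Set.Iio k) {k} (by simp) ?_ ?_
      · have : Measurable[⨆ i ∈ Set.Iio k, MeasurableSpace.comap (ξ i) inferInstance] (RS ξ k) := by
          unfold RS
          exact Finset.measurable_sum _ fun i hi => meas_past ξ _ i (by simpa using hi)
        exact Real.measurable_exp.comp ((this.const_mul Φ).neg)
      · exact Real.measurable_exp.comp (((meas_past ξ {k} k rfl).const_mul Φ).neg)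
    refine (hind.integrable_mul ih (hint k)).congr (ae_of_all _ fun ω => ?_)
    simp only [Pi.mul_apply, RS_succ, ← Real.exp_add]
    congr 1; ring

lemma mart_step {ξ : ℕ → Ω → ℝ} (hm : ∀ k, Measurable (ξ k)) (hi : iIndepFun ξ μ)
    (Φ r : ℝ) (hint : ∀ k, Integrable (fun ω => Real.exp (-(Φ * ξ k ω))) μ)
    (hr : ∀ k, r * ∫ ω, Real.exp (-(Φ * ξ k ω)) ∂μ = 1) (y : ℝ) (n : ℕ) :
    ∫ ω in RB ξ y n, Real.exp (-(Φ * RS ξ n ω)) ∂μ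
      = r * ∫ ω in RB ξ y n, Real.exp (-(Φ * RS ξ (n+1) ω)) ∂μ := by
  have hRS : ∀ j ≤ n, Measurable[⨆ i ∈ Set.Iio n, MeasurableSpace.comap (ξ i) inferInstance] (RS ξ j) := by
    intro j hj
    unfold RS
    refine Finset.measurable_sum _ fun i hi => meas_past ξ _ i ?_
    have := Finset.mem_range.1 hi
    exact lt_of_lt_of_le this hj
  have hBm : MeasurableSet[⨆ i ∈ Set.Iio n, MeasurableSpace.comap (ξ i) inferInstance] (RB ξ y n) := by
    have : RB ξ y n = ⋂ j, ⋂ (_ : j ≤ n), {ω | -y ≤ RS ξ j ω} := by ext; simp [RB]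
    rw [this]
    exact MeasurableSet.iInter fun j => MeasurableSet.iInter fun hj =>
      (hRS j hj) measurableSet_Ici
  have hind : IndepFun ((RB ξ y n).indicator fun ω => Real.exp (-(Φ * RS ξ n ω)))
      (fun ω => Real.exp (-(Φ * ξ n ω))) μ := by
    refine indep_of_past hm hi (Set.Iio n) {n} (by simp) ?_ ?_
    · exact (Real.measurable_exp.comp (((hRS n le_rfl).const_mul Φ).neg)).indicator hBm
    · exact Real.measurable_exp.comp (((meas_past ξ {n} n rfl).const_mul Φ).neg)
  have h1 := hind.integral_fun_mul_eq_mul_integral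
    (((Real.measurable_exp.comp (((RS_meas hm n).const_mul Φ).neg)).indicator
      (RB_meas hm y n)).aestronglyMeasurable) (hint n).1
  rw [integral_indicator (RB_meas hm y n)] at h1
  have h2 : ∫ ω in RB ξ y n, Real.exp (-(Φ * RS ξ (n+1) ω)) ∂μ
      = (∫ ω in RB ξ y n, Real.exp (-(Φ * RS ξ n ω)) ∂μ) * ∫ ω, Real.exp (-(Φ * ξ n ω)) ∂μ := by
    rw [← h1, ← integral_indicator (RB_meas hm y n)]
    congr 1; ext ω
    by_cases h : ω ∈ RB ξ y n
    · simp only [Set.indicator_of_mem h, RS_succ, ← Real.exp_add]; congr 1; ring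
    · simp [Set.indicator_of_notMem h]
  rw [h2, mul_left_comm, hr n, mul_one]

lemma mart_id {ξ : ℕ → Ω → ℝ} (hm : ∀ k, Measurable (ξ k)) (hi : iIndepFun ξ μ)
    (Φ r : ℝ) (hint : ∀ k, Integrable (fun ω => Real.exp (-(Φ * ξ k ω))) μ)
    (hr : ∀ k, r * ∫ ω, Real.exp (-(Φ * ξ k ω)) ∂μ = 1) (y : ℝ) (hy : 0 ≤ y) (n : ℕ) :
    ∑ k ∈ Finset.range (n+1), r^k * ∫ ω in RA ξ y k, Real.exp (-(Φ * RS ξ k ω)) ∂μ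
      + r^n * ∫ ω in RB ξ y n, Real.exp (-(Φ * RS ξ n ω)) ∂μ = 1 := by
  induction n with
  | zero =>
    have h0 : RA ξ y 0 = ∅ := by ext; simp [RA, RS_zero, hy]
    have h1 : RB ξ y 0 = univ := by ext; simp [RB, RS_zero, hy]
    simp [h0, h1, RS_zero]
  | succ n ih =>
    rw [Finset.sum_range_succ, ← ih, mart_step hm hi Φ r hint hr y n]
    have hu : RB ξ y n = RA ξ y (n+1) ∪ RB ξ y (n+1) := by
      ext ω
      simp only [RB, RA, mem_ofPred_eq, mem_union, Nat.lt_succ_iff]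
      constructor
      · intro h
        by_cases hc : RS ξ (n+1) ω < -y
        · exact Or.inl ⟨h, hc⟩
        · refine Or.inr fun j hj => ?_
          rcases Nat.le_succ_iff.1 hj with h' | h'
          · exact h j h'
          · subst h'; exact not_lt.1 hc
      · rintro (h | h)
        · exact h.1
        · exact fun j hj => h j (by omega)
    have hd : Disjoint (RA ξ y (n+1)) (RB ξ y (n+1)) := by
      rw [Set.disjoint_left]
      rintro ω ⟨_, h⟩ h'
      exact absurd (h' (n+1) le_rfl) (not_le.2 h)
    rw [hu, setIntegral_union hd (RB_meas hm y _)
      (exp_RS_integrable hm hi Φ hint _).integrableOn (exp_RS_integrable hm hi Φ hint _).integrableOn]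
    ring

end RW

section RWA
variable {Ω : Type*} [MeasurableSpace Ω] {μ : Measure Ω} [IsProbabilityMeasure μ]

lemma rwA_bound {ξ : ℕ → Ω → ℝ} (hm : ∀ k, Measurable (ξ k)) (hi : iIndepFun ξ μ)
    (Φ r : ℝ) (hΦ : 0 < Φ) (hr0 : 0 < r) (hr1 : r < 1)
    (hint : ∀ k, Integrable (fun ω => Real.exp (-(Φ * ξ k ω))) μ)
    (hr : ∀ k, r * ∫ ω, Real.exp (-(Φ * ξ k ω)) ∂μ = 1) (y : ℝ) (hy : 0 ≤ y)
    (ε η : ℝ) (hη : ∀ k, ∫ ω in {ω | ξ k ω < -ε}, Real.exp (-(Φ * ξ k ω)) ∂μ = η) (n : ℕ) :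
    ∑ k ∈ Finset.range (n+1), r^k * μ.real (RA ξ y k) ≤ Real.exp (-(Φ * y)) ∧
    Real.exp (-(Φ * y)) ≤ Real.exp (Φ * ε) * ∑ k ∈ Finset.range (n+1), r^k * μ.real (RA ξ y k)
      + η / (1 - r) + r^n := by
  have hid := mart_id hm hi Φ r hint hr y hy n
  have hSi := exp_RS_integrable hm hi Φ hint
  have hη0 : 0 ≤ η := by
    rw [← hη 0]; exact integral_nonneg fun ω => (Real.exp_pos _).le
  have hey : Real.exp (-(Φ*y)) * Real.exp (Φ * y) = 1 := by rw [← Real.exp_add]; simp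
  have hep := Real.exp_pos (Φ*y)
  have hep' := Real.exp_pos (-(Φ*y))
  have hlow : ∀ k, Real.exp (Φ*y) * μ.real (RA ξ y k) ≤
      ∫ ω in RA ξ y k, Real.exp (-(Φ * RS ξ k ω)) ∂μ := by
    intro k
    have : ∫ ω in RA ξ y k, Real.exp (Φ*y) ∂μ ≤ ∫ ω in RA ξ y k, Real.exp (-(Φ * RS ξ k ω)) ∂μ := by
      refine setIntegral_mono_on (integrable_const _).integrableOn (hSi k).integrableOn
        (RA_meas hm y k) fun ω hω => ?_
      apply Real.exp_le_exp.2
      nlinarith [hω.2]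
    simpa [mul_comm] using this
  have hup : ∀ k, ∫ ω in RA ξ y k, Real.exp (-(Φ * RS ξ k ω)) ∂μ ≤
      Real.exp (Φ*y) * (Real.exp (Φ*ε) * μ.real (RA ξ y k) + η) := by
    intro k
    cases k with
    | zero =>
      have h0 : RA ξ y 0 = ∅ := by ext; simp [RA, RS_zero, hy]
      simp [h0]; positivity
    | succ k =>
      have hsm : MeasurableSet {ω | ξ k ω < -ε} := measurableSet_lt (hm k) measurable_const
      have hii : Integrable ({ω | ξ k ω < -ε}.indicator fun ω => Real.exp (-(Φ * ξ k ω))) μ :=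
        (hint k).indicator hsm
      calc ∫ ω in RA ξ y (k+1), Real.exp (-(Φ * RS ξ (k+1) ω)) ∂μ
          ≤ ∫ ω in RA ξ y (k+1), (Real.exp (Φ*y) * Real.exp (Φ*ε) + Real.exp (Φ*y) *
              ({ω | ξ k ω < -ε}.indicator fun ω => Real.exp (-(Φ * ξ k ω))) ω) ∂μ := by
            refine setIntegral_mono_on (hSi _).integrableOn
              (((integrable_const _).add (hii.const_mul _)).integrableOn)
              (RA_meas hm y _) fun ω hω => ?_
            have h1 := hω.1 k (Nat.lt_succ_self k)
            have h2 := RS_succ ξ k ω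
            by_cases hc : -ε ≤ y + RS ξ (k+1) ω
            · have : Real.exp (-(Φ * RS ξ (k+1) ω)) ≤ Real.exp (Φ*y) * Real.exp (Φ*ε) := by
                rw [← Real.exp_add]; apply Real.exp_le_exp.2; nlinarith
              have h3 : 0 ≤ ({ω | ξ k ω < -ε}.indicator fun ω => Real.exp (-(Φ * ξ k ω))) ω :=
                Set.indicator_nonneg (fun ω _ => (Real.exp_pos _).le) ω
              nlinarith
            · push Not at hc
              have hmem : ω ∈ {ω | ξ k ω < -ε} := by
                simp only [mem_ofPred_eq]; linarith
              rw [Set.indicator_of_mem hmem, ← Real.exp_add, ← Real.exp_add]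
              have : Real.exp (-(Φ * RS ξ (k+1) ω)) ≤ Real.exp (Φ * y + -(Φ * ξ k ω)) := by
                apply Real.exp_le_exp.2; nlinarith
              linarith [Real.exp_pos (Φ*y + Φ*ε)]
        _ = Real.exp (Φ*y) * (Real.exp (Φ*ε) * μ.real (RA ξ y (k+1)) +
              ∫ ω in RA ξ y (k+1),
                ({ω | ξ k ω < -ε}.indicator fun ω => Real.exp (-(Φ * ξ k ω))) ω ∂μ) := by
            rw [integral_add (integrable_const _).integrableOn (hii.const_mul _).integrableOn,
              setIntegral_const, integral_const_mul]
            simp only [smul_eq_mul]; ring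
        _ ≤ _ := by
            gcongr
            rw [← hη k, ← integral_indicator hsm]
            exact setIntegral_le_integral hii
              (ae_of_all _ fun ω => Set.indicator_nonneg (fun ω _ => (Real.exp_pos _).le) ω)
  have hB : ∫ ω in RB ξ y n, Real.exp (-(Φ * RS ξ n ω)) ∂μ ≤ Real.exp (Φ*y) := by
    calc _ ≤ ∫ ω in RB ξ y n, Real.exp (Φ*y) ∂μ := by
          refine setIntegral_mono_on (hSi n).integrableOn (integrable_const _).integrableOn
            (RB_meas hm y n) fun ω hω => ?_
          apply Real.exp_le_exp.2
          nlinarith [hω n le_rfl]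
      _ = Real.exp (Φ*y) * μ.real (RB ξ y n) := by simp [mul_comm]
      _ ≤ _ := by nlinarith [measureReal_le_one (μ := μ) (s := RB ξ y n)]
  have hB0 : 0 ≤ ∫ ω in RB ξ y n, Real.exp (-(Φ * RS ξ n ω)) ∂μ :=
    integral_nonneg fun ω => (Real.exp_pos _).le
  set V := ∑ k ∈ Finset.range (n+1), r^k * μ.real (RA ξ y k) with hV
  set W := ∑ k ∈ Finset.range (n+1), r^k * ∫ ω in RA ξ y k, Real.exp (-(Φ * RS ξ k ω)) ∂μ with hW
  have hrn : 0 < r^n := pow_pos hr0 n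
  have h1 : Real.exp (Φ*y) * V ≤ W := by
    rw [hV, hW, Finset.mul_sum]
    refine Finset.sum_le_sum fun k _ => ?_
    rw [mul_left_comm]
    exact mul_le_mul_of_nonneg_left (hlow k) (pow_pos hr0 k).le
  have hg : ∑ k ∈ Finset.range (n+1), r^k ≤ 1/(1-r) := by
    rw [geom_sum_eq hr1.ne, ← neg_div_neg_eq]
    apply div_le_div_of_nonneg_right _ (by linarith) |>.trans_eq
    · congr 1; ring
    · have := pow_pos hr0 (n+1); linarith
  have h2 : W ≤ Real.exp (Φ*y) * (Real.exp (Φ*ε) * V + η / (1 - r)) := by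
    have : W ≤ Real.exp (Φ*y) * (Real.exp (Φ*ε) * V + η * ∑ k ∈ Finset.range (n+1), r^k) := by
      rw [hV, hW, Finset.mul_sum, Finset.mul_sum, ← Finset.sum_add_distrib, Finset.mul_sum]
      refine Finset.sum_le_sum fun k _ => ?_
      refine (mul_le_mul_of_nonneg_left (hup k) (pow_pos hr0 k).le).trans_eq ?_
      ring
    refine this.trans ?_
    have h3 : η / (1-r) = η * (1/(1-r)) := by ring
    rw [h3]
    gcongr
  constructor
  · have : Real.exp (Φ*y) * V ≤ 1 := by nlinarith
    calc V = Real.exp (-(Φ*y)) * (Real.exp (Φ*y) * V) := by rw [← mul_assoc, hey, one_mul]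
      _ ≤ Real.exp (-(Φ*y)) * 1 := by gcongr
      _ = _ := mul_one _
  · have : 1 ≤ Real.exp (Φ*y) * (Real.exp (Φ*ε) * V + η / (1 - r) + r^n) := by nlinarith
    calc Real.exp (-(Φ*y)) = Real.exp (-(Φ*y)) * 1 := (mul_one _).symm
      _ ≤ Real.exp (-(Φ*y)) * (Real.exp (Φ*y) * (Real.exp (Φ*ε) * V + η / (1 - r) + r^n)) := by gcongr
      _ = _ := by rw [← mul_assoc, hey, one_mul]

lemma rwA {ξ : ℕ → Ω → ℝ} (hm : ∀ k, Measurable (ξ k)) (hi : iIndepFun ξ μ)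
    (Φ r : ℝ) (hΦ : 0 < Φ) (hr0 : 0 < r) (hr1 : r < 1)
    (hint : ∀ k, Integrable (fun ω => Real.exp (-(Φ * ξ k ω))) μ)
    (hr : ∀ k, r * ∫ ω, Real.exp (-(Φ * ξ k ω)) ∂μ = 1) (y : ℝ) (hy : 0 ≤ y)
    (ε η : ℝ) (hη : ∀ k, ∫ ω in {ω | ξ k ω < -ε}, Real.exp (-(Φ * ξ k ω)) ∂μ = η)
    (h : ℝ) (hh : 0 < h) (e : Ω → ℝ) (he : Measurable e)
    (hprod : ∀ k : ℕ, μ.real ({ω | k * h < e ω} ∩ RA ξ y k) = r^k * μ.real (RA ξ y k)) :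
    μ.real {ω | ∃ k : ℕ, k * h < e ω ∧ RS ξ k ω < -y} ≤ Real.exp (-(Φ * y)) ∧
    Real.exp (-(Φ * y)) ≤
      Real.exp (Φ * ε) * μ.real {ω | ∃ k : ℕ, k * h < e ω ∧ RS ξ k ω < -y} + η / (1 - r) := by
  have hset : {ω | ∃ k : ℕ, k * h < e ω ∧ RS ξ k ω < -y}
      = ⋃ k : ℕ, ({ω | k * h < e ω} ∩ RA ξ y k) := by
    ext ω
    simp only [mem_ofPred_eq, mem_iUnion, mem_inter_iff, RA]
    constructor
    · rintro ⟨k, hk, hS⟩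
      classical
      have hex : ∃ k, RS ξ k ω < -y := ⟨k, hS⟩
      refine ⟨Nat.find hex, ?_, ?_, Nat.find_spec hex⟩
      · have : ((Nat.find hex : ℕ) : ℝ) ≤ k := by exact_mod_cast Nat.find_min' hex hS
        nlinarith
      · intro j hj
        exact not_lt.1 (Nat.find_min hex hj)
    · rintro ⟨k, hk, _, hS⟩; exact ⟨k, hk, hS⟩
  have hdisj : Pairwise (Function.onFun Disjoint fun k : ℕ => ({ω | k * h < e ω} ∩ RA ξ y k)) := by
    have key : ∀ i j : ℕ, i < j →
        Disjoint ({ω | i * h < e ω} ∩ RA ξ y i) ({ω | j * h < e ω} ∩ RA ξ y j) := by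
      intro i j hij
      rw [Set.disjoint_left]
      rintro ω ⟨_, h1⟩ ⟨_, h2⟩
      exact absurd (h2.1 i hij) (not_le.2 h1.2)
    intro i j hij
    rcases lt_or_gt_of_ne hij with h' | h'
    · exact key i j h'
    · exact (key j i h').symm
  have hmeasset : ∀ k : ℕ, MeasurableSet ({ω | k * h < e ω} ∩ RA ξ y k) := fun k =>
    (measurableSet_lt measurable_const he).inter (RA_meas hm y k)
  have hsum : HasSum (fun k : ℕ => r^k * μ.real (RA ξ y k))
      (μ.real {ω | ∃ k : ℕ, k * h < e ω ∧ RS ξ k ω < -y}) := by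
    simp_rw [← hprod]
    rw [hset]
    unfold Measure.real
    rw [measure_iUnion hdisj hmeasset]
    rw [ENNReal.tsum_toReal_eq fun k => measure_ne_top _ _]
    refine (ENNReal.hasSum_toReal ?_)
    rw [← measure_iUnion hdisj hmeasset]; exact measure_ne_top _ _
  have ht := (tendsto_add_atTop_iff_nat 1).2 hsum.tendsto_sum_nat
  have hb := rwA_bound hm hi Φ r hΦ hr0 hr1 hint hr y hy ε η hη
  constructor
  · exact le_of_tendsto' ht fun n => (hb n).1
  · have h2 := ((ht.const_mul (Real.exp (Φ*ε))).add_const (η/(1-r))).add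
      (tendsto_pow_atTop_nhds_zero_of_lt_one hr0.le hr1)
    rw [add_zero] at h2
    exact ge_of_tendsto' h2 fun n => (hb n).2

end RWA

section MGF
variable {Ω : Type*} [MeasurableSpace Ω] {μ : Measure Ω} [IsProbabilityMeasure μ]

lemma exp_int_le {ξ : Ω → ℝ} (hm : Measurable ξ) {a b : ℝ} (ha : 0 ≤ a) (hab : a ≤ b)
    (hb : Integrable (fun ω => Real.exp (-(b * ξ ω))) μ) :
    Integrable (fun ω => Real.exp (-(a * ξ ω))) μ := by
  refine ((integrable_const (1:ℝ)).add hb).mono'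
    (Real.measurable_exp.comp ((hm.const_mul a).neg)).aestronglyMeasurable
    (ae_of_all _ fun ω => ?_)
  simp only [Real.norm_eq_abs, Real.abs_exp, Pi.add_apply]
  rcases le_total 0 (ξ ω) with h | h
  · have : Real.exp (-(a * ξ ω)) ≤ 1 := Real.exp_le_one_iff.2 (by nlinarith)
    linarith [Real.exp_pos (-(b * ξ ω))]
  · have : Real.exp (-(a * ξ ω)) ≤ Real.exp (-(b * ξ ω)) := Real.exp_le_exp.2 (by nlinarith)
    linarith

lemma tendsto_mgf_zero {ξ : Ω → ℝ} (hm : Measurable ξ) (hi : Integrable ξ μ)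
    (he : Integrable (fun ω => Real.exp (-(1 * ξ ω))) μ) :
    Tendsto (fun θ : ℝ => ((∫ ω, Real.exp (-(θ * ξ ω)) ∂μ) - 1) / θ) (nhdsWithin 0 (Ioi 0))
      (nhds (-∫ ω, ξ ω ∂μ)) := by
  have h1 : Tendsto (fun θ : ℝ => ∫ ω, (Real.exp (-(θ * ξ ω)) - 1) / θ ∂μ) (nhdsWithin 0 (Ioi 0))
      (nhds (∫ ω, -ξ ω ∂μ)) := by
    refine tendsto_integral_filter_of_dominated_convergence
      (fun ω => |ξ ω| + (Real.exp (-(1 * ξ ω)) + 1)) ?_ ?_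
      (hi.abs.add (he.add (integrable_const 1))) ?_
    · exact Eventually.of_forall fun θ => (((Real.measurable_exp.comp
        ((hm.const_mul θ).neg)).sub_const 1).div_const θ).aestronglyMeasurable
    · have : Ioc (0:ℝ) 1 ∈ nhdsWithin (0:ℝ) (Ioi 0) := Ioc_mem_nhdsGT one_pos
      filter_upwards [this] with θ hθ
      refine ae_of_all _ fun ω => ?_
      have hl : -ξ ω ≤ (Real.exp (-(θ * ξ ω)) - 1) / θ := by
        rw [le_div_iff₀ hθ.1]
        have := Real.add_one_le_exp (-(θ * ξ ω)); linarith
      have hu : (Real.exp (-(θ * ξ ω)) - 1) / θ ≤ Real.exp (-(1 * ξ ω)) - 1 := by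
        rw [div_le_iff₀ hθ.1]
        have := convexOn_exp.2 (mem_univ (-(1 * ξ ω))) (mem_univ (0:ℝ)) hθ.1.le
          (sub_nonneg.2 hθ.2) (by ring)
        simp only [smul_eq_mul, mul_zero, add_zero, Real.exp_zero, mul_one] at this
        have h2 : θ * -(1 * ξ ω) = -(θ * ξ ω) := by ring
        rw [h2] at this; linarith
      rw [Real.norm_eq_abs, abs_le]
      have := Real.exp_pos (-(1 * ξ ω))
      constructor
      · linarith [le_abs_self (ξ ω)]
      · linarith [abs_nonneg (ξ ω)]
    · refine ae_of_all _ fun ω => ?_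
      have hd : HasDerivAt (fun θ : ℝ => Real.exp (-(θ * ξ ω))) (-ξ ω) 0 := by
        have := (((hasDerivAt_id (0:ℝ)).mul_const (ξ ω)).neg).exp
        simpa using this
      have := (hasDerivAt_iff_tendsto_slope.1 hd).mono_left
        (nhdsWithin_mono (0:ℝ) (s := Ioi 0) (fun x hx => (ne_of_gt hx : x ≠ 0)))
      refine this.congr' (Eventually.of_forall fun θ => ?_)
      simp [slope_def_field]
  rw [integral_neg] at h1
  refine h1.congr' ?_
  have : Ioc (0:ℝ) 1 ∈ nhdsWithin (0:ℝ) (Ioi 0) := Ioc_mem_nhdsGT one_pos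
  filter_upwards [this] with θ hθ
  rw [integral_div, integral_sub (exp_int_le hm hθ.1.le hθ.2 he) (integrable_const 1)]
  simp

end MGF

section RWB
variable {Ω : Type*} [MeasurableSpace Ω] {μ : Measure Ω} [IsProbabilityMeasure μ]

lemma RS_bdd {ξ : ℕ → Ω → ℝ} (hi : iIndepFun ξ μ)
    (hid : ∀ k, IdentDistrib (ξ k) (ξ 0) μ μ) (hint : Integrable (ξ 0) μ)
    (hneg : ∫ ω, ξ 0 ω ∂μ < 0) : ∀ᵐ ω ∂μ, BddAbove (range fun k => RS ξ k ω) := by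
  have := strong_law_ae_real ξ hint (fun i j hij => hi.indepFun hij) hid
  filter_upwards [this] with ω hω
  have h1 := (hω.eventually (gt_mem_nhds hneg))
  obtain ⟨N, hN⟩ := eventually_atTop.1 h1
  have h2 : ∀ᶠ k in atTop, RS ξ k ω ≤ 0 := by
    filter_upwards [eventually_ge_atTop (max N 1)] with k hk
    have h3 := hN k ((le_max_left _ _).trans hk)
    have hk1 : 1 ≤ k := (le_max_right _ _).trans hk
    have hk0 : (0:ℝ) < k := by exact_mod_cast hk1
    rw [div_lt_iff₀ hk0, zero_mul] at h3
    exact h3.le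
  exact (isBoundedUnder_of_eventually_le h2).bddAbove_range

lemma rwB_eq {ξ : ℕ → Ω → ℝ} (hm : ∀ k, Measurable (ξ k)) (hi : iIndepFun ξ μ)
    (hid : ∀ k, IdentDistrib (ξ k) (ξ 0) μ μ) (hint : Integrable (ξ 0) μ)
    (hneg : ∫ ω, ξ 0 ω ∂μ < 0)
    (hexp : ∀ θ : ℝ, 0 ≤ θ → Integrable (fun ω => Real.exp (-(θ * ξ 0 ω))) μ) :
    ∃ z : Ω → ℝ, Measurable z ∧ (∀ ω, 0 ≤ z ω) ∧ (∀ᵐ ω ∂μ, z ω ≤ max 0 (-ξ 0 ω)) ∧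
      ∀ θ : ℝ, 0 < θ →
      (∫ ω, Real.exp (-(θ * ⨆ k, RS ξ k ω)) ∂μ) * ((∫ ω, Real.exp (-(θ * ξ 0 ω)) ∂μ) - 1)
      = ∫ ω, (Real.exp (θ * z ω) - 1) ∂μ := by
  set ξ' : ℕ → Ω → ℝ := fun j => ξ (j+1) with hξ'
  have hm' : ∀ k, Measurable (ξ' k) := fun k => hm _
  have hi' : iIndepFun ξ' μ := hi.precomp (g := fun j : ℕ => j + 1) (add_left_injective 1)
  have hidd : IdentDistrib (fun ω => (ξ' · ω)) (fun ω => (ξ · ω)) μ μ :=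
    IdentDistrib.pi (fun k => (hid (k+1)).trans (hid k).symm) hi' hi
  set Q : Ω → ℝ := fun ω => ⨆ k, RS ξ k ω with hQ
  set Q' : Ω → ℝ := fun ω => ⨆ k, RS ξ' k ω with hQ'
  have hφ : Measurable (fun v : ℕ → ℝ => ⨆ k, ∑ j ∈ Finset.range k, v j) :=
    Measurable.iSup fun k => Finset.measurable_sum _ fun i _ => measurable_pi_apply i
  have hQQ : IdentDistrib Q' Q μ μ := hidd.comp hφ
  have hQm : Measurable Q := Measurable.iSup fun k => RS_meas hm k
  have hQm' : Measurable Q' := Measurable.iSup fun k => RS_meas hm' k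
  have hbd := RS_bdd hi hid hint hneg
  have hrel : ∀ᵐ ω ∂μ, 0 ≤ Q' ω ∧ Q ω = max 0 (ξ 0 ω + Q' ω) := by
    filter_upwards [hbd] with ω hω
    have hbd' : BddAbove (range fun k => RS ξ' k ω) := by
      obtain ⟨C, hC⟩ := hω
      refine ⟨C - ξ 0 ω, ?_⟩
      rintro _ ⟨k, rfl⟩
      have := hC ⟨k+1, rfl⟩
      simp only [RS_succ'] at this
      show RS ξ' k ω ≤ _
      linarith
    have h0 : 0 ≤ Q' ω := by
      have := le_ciSup hbd' 0
      simpa [RS_zero] using this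
    refine ⟨h0, le_antisymm ?_ ?_⟩
    · refine ciSup_le fun k => ?_
      cases k with
      | zero => simp [RS_zero]
      | succ k =>
        rw [RS_succ']
        have := le_ciSup hbd' k
        exact le_max_of_le_right (by simp only [hQ']; linarith)
    · refine max_le ?_ ?_
      · have := le_ciSup hω 0
        simpa [RS_zero] using this
      · rw [add_comm, ← le_sub_iff_add_le]
        refine ciSup_le fun k => ?_
        have := le_ciSup hω (k+1)
        simp only [RS_succ'] at this
        simp only [hQ]
        show RS ξ' k ω ≤ _
        linarith
  have hind : IndepFun (ξ 0) Q' μ := by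
    refine indep_of_past hm hi {0} (Set.Ici 1) (by simp) (meas_past ξ _ 0 rfl) ?_
    refine Measurable.iSup fun k => ?_
    unfold RS
    exact Finset.measurable_sum _ fun i _ => meas_past ξ _ (i+1) (by simp)
  refine ⟨fun ω => max 0 (-(ξ 0 ω + Q' ω)), measurable_const.max ((hm 0).add hQm').neg,
    fun ω => le_max_left _ _, ?_, fun θ hθ => ?_⟩
  · filter_upwards [hrel] with ω hω
    exact max_le_max le_rfl (by linarith [hω.1])
  have hQi : Integrable (fun ω => Real.exp (-(θ * Q ω))) μ := by
    refine (integrable_const (1:ℝ)).mono'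
      (Real.measurable_exp.comp ((hQm.const_mul θ).neg)).aestronglyMeasurable ?_
    filter_upwards [hrel] with ω hω
    simp only [Real.norm_eq_abs, Real.abs_exp]
    have : 0 ≤ Q ω := by rw [hω.2]; exact le_max_left _ _
    exact Real.exp_le_one_iff.2 (by nlinarith)
  have hcm : Measurable (fun u : ℝ => Real.exp (-(θ * u))) := by fun_prop
  have hQQe : ∫ ω, Real.exp (-(θ * Q' ω)) ∂μ = ∫ ω, Real.exp (-(θ * Q ω)) ∂μ :=
    (hQQ.comp hcm).integral_eq
  have hQi' : Integrable (fun ω => Real.exp (-(θ * Q' ω))) μ :=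
    (hQQ.comp hcm).integrable_iff.2 hQi
  have hind2 := hind.comp hcm hcm
  have hpi : Integrable (fun ω => Real.exp (-(θ * ξ 0 ω)) * Real.exp (-(θ * Q' ω))) μ :=
    hind2.integrable_mul (hexp θ hθ.le) hQi'
  have hpe : ∫ ω, Real.exp (-(θ * ξ 0 ω)) * Real.exp (-(θ * Q' ω)) ∂μ
      = (∫ ω, Real.exp (-(θ * ξ 0 ω)) ∂μ) * ∫ ω, Real.exp (-(θ * Q' ω)) ∂μ :=
    hind2.integral_fun_mul_eq_mul_integral (hexp θ hθ.le).1 hQi'.1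
  rw [hQQe] at hpe
  have : ∫ ω, (Real.exp (θ * max 0 (-(ξ 0 ω + Q' ω))) - 1) ∂μ
      = ∫ ω, (Real.exp (-(θ * ξ 0 ω)) * Real.exp (-(θ * Q' ω)) - Real.exp (-(θ * Q ω))) ∂μ := by
    refine integral_congr_ae ?_
    filter_upwards [hrel] with ω hω
    rw [hω.2, ← Real.exp_add]
    rcases le_total 0 (ξ 0 ω + Q' ω) with h | h
    · rw [max_eq_left (by linarith), max_eq_right h]
      simp only [mul_zero, Real.exp_zero]
      rw [show -(θ * ξ 0 ω) + -(θ * Q' ω) = -(θ * (ξ 0 ω + Q' ω)) by ring]; ring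
    · rw [max_eq_right (by linarith), max_eq_left h]
      simp only [mul_zero, neg_zero, Real.exp_zero]
      rw [show -(θ * ξ 0 ω) + -(θ * Q' ω) = θ * -(ξ 0 ω + Q' ω) by ring]
  rw [this, integral_sub hpi hQi, hpe]
  ring

lemma rwB {ξ : ℕ → Ω → ℝ} (hm : ∀ k, Measurable (ξ k)) (hi : iIndepFun ξ μ)
    (hid : ∀ k, IdentDistrib (ξ k) (ξ 0) μ μ) (hint : Integrable (ξ 0) μ)
    (h : ℝ) (hh : 0 < h) (hmean : ∫ ω, ξ 0 ω ∂μ = -h)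
    (hexp : ∀ θ : ℝ, 0 ≤ θ → Integrable (fun ω => Real.exp (-(θ * ξ 0 ω))) μ)
    (x : ℝ) (hx : 0 < x) (ε η : ℝ)
    (hη : ∫ ω in {ω | ξ 0 ω < -ε}, Real.exp (-(x * ξ 0 ω)) ∂μ = η) (hε : 0 < ε) :
    x * h ≤ (∫ ω, Real.exp (-(x * ⨆ k, RS ξ k ω)) ∂μ) * ((∫ ω, Real.exp (-(x * ξ 0 ω)) ∂μ) - 1) ∧
    (∫ ω, Real.exp (-(x * ⨆ k, RS ξ k ω)) ∂μ) * ((∫ ω, Real.exp (-(x * ξ 0 ω)) ∂μ) - 1)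
      ≤ x * h * Real.exp (x * ε) + η := by
  obtain ⟨z, hzm, hz0, hzle, heq⟩ := rwB_eq hm hi hid hint (by linarith) hexp
  have hzi : Integrable z μ := by
    refine hint.abs.mono' hzm.aestronglyMeasurable ?_
    filter_upwards [hzle] with ω hω
    rw [Real.norm_eq_abs, abs_of_nonneg (hz0 ω)]
    exact hω.trans (max_le (abs_nonneg _) (neg_le_abs _))
  have hze : ∀ θ : ℝ, 0 ≤ θ → Integrable (fun ω => Real.exp (θ * z ω)) μ := by
    intro θ hθ
    refine ((integrable_const (1:ℝ)).add (hexp θ hθ)).mono'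
      (Real.measurable_exp.comp (hzm.const_mul θ)).aestronglyMeasurable ?_
    filter_upwards [hzle] with ω hω
    simp only [Real.norm_eq_abs, Real.abs_exp, Pi.add_apply]
    rcases le_total 0 (-ξ 0 ω) with h' | h'
    · rw [max_eq_right h'] at hω
      have : Real.exp (θ * z ω) ≤ Real.exp (-(θ * ξ 0 ω)) := Real.exp_le_exp.2 (by nlinarith)
      linarith
    · rw [max_eq_left h'] at hω
      have : Real.exp (θ * z ω) ≤ 1 := Real.exp_le_one_iff.2 (by nlinarith)
      linarith [Real.exp_pos (-(θ * ξ 0 ω))]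
  have hmz : ∫ ω, z ω ∂μ = h := by
    have h1 := tendsto_mgf_zero (μ := μ) (ξ := fun ω => - z ω) hzm.neg hzi.neg
      ((hze 1 zero_le_one).congr (ae_of_all _ fun ω => by simp))
    rw [integral_neg, neg_neg] at h1
    have h2 := tendsto_mgf_zero (hm 0) hint (hexp 1 zero_le_one)
    rw [hmean, neg_neg] at h2
    have h3 : Tendsto (fun θ : ℝ => ∫ ω, Real.exp (-(θ * ⨆ k, RS ξ k ω)) ∂μ)
        (nhdsWithin 0 (Ioi 0)) (nhds (∫ ω, (1:ℝ) ∂μ)) := by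
      have hQm : Measurable (fun ω => ⨆ k, RS ξ k ω) := Measurable.iSup fun k => RS_meas hm k
      refine tendsto_integral_filter_of_dominated_convergence (fun _ => 1) ?_ ?_
        (integrable_const 1) ?_
      · exact Eventually.of_forall fun θ =>
          (Real.measurable_exp.comp ((hQm.const_mul θ).neg)).aestronglyMeasurable
      · filter_upwards [self_mem_nhdsWithin] with θ hθ
        filter_upwards [RS_bdd hi hid hint (by linarith)] with ω hω
        have h0 : 0 ≤ ⨆ k, RS ξ k ω := by
          have := le_ciSup hω 0
          simpa [RS_zero] using this
        simp only [Real.norm_eq_abs, Real.abs_exp]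
        have : (0:ℝ) < θ := hθ
        exact Real.exp_le_one_iff.2 (by nlinarith)
      · refine ae_of_all _ fun ω => ?_
        have : Continuous (fun θ : ℝ => Real.exp (-(θ * ⨆ k, RS ξ k ω))) := by fun_prop
        have h4 := this.tendsto 0
        simp only [zero_mul, neg_zero, Real.exp_zero] at h4
        exact h4.mono_left nhdsWithin_le_nhds
    simp only [integral_const, probReal_univ, smul_eq_mul, mul_one] at h3
    have h5 := h3.mul h2
    rw [one_mul] at h5
    refine tendsto_nhds_unique h1 (h5.congr' ?_)
    filter_upwards [self_mem_nhdsWithin] with θ hθ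
    rw [← mul_div_assoc, heq θ hθ, integral_sub (hze θ (le_of_lt hθ)) (integrable_const 1)]
    simp
  rw [heq x hx]
  have hsm : MeasurableSet {ω | ξ 0 ω < -ε} := measurableSet_lt (hm 0) measurable_const
  have hii : Integrable ({ω | ξ 0 ω < -ε}.indicator fun ω => Real.exp (-(x * ξ 0 ω))) μ :=
    (hexp x hx.le).indicator hsm
  have hzei := (hze x hx.le).sub (integrable_const (1:ℝ))
  constructor
  · rw [← hmz, ← integral_const_mul]
    refine integral_mono (hzi.const_mul x) hzei fun ω => ?_
    have := Real.add_one_le_exp (x * z ω)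
    linarith
  · have : x * h * Real.exp (x * ε) + η = ∫ ω, (x * Real.exp (x*ε) * z ω +
        ({ω | ξ 0 ω < -ε}.indicator fun ω => Real.exp (-(x * ξ 0 ω))) ω) ∂μ := by
      rw [integral_add (hzi.const_mul _) hii, integral_const_mul, integral_indicator hsm, hη, hmz]
      ring
    rw [this]
    refine integral_mono_ae hzei ((hzi.const_mul _).add hii) ?_
    filter_upwards [hzle] with ω hω
    have hz := hz0 ω
    by_cases hc : z ω ≤ ε
    · have h1 : Real.exp (x * z ω) - 1 ≤ x * z ω * Real.exp (x * z ω) := by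
        have h2 := Real.add_one_le_exp (-(x * z ω))
        have h3 := Real.exp_pos (x * z ω)
        have h4 : Real.exp (x * z ω) * Real.exp (-(x * z ω)) = 1 := by rw [← Real.exp_add]; simp
        nlinarith
      have h2 : Real.exp (x * z ω) ≤ Real.exp (x * ε) := Real.exp_le_exp.2 (by nlinarith)
      have h3 : 0 ≤ ({ω | ξ 0 ω < -ε}.indicator fun ω => Real.exp (-(x * ξ 0 ω))) ω :=
        Set.indicator_nonneg (fun ω _ => (Real.exp_pos _).le) ω
      have h4 : x * z ω * Real.exp (x * z ω) ≤ x * z ω * Real.exp (x * ε) := by gcongr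
      linarith
    · push Not at hc
      have h5 : z ω ≤ -ξ 0 ω := by
        rcases le_total 0 (-ξ 0 ω) with h' | h'
        · rwa [max_eq_right h'] at hω
        · rw [max_eq_left h'] at hω; linarith
      have hmem : ω ∈ {ω | ξ 0 ω < -ε} := by
        simp only [mem_ofPred_eq]; linarith
      rw [Set.indicator_of_mem hmem]
      have : Real.exp (x * z ω) ≤ Real.exp (-(x * ξ 0 ω)) := Real.exp_le_exp.2 (by nlinarith)
      have h6 : 0 ≤ x * Real.exp (x*ε) * z ω := by positivity
      linarith

end RWB

/-- càdlàg without negative jumps -/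
structure GoodPath (f : ℝ → ℝ) : Prop where
  rc : ∀ t : ℝ, 0 ≤ t → ContinuousWithinAt f (Ici t) t
  ll : ∀ t : ℝ, 0 < t → ∃ l : ℝ, Tendsto f (nhdsWithin t (Iio t)) (nhds l) ∧ l ≤ f t

lemma GoodPath.sub_id {f : ℝ → ℝ} (hf : GoodPath f) : GoodPath (fun t => f t - t) where
  rc t ht := (hf.rc t ht).sub continuousWithinAt_id
  ll t ht := by
    obtain ⟨l, hl, hle⟩ := hf.ll t ht
    exact ⟨l - t, hl.sub (tendsto_id.mono_left nhdsWithin_le_nhds), by linarith⟩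

lemma exists_dyadic {s b : ℝ} (hs : 0 ≤ s) (hsb : s < b) :
    ∃ n k : ℕ, s < (k:ℝ) / 2^n ∧ (k:ℝ) / 2^n < b := by
  obtain ⟨n, hn⟩ := exists_pow_lt_of_lt_one (sub_pos.2 hsb) (by norm_num : (1/2:ℝ) < 1)
  have h2 : (0:ℝ) < 2^n := by positivity
  refine ⟨n, ⌊s * 2^n⌋₊ + 1, ?_, ?_⟩
  · rw [lt_div_iff₀ h2]; push_cast; exact Nat.lt_floor_add_one _
  · rw [div_lt_iff₀ h2]; push_cast
    have h3 := Nat.floor_le (mul_nonneg hs h2.le)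
    rw [one_div, inv_pow, inv_lt_iff_one_lt_mul₀ h2] at hn
    nlinarith

lemma GoodPath.near_dyadic {f : ℝ → ℝ} (hf : GoodPath f) {s b : ℝ} (hs : 0 ≤ s) (hsb : s < b)
    {U : Set ℝ} (hU : U ∈ nhds (f s)) : ∃ n k : ℕ, (k:ℝ)/2^n < b ∧ f ((k:ℝ)/2^n) ∈ U := by
  have h1 : f ⁻¹' U ∈ nhdsWithin s (Ici s) := hf.rc s hs hU
  obtain ⟨c, hc, hsub⟩ := (mem_nhdsGE_iff_exists_Ico_subset' hsb).1 h1
  obtain ⟨n, k, h2, h3⟩ := exists_dyadic hs (lt_min hc hsb)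
  exact ⟨n, k, h3.trans_le (min_le_right _ _), hsub ⟨h2.le, h3.trans_le (min_le_left _ _)⟩⟩

lemma GoodPath.local_bdd {f : ℝ → ℝ} (hf : GoodPath f) {s : ℝ} (hs : 0 ≤ s) {ε : ℝ} (hε : 0 < ε) :
    ∃ U : Set ℝ, IsOpen U ∧ s ∈ U ∧ (∀ u v, u ∈ U → v ∈ U → 0 ≤ u → u ≤ v → f u - ε ≤ f v) ∧
      ∃ C, ∀ u ∈ U, 0 ≤ u → C ≤ f u := by
  have h1 : ∀ᶠ u in nhdsWithin s (Ici s), |f u - f s| < ε / 2 := by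
    have := hf.rc s hs (Metric.ball_mem_nhds (f s) (half_pos hε))
    filter_upwards [this] with u hu
    simpa [Real.dist_eq] using hu
  rcases hs.eq_or_lt with h0 | h0
  · obtain ⟨U, hU, hsU, hsub⟩ := mem_nhdsWithin.1 h1
    refine ⟨U, hU, hsU, ?_, f s - ε, ?_⟩
    · intro u v hu hv hu0 huv
      have a := hsub ⟨hu, by rw [← h0]; exact hu0⟩
      have b := hsub ⟨hv, by rw [← h0]; exact hu0.trans huv⟩
      simp only [mem_ofPred_eq, abs_lt] at a b
      linarith [a.1, a.2, b.1, b.2]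
    · intro u hu hu0
      have a := hsub ⟨hu, by rw [← h0]; exact hu0⟩
      simp only [mem_ofPred_eq, abs_lt] at a
      linarith [a.1]
  · obtain ⟨l, hl, hle⟩ := hf.ll s h0
    have h2 : ∀ᶠ u in nhdsWithin s (Iio s), |f u - l| < ε / 2 := by
      have := hl (Metric.ball_mem_nhds l (half_pos hε))
      filter_upwards [this] with u hu
      simpa [Real.dist_eq] using hu
    obtain ⟨U, hU, hsU, hsub⟩ := mem_nhdsWithin.1 h1
    obtain ⟨V, hV, hsV, hsub'⟩ := mem_nhdsWithin.1 h2
    have key : ∀ u ∈ U ∩ V, (s ≤ u ∧ |f u - f s| < ε/2) ∨ (u < s ∧ |f u - l| < ε/2) := by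
      intro u hu
      rcases le_or_gt s u with h | h
      · exact Or.inl ⟨h, hsub ⟨hu.1, h⟩⟩
      · exact Or.inr ⟨h, hsub' ⟨hu.2, h⟩⟩
    refine ⟨U ∩ V, hU.inter hV, ⟨hsU, hsV⟩, ?_, l - ε, ?_⟩
    · intro u v hu hv hu0 huv
      rcases key u hu with ⟨a1, a2⟩ | ⟨a1, a2⟩ <;> rcases key v hv with ⟨b1, b2⟩ | ⟨b1, b2⟩ <;>
        rw [abs_lt] at a2 b2
      · linarith [a2.1, a2.2, b2.1, b2.2]
      · linarith
      · linarith [a2.1, a2.2, b2.1, b2.2]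
      · linarith [a2.1, a2.2, b2.1, b2.2]
    · intro u hu hu0
      rcases key u hu with ⟨a1, a2⟩ | ⟨a1, a2⟩ <;> rw [abs_lt] at a2 <;> linarith [a2.1]

lemma GoodPath.modulus {f : ℝ → ℝ} (hf : GoodPath f) {ε : ℝ} (hε : 0 < ε) :
    ∃ δ > 0, ∀ u v, 0 ≤ u → u ≤ v → u ≤ 1 → v - u < δ → f u - ε ≤ f v := by
  choose U hU hsU hprop _ using fun s : Icc (0:ℝ) 1 => hf.local_bdd s.2.1 hε
  obtain ⟨δ, hδ, h⟩ := lebesgue_number_lemma_of_metric (isCompact_Icc (a := (0:ℝ)) (b := 1)) hU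
    (fun s hs => mem_iUnion.2 ⟨⟨s, hs⟩, hsU ⟨s, hs⟩⟩)
  refine ⟨δ, hδ, fun u v hu huv hu1 hlt => ?_⟩
  obtain ⟨i, hi⟩ := h u ⟨hu, hu1⟩
  refine hprop i u v (hi (Metric.mem_ball_self hδ)) (hi ?_) hu huv
  rw [Metric.mem_ball, Real.dist_eq, abs_of_nonneg (by linarith)]; exact hlt

lemma GoodPath.bddBelow {f : ℝ → ℝ} (hf : GoodPath f) (T : ℝ) : BddBelow (f '' Icc 0 T) := by
  refine (isCompact_Icc (a := (0:ℝ)) (b := T)).induction_on (p := fun S => BddBelow (f '' S))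
    (by simp) (fun s t hst ht => ht.mono (image_mono hst))
    (fun s t hs ht => by rw [image_union]; exact hs.union ht) ?_
  intro s hs
  obtain ⟨U, hU, hsU, _, C, hC⟩ := hf.local_bdd hs.1 one_pos
  refine ⟨U ∩ Icc 0 T, inter_comm _ _ ▸ inter_mem_nhdsWithin _ (hU.mem_nhds hsU), C, ?_⟩
  rintro _ ⟨u, hu, rfl⟩
  exact hC u hu.1 hu.2.1

lemma GoodPath.inf_lt_iff {f : ℝ → ℝ} (hf : GoodPath f) {T : ℝ} (hT : 0 < T) (y : ℝ) :
    (⨅ s : Icc (0:ℝ) T, f s) < y ↔ ∃ n k : ℕ, (k:ℝ)/2^n < T ∧ f ((k:ℝ)/2^n) < y := by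
  have hb : BddBelow (range fun s : Icc (0:ℝ) T => f s) := by
    have := hf.bddBelow T
    rwa [image_eq_range] at this
  have : Nonempty (Icc (0:ℝ) T) := ⟨⟨0, le_rfl, hT.le⟩⟩
  constructor
  · intro h
    obtain ⟨⟨s, hs⟩, hlt⟩ := exists_lt_of_ciInf_lt h
    simp only at hlt
    rcases hs.2.lt_or_eq with h1 | h1
    · exact hf.near_dyadic hs.1 h1 (Iio_mem_nhds hlt)
    · subst h1
      obtain ⟨l, hl, hle⟩ := hf.ll s hT
      have h2 : ∀ᶠ u in nhdsWithin s (Iio s), f u < y := hl (Iio_mem_nhds (hle.trans_lt hlt))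
      have h3 : ∀ᶠ u in nhdsWithin s (Iio s), u ∈ Ioo 0 s := Ioo_mem_nhdsLT hT
      obtain ⟨u, hu1, hu2⟩ := (h2.and h3).exists
      exact hf.near_dyadic hu2.1.le hu2.2 (Iio_mem_nhds hu1)
  · rintro ⟨n, k, h1, h2⟩
    exact (ciInf_le hb ⟨(k:ℝ)/2^n, by positivity, h1.le⟩).trans_lt h2

lemma GoodPath.sup_le {f : ℝ → ℝ} (hf : GoodPath f) {C : ℝ}
    (hC : ∀ n k : ℕ, f ((k:ℝ)/2^n) ≤ C) (s : ℝ) (hs : 0 ≤ s) : f s ≤ C := by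
  by_contra h
  push Not at h
  obtain ⟨n, k, _, h2⟩ := hf.near_dyadic hs (lt_add_one s) (Ioi_mem_nhds h)
  exact absurd (hC n k) (not_le.2 h2)

section Levy
variable {Ω : Type*} [MeasurableSpace Ω] {μ : Measure Ω} [IsProbabilityMeasure μ]

/-- The hypotheses on `X`. -/
structure Lev (μ : Measure Ω) (X : ℝ → Ω → ℝ) : Prop where
  hmeas : ∀ t : ℝ, Measurable (X t)
  hX0 : ∀ᵐ ω ∂μ, X 0 ω = 0
  hgood : ∀ᵐ ω ∂μ, GoodPath (fun t => X t ω)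
  hstat : ∀ s t : ℝ, 0 ≤ s → s ≤ t →
      Measure.map (fun ω => X t ω - X s ω) μ = Measure.map (X (t - s)) μ
  hincr : ∀ (n : ℕ) (t : Fin (n + 1) → ℝ), (∀ i, 0 ≤ t i) → StrictMono t →
      iIndepFun
        (fun i : Fin n => fun ω => X (t i.succ) ω - X (t i.castSucc) ω) μ
  hint : Integrable (X 1) μ
  hmean : ∫ ω, X 1 ω ∂μ = 0
  hfin : ∀ θ : ℝ, 0 ≤ θ → Integrable (fun ω => Real.exp (-(θ * (X 1 ω - 1)))) μ

noncomputable def LI (X : ℝ → Ω → ℝ) (n k : ℕ) (ω : Ω) : ℝ :=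
  X (((k+1 : ℕ) : ℝ) / 2^n) ω - X ((k:ℝ) / 2^n) ω - 1 / 2^n

variable {X : ℝ → Ω → ℝ}

lemma LI_meas (H : Lev μ X) (n k : ℕ) : Measurable (LI X n k) :=
  ((H.hmeas _).sub (H.hmeas _)).sub_const _

lemma RS_LI (X : ℝ → Ω → ℝ) (n k : ℕ) (ω : Ω) :
    RS (LI X n) k ω = X ((k:ℝ) / 2^n) ω - (k:ℝ)/2^n - X 0 ω := by
  induction k with
  | zero => simp [RS_zero]
  | succ k ih => rw [RS_succ, ih, LI]; push_cast; ring

lemma LI_ident (H : Lev μ X) (n k : ℕ) : IdentDistrib (LI X n k) (LI X n 0) μ μ := by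
  have key : ∀ k : ℕ, IdentDistrib (fun ω => X (((k+1 : ℕ) : ℝ) / 2^n) ω - X ((k:ℝ) / 2^n) ω)
      (X (1/2^n)) μ μ := by
    intro k
    refine ⟨((H.hmeas _).sub (H.hmeas _)).aemeasurable, (H.hmeas _).aemeasurable, ?_⟩
    rw [H.hstat ((k:ℝ)/2^n) (((k+1 : ℕ) : ℝ) / 2^n) (by positivity) (by gcongr; simp)]
    congr 2; push_cast; ring
  exact ((key k).trans (key 0).symm).comp (measurable_id.sub_const (1/2^n))

lemma LI_indep (H : Lev μ X) (n : ℕ) : iIndepFun (LI X n) μ := by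
  rw [iIndepFun_iff_measure_inter_preimage_eq_mul]
  intro S sets hsets
  obtain ⟨N, hN⟩ : ∃ N, ∀ i ∈ S, i < N := ⟨S.sup id + 1, fun i hi =>
    Nat.lt_succ_of_le (Finset.le_sup (f := id) hi)⟩
  have h1 := H.hincr N (fun i => (i:ℕ) / 2^n) (fun i => by positivity) (by
    intro i j hij
    have : ((i:ℕ):ℝ) < (j:ℕ) := by exact_mod_cast hij
    simp only
    gcongr)
  have h2 : iIndepFun (fun i : Fin N => LI X n i) μ := by
    have := h1.comp (fun _ => fun x : ℝ => x - 1/2^n) (fun _ => measurable_id.sub_const _)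
    exact this
  have h3 := h2.measure_inter_preimage_eq_mul (S.attachFin hN) (sets := fun i => sets i)
    (fun i hi => hsets i (Finset.mem_attachFin hN |>.1 hi))
  have e1 : (⋂ i ∈ S, LI X n i ⁻¹' sets i)
      = ⋂ i ∈ S.attachFin hN, (LI X n i) ⁻¹' sets i := by
    ext ω
    simp only [mem_iInter, Finset.mem_attachFin]
    constructor
    · intro h i hi; exact h i hi
    · intro h i hi; exact h ⟨i, hN i hi⟩ hi
  rw [e1, h3]
  refine Finset.prod_bij (fun i _ => (i:ℕ)) (fun i hi => Finset.mem_attachFin hN |>.1 hi)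
    (fun i _ j _ h => Fin.ext h) (fun i hi => ⟨⟨i, hN i hi⟩, by simpa using hi, rfl⟩) (fun i _ => rfl)

/-- Laplace exponent. -/
noncomputable def psi (μ : Measure Ω) (X : ℝ → Ω → ℝ) (θ : ℝ) : ℝ :=
  Real.log (∫ ω, Real.exp (-(θ * (X 1 ω - 1))) ∂μ)

lemma RS_top (H : Lev μ X) (n : ℕ) : ∀ᵐ ω ∂μ, RS (LI X n) (2^n) ω = X 1 ω - 1 := by
  filter_upwards [H.hX0] with ω hω
  rw [RS_LI, hω]; push_cast
  rw [div_self (by positivity)]; ring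

lemma int_exp_pos (H : Lev μ X) {θ : ℝ} (hθ : 0 ≤ θ) :
    0 < ∫ ω, Real.exp (-(θ * (X 1 ω - 1))) ∂μ := integral_exp_pos (H.hfin θ hθ)

lemma psi_ge (H : Lev μ X) {θ : ℝ} (hθ : 0 ≤ θ) : θ ≤ psi μ X θ := by
  unfold psi
  rw [Real.le_log_iff_exp_le (int_exp_pos H hθ)]
  have h1 : ∫ ω, Real.exp θ * (1 - θ * X 1 ω) ∂μ ≤ ∫ ω, Real.exp (-(θ * (X 1 ω - 1))) ∂μ := by
    refine integral_mono (((integrable_const _).sub (H.hint.const_mul θ)).const_mul _)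
      (H.hfin θ hθ) fun ω => ?_
    have : -(θ * (X 1 ω - 1)) = θ + -(θ * X 1 ω) := by ring
    simp only
    rw [this, Real.exp_add]
    gcongr
    linarith [Real.add_one_le_exp (-(θ * X 1 ω))]
  rwa [integral_const_mul, integral_sub (integrable_const _) (H.hint.const_mul θ),
    integral_const_mul, H.hmean, integral_const, probReal_univ, smul_eq_mul, mul_zero, sub_zero,
    mul_one, mul_one] at h1

lemma LI_mgf (H : Lev μ X) (n : ℕ) {θ : ℝ} (hθ : 0 ≤ θ) :
    Integrable (fun ω => Real.exp (-(θ * LI X n 0 ω))) μ ∧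
    ∫ ω, Real.exp (-(θ * LI X n 0 ω)) ∂μ = Real.exp (psi μ X θ / 2^n) := by
  have hid : ∀ k, mgf (LI X n k) μ (-θ) = mgf (LI X n 0) μ (-θ) := fun k => by
    have := (LI_ident H n k).comp (u := fun u : ℝ => Real.exp (-θ * u)) (by fun_prop)
    exact this.integral_eq
  have h1 : (mgf (LI X n 0) μ (-θ))^(2^n) = Real.exp (psi μ X θ) := by
    have h2 := (LI_indep H n).mgf_sum (t := -θ) (LI_meas H n) (Finset.range (2^n))
    rw [Finset.prod_congr rfl fun k _ => hid k] at h2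
    simp only [Finset.prod_const, Finset.card_range] at h2
    rw [← h2, psi, Real.exp_log (int_exp_pos H hθ)]
    unfold mgf
    refine integral_congr_ae ?_
    filter_upwards [RS_top H n] with ω hω
    rw [← hω]
    simp [RS]
  have hnn : 0 ≤ mgf (LI X n 0) μ (-θ) := mgf_nonneg
  have h3 : mgf (LI X n 0) μ (-θ) = Real.exp (psi μ X θ / 2^n) := by
    refine (pow_left_inj₀ hnn (Real.exp_pos _).le (pow_ne_zero n two_ne_zero)).1 ?_
    rw [h1, ← Real.exp_nat_mul]
    congr 1; push_cast; field_simp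
  have h4 : ∫ ω, Real.exp (-(θ * LI X n 0 ω)) ∂μ = Real.exp (psi μ X θ / 2^n) := by
    rw [← h3]; unfold mgf; simp only [neg_mul]
  refine ⟨?_, h4⟩
  by_contra hcon
  rw [integral_undef hcon] at h4
  exact absurd h4 (Real.exp_pos _).ne

lemma LI_mgf' (H : Lev μ X) (n k : ℕ) {θ : ℝ} (hθ : 0 ≤ θ) :
    Integrable (fun ω => Real.exp (-(θ * LI X n k ω))) μ ∧
    ∫ ω, Real.exp (-(θ * LI X n k ω)) ∂μ = Real.exp (psi μ X θ / 2^n) := by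
  have := (LI_ident H n k).comp (u := fun u : ℝ => Real.exp (-(θ * u))) (by fun_prop)
  exact ⟨this.integrable_iff.2 (LI_mgf H n hθ).1, this.integral_eq.trans (LI_mgf H n hθ).2⟩

lemma LI_int (H : Lev μ X) (n : ℕ) :
    Integrable (LI X n 0) μ ∧ ∫ ω, LI X n 0 ω ∂μ = -(1 / 2^n) := by
  have h1 : Integrable (LI X n 0) μ := by
    refine ((H.hint.abs.add (integrable_const 1)).add
      (integrable_finsetSum (Finset.range (2^n)) fun k _ =>
        (LI_mgf' H n k zero_le_one).1)).mono' (LI_meas H n 0).aestronglyMeasurable ?_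
    filter_upwards [RS_top H n] with ω hω
    simp only [Pi.add_apply, one_mul, Real.norm_eq_abs]
    have hN : 2^n = (2^n - 1) + 1 := (Nat.sub_add_cancel Nat.one_le_two_pow).symm
    have hsplit : ∀ g : ℕ → ℝ, ∑ k ∈ Finset.range (2^n), g k
        = ∑ k ∈ Finset.range (2^n - 1), g (k+1) + g 0 := fun g => by
      conv_lhs => rw [hN]
      rw [Finset.sum_range_succ']
    have h2 : -(∑ k ∈ Finset.range (2^n-1), LI X n (k+1) ω)
        ≤ ∑ k ∈ Finset.range (2^n-1), Real.exp (-LI X n (k+1) ω) := by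
      rw [← Finset.sum_neg_distrib]
      refine Finset.sum_le_sum fun k _ => ?_
      linarith [Real.add_one_le_exp (-LI X n (k+1) ω)]
    have h3 : 0 ≤ ∑ k ∈ Finset.range (2^n-1), Real.exp (-LI X n (k+1) ω) :=
      Finset.sum_nonneg fun k _ => (Real.exp_pos _).le
    have h4 := Real.add_one_le_exp (-LI X n 0 ω)
    have h5 := Real.exp_pos (-LI X n 0 ω)
    rw [hsplit fun k => Real.exp (-LI X n k ω)]
    rw [RS, hsplit fun k => LI X n k ω] at hω
    rw [abs_le]
    constructor
    · linarith [abs_nonneg (X 1 ω)]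
    · linarith [le_abs_self (X 1 ω)]
  refine ⟨h1, ?_⟩
  have hk : ∀ k, Integrable (LI X n k) μ := fun k => (LI_ident H n k).integrable_iff.2 h1
  have h2 : ∫ ω, RS (LI X n) (2^n) ω ∂μ = -1 := by
    rw [integral_congr_ae (RS_top H n), integral_sub H.hint (integrable_const 1), H.hmean]; simp
  unfold RS at h2
  rw [integral_finsetSum _ fun k _ => hk k, Finset.sum_congr rfl fun k _ =>
    (LI_ident H n k).integral_eq] at h2
  simp only [Finset.sum_const, Finset.card_range, nsmul_eq_mul] at h2
  push_cast at h2
  field_simp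
  linarith

end Levy

section J
variable {Ω : Type*} [MeasurableSpace Ω] {μ : Measure Ω} [IsProbabilityMeasure μ]
variable {X : ℝ → Ω → ℝ}

lemma LI_small (H : Lev μ X) {ε : ℝ} (hε : 0 < ε) :
    Tendsto (fun n : ℕ => (2:ℝ)^n * μ.real {ω | LI X n 0 ω < -ε}) atTop (nhds 0) := by
  have hsm : ∀ n k, MeasurableSet {ω | LI X n k ω < -ε} := fun n k =>
    measurableSet_lt (LI_meas H n k) measurable_const
  set G : ℕ → Set Ω := fun n => ⋂ k ∈ Finset.range (2^n), LI X n k ⁻¹' (Ici (-ε)) with hG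
  have hGm : ∀ n, MeasurableSet (G n) := fun n =>
    Finset.measurableSet_biInter _ fun k _ => LI_meas H n k measurableSet_Ici
  have hev : ∀ᵐ ω ∂μ, ∀ᶠ n in atTop, ω ∈ G n := by
    filter_upwards [H.hgood] with ω hω
    obtain ⟨δ, hδ, hmod⟩ := hω.modulus (half_pos hε)
    have ht : Tendsto (fun n : ℕ => (1/2:ℝ)^n) atTop (nhds 0) :=
      tendsto_pow_atTop_nhds_zero_of_lt_one (by norm_num) (by norm_num)
    filter_upwards [ht.eventually (gt_mem_nhds (lt_min hδ (half_pos hε)))] with n hn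
    simp only [hG, mem_iInter, Finset.mem_range, mem_preimage, mem_Ici, LI]
    intro k hk
    have h2 : (0:ℝ) < 2^n := by positivity
    have hk' : (k:ℝ) ≤ 2^n := by exact_mod_cast hk.le
    rw [one_div, inv_pow, ← one_div] at hn
    have hd : ((k+1:ℕ):ℝ)/2^n - (k:ℝ)/2^n = 1/2^n := by push_cast; ring
    have := hmod ((k:ℝ)/2^n) (((k+1:ℕ):ℝ)/2^n) (by positivity) (by
        have : 0 < 1/(2:ℝ)^n := by positivity
        linarith) (by
      rw [div_le_one h2]; exact hk') (by
      rw [hd]; exact hn.trans_le (min_le_left _ _))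
    have h3 := hn.trans_le (min_le_right _ _)
    linarith
  have hlim : Tendsto (fun n => μ.real (G n)) atTop (nhds 1) := by
    have h1 : Tendsto (fun n => ∫ ω, (G n).indicator (fun _ => (1:ℝ)) ω ∂μ) atTop
        (nhds (∫ ω, (1:ℝ) ∂μ)) := by
      refine tendsto_integral_of_dominated_convergence (fun _ => 1) ?_ (integrable_const 1) ?_ ?_
      · exact fun n => (measurable_const.indicator (hGm n)).aestronglyMeasurable
      · intro n
        refine ae_of_all _ fun ω => ?_
        by_cases h : ω ∈ G n <;> simp [h]
      · filter_upwards [hev] with ω hω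
        refine tendsto_const_nhds.congr' ?_
        filter_upwards [hω] with n hn
        simp [hn]
    simp only [integral_const, probReal_univ, smul_eq_mul, mul_one] at h1
    refine h1.congr fun n => ?_
    rw [integral_indicator (hGm n)]; simp
  have hprod : ∀ n, μ.real (G n) = (1 - μ.real {ω | LI X n 0 ω < -ε})^(2^n) := by
    intro n
    have h1 := (LI_indep H n).measure_inter_preimage_eq_mul (Finset.range (2^n))
      (sets := fun _ => Ici (-ε)) (fun _ _ => measurableSet_Ici)
    have h2 : ∀ k, μ (LI X n k ⁻¹' Ici (-ε)) = μ (LI X n 0 ⁻¹' Ici (-ε)) := fun k =>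
      (LI_ident H n k).measure_mem_eq measurableSet_Ici
    rw [Finset.prod_congr rfl fun k _ => h2 k, Finset.prod_const, Finset.card_range] at h1
    have h3 : LI X n 0 ⁻¹' Ici (-ε) = {ω | LI X n 0 ω < -ε}ᶜ := by
      ext ω; simp
    unfold Measure.real
    rw [hG, h1, ENNReal.toReal_pow, h3]
    congr 1
    exact probReal_compl_eq_one_sub (hsm n 0)
  have hlog : Tendsto (fun n => -Real.log (μ.real (G n))) atTop (nhds 0) := by
    have := (hlim.log one_ne_zero).neg
    simpa using this
  refine squeeze_zero' (Eventually.of_forall fun n => by positivity) ?_ hlog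
  filter_upwards [hlim.eventually (lt_mem_nhds zero_lt_one)] with n hn
  rw [le_neg, Real.log_le_iff_le_exp hn, hprod]
  set p := μ.real {ω | LI X n 0 ω < -ε}
  have hp1 : p ≤ 1 := measureReal_le_one
  calc (1 - p)^(2^n) ≤ (Real.exp (-p))^(2^n) := by
        refine pow_le_pow_left₀ (by linarith) ?_ _
        linarith [Real.add_one_le_exp (-p)]
    _ = Real.exp (-(2^n * p)) := by
        rw [← Real.exp_nat_mul]; congr 1; push_cast; ring

lemma LI_eta (H : Lev μ X) {ε θ : ℝ} (hε : 0 < ε) (hθ : 0 < θ) :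
    Tendsto (fun n : ℕ => (2:ℝ)^n * ∫ ω in {ω | LI X n 0 ω < -ε}, Real.exp (-(θ * LI X n 0 ω)) ∂μ)
      atTop (nhds 0) := by
  have hsm : ∀ n, MeasurableSet {ω | LI X n 0 ω < -ε} := fun n =>
    measurableSet_lt (LI_meas H n 0) measurable_const
  set c := 1 - Real.exp (-(θ * ε)) with hc
  have hc0 : 0 < c := by
    have : Real.exp (-(θ*ε)) < 1 := Real.exp_lt_one_iff.2 (by nlinarith)
    linarith
  set a := psi μ X (2*θ) with ha
  have ha0 : 0 ≤ a := le_trans (by positivity) (psi_ge H (θ := 2*θ) (by positivity))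
  set C := a * Real.exp a / c^2 with hC
  have hC0 : 0 ≤ C := by positivity
  have hK : ∀ n : ℕ, (2:ℝ)^n * ∫ ω in {ω | LI X n 0 ω < -ε}, Real.exp (-(2*θ * LI X n 0 ω)) ∂μ ≤ C := by
    intro n
    have hN : (1:ℝ) ≤ 2^n := one_le_pow₀ (by norm_num)
    obtain ⟨i1, e1⟩ := LI_mgf H n hθ.le
    obtain ⟨i2, e2⟩ := LI_mgf H n (θ := 2*θ) (by positivity)
    have i3 : Integrable (fun ω => (Real.exp (-(2*θ * LI X n 0 ω)) - 2 * Real.exp (-(θ * LI X n 0 ω)) + 1)) μ :=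
      (i2.sub (i1.const_mul 2)).add (integrable_const 1)
    have hsq : ∀ u : ℝ, Real.exp (-(2*θ*u)) - 2 * Real.exp (-(θ*u)) + 1 = (Real.exp (-(θ*u)) - 1)^2 := by
      intro u
      have : -(2*θ*u) = -(θ*u) + -(θ*u) := by ring
      rw [this, Real.exp_add]; ring
    have h1 : c^2 * ∫ ω in {ω | LI X n 0 ω < -ε}, Real.exp (-(2*θ * LI X n 0 ω)) ∂μ
        ≤ ∫ ω, (Real.exp (-(2*θ * LI X n 0 ω)) - 2 * Real.exp (-(θ * LI X n 0 ω)) + 1) ∂μ := by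
      rw [← integral_const_mul, ← integral_indicator (hsm n)]
      refine integral_mono ((i2.const_mul _).indicator (hsm n)) i3 fun ω => ?_
      simp only [hsq]
      by_cases h : ω ∈ {ω | LI X n 0 ω < -ε}
      · rw [Set.indicator_of_mem h]
        have h' : LI X n 0 ω < -ε := h
        have h5 : -(2*θ*LI X n 0 ω) = -(θ*LI X n 0 ω) + -(θ*LI X n 0 ω) := by ring
        rw [h5, Real.exp_add, ← pow_two, ← mul_pow]
        have h6 : Real.exp (-(θ*LI X n 0 ω)) * Real.exp (-(θ*ε)) ≥ 1 := by
          rw [← Real.exp_add]; exact Real.one_le_exp (by nlinarith)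
        refine pow_le_pow_left₀ (by positivity) ?_ 2
        rw [hc]; linarith
      · rw [Set.indicator_of_notMem h]; positivity
    have h2 : ∫ ω, (Real.exp (-(2*θ * LI X n 0 ω)) - 2 * Real.exp (-(θ * LI X n 0 ω)) + 1) ∂μ
        = Real.exp (a/2^n) - 2 * Real.exp (psi μ X θ/2^n) + 1 := by
      have i4 : Integrable (fun ω => Real.exp (-(2*θ*LI X n 0 ω)) - 2*Real.exp (-(θ*LI X n 0 ω))) μ := i2.sub (i1.const_mul 2)
      rw [integral_add i4 (integrable_const 1), integral_sub i2 (i1.const_mul 2),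
        integral_const_mul, e1, e2]; simp [ha]
    have h3 : 1 ≤ Real.exp (psi μ X θ/2^n) := Real.one_le_exp (by
      have := psi_ge H hθ.le
      have : 0 ≤ psi μ X θ := by linarith
      positivity)
    have h4 : Real.exp (a/2^n) - 1 ≤ a/2^n * Real.exp a := by
      have hle : a/2^n ≤ a := div_le_self ha0 hN
      have hnn : 0 ≤ a/2^n := by positivity
      have g2 := Real.add_one_le_exp (-(a/2^n))
      have g3 := Real.exp_pos (a/2^n)
      have g4 : Real.exp (a/2^n) * Real.exp (-(a/2^n)) = 1 := by rw [← Real.exp_add]; simp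
      have g5 : Real.exp (a/2^n) ≤ Real.exp a := Real.exp_le_exp.2 hle
      nlinarith
    rw [hC, le_div_iff₀ (by positivity)]
    have h7 : c^2 * ∫ ω in {ω | LI X n 0 ω < -ε}, Real.exp (-(2*θ * LI X n 0 ω)) ∂μ ≤ a/2^n * Real.exp a := by
      linarith
    calc _ = 2^n * (c^2 * ∫ ω in {ω | LI X n 0 ω < -ε}, Real.exp (-(2*θ * LI X n 0 ω)) ∂μ) := by ring
      _ ≤ 2^n * (a/2^n * Real.exp a) := by gcongr
      _ = a * Real.exp a := by field_simp
  have hbound : ∀ l : ℝ, 0 < l → ∀ n : ℕ,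
      (2:ℝ)^n * ∫ ω in {ω | LI X n 0 ω < -ε}, Real.exp (-(θ * LI X n 0 ω)) ∂μ
      ≤ l * C + (2^n * μ.real {ω | LI X n 0 ω < -ε}) / l := by
    intro l hl n
    obtain ⟨i1, e1⟩ := LI_mgf H n hθ.le
    obtain ⟨i2, e2⟩ := LI_mgf H n (θ := 2*θ) (by positivity)
    have h1 : ∫ ω in {ω | LI X n 0 ω < -ε}, Real.exp (-(θ * LI X n 0 ω)) ∂μ
        ≤ ∫ ω in {ω | LI X n 0 ω < -ε}, (l * Real.exp (-(2*θ * LI X n 0 ω)) + 1/l) ∂μ := by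
      refine integral_mono i1.integrableOn ((i2.const_mul l).add (integrable_const _)).integrableOn
        fun ω => ?_
      have h5 : -(2*θ*LI X n 0 ω) = -(θ*LI X n 0 ω) + -(θ*LI X n 0 ω) := by ring
      simp only
      rw [h5, Real.exp_add]
      set E := Real.exp (-(θ*LI X n 0 ω))
      have hE : 0 < E := Real.exp_pos _
      have : l * (E * E) + 1/l - E = ((l * E - 1)^2 + l * E) / l := by field_simp; ring
      have h9 : 0 ≤ ((l * E - 1)^2 + l * E) / l := by positivity
      linarith
    rw [integral_add (i2.const_mul l).integrableOn (integrable_const _).integrableOn,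
      setIntegral_const, integral_const_mul] at h1
    have h2 := hK n
    have hN : (0:ℝ) < 2^n := by positivity
    calc _ ≤ 2^n * (l * ∫ ω in {ω | LI X n 0 ω < -ε}, Real.exp (-(2*θ * LI X n 0 ω)) ∂μ +
          μ.real {ω | LI X n 0 ω < -ε} • (1/l)) := by gcongr
      _ = l * (2^n * ∫ ω in {ω | LI X n 0 ω < -ε}, Real.exp (-(2*θ * LI X n 0 ω)) ∂μ) +
          (2^n * μ.real {ω | LI X n 0 ω < -ε}) / l := by simp only [smul_eq_mul]; ring
      _ ≤ _ := by gcongr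
  rw [Metric.tendsto_atTop]
  intro δ hδ
  set l := δ / (2 * (C+1)) with hl
  have hl0 : 0 < l := by positivity
  have hlC : l * C < δ/2 := by
    rw [hl, div_mul_eq_mul_div, div_lt_div_iff₀ (by positivity) (by positivity)]
    nlinarith
  have := (LI_small H hε).div_const l
  rw [zero_div] at this
  obtain ⟨N, hN⟩ := eventually_atTop.1 (this.eventually (gt_mem_nhds (half_pos hδ)))
  refine ⟨N, fun n hn => ?_⟩
  have h0 : 0 ≤ (2:ℝ)^n * ∫ ω in {ω | LI X n 0 ω < -ε}, Real.exp (-(θ * LI X n 0 ω)) ∂μ :=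
    mul_nonneg (by positivity) (integral_nonneg fun ω => (Real.exp_pos _).le)
  rw [Real.dist_eq, sub_zero, abs_of_nonneg h0]
  linarith [hbound l hl0 n, hN n hn]

lemma psi_div (H : Lev μ X) : Tendsto (fun θ : ℝ => θ / psi μ X θ) (nhdsWithin 0 (Ioi 0)) (nhds 1) := by
  have h1 := tendsto_mgf_zero (μ := μ) (ξ := fun ω => X 1 ω - 1) ((H.hmeas 1).sub_const 1)
    (H.hint.sub (integrable_const 1)) (H.hfin 1 zero_le_one)
  rw [integral_sub H.hint (integrable_const 1), H.hmean] at h1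
  simp only [integral_const, probReal_univ, smul_eq_mul, mul_one, zero_sub, neg_neg] at h1
  have h2 : Tendsto (fun θ : ℝ => psi μ X θ / θ) (nhdsWithin 0 (Ioi 0)) (nhds 1) := by
    refine tendsto_of_tendsto_of_tendsto_of_le_of_le' tendsto_const_nhds h1 ?_ ?_
    · filter_upwards [self_mem_nhdsWithin] with θ hθ
      have h0 : (0:ℝ) < θ := hθ
      rw [le_div_iff₀ h0, one_mul]
      exact psi_ge H h0.le
    · filter_upwards [self_mem_nhdsWithin] with θ hθ
      have h0 : (0:ℝ) < θ := hθ
      gcongr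
      exact Real.log_le_sub_one_of_pos (int_exp_pos H h0.le)
  have h3 := h2.inv₀ one_ne_zero
  rw [inv_one] at h3
  exact h3.congr fun θ => by rw [inv_div]

lemma psi_cont (H : Lev μ X) : ContinuousOn (psi μ X) (Ici 0) := by
  unfold psi
  refine ContinuousOn.log ?_ fun θ hθ => (int_exp_pos H hθ).ne'
  intro θ hθ
  refine continuousWithinAt_of_dominated (bound := fun ω => 1 + Real.exp (-((θ+1) * (X 1 ω - 1))))
    ?_ ?_ ((integrable_const 1).add (H.hfin (θ+1) (by have : (0:ℝ) ≤ θ := hθ; linarith))) ?_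
  · exact Eventually.of_forall fun t => (Real.measurable_exp.comp
      ((((H.hmeas 1).sub_const 1).const_mul t).neg)).aestronglyMeasurable
  · have : Iio (θ+1) ∈ nhds θ := Iio_mem_nhds (lt_add_one θ)
    filter_upwards [self_mem_nhdsWithin, mem_nhdsWithin_of_mem_nhds this] with t ht ht'
    refine ae_of_all _ fun ω => ?_
    have h0 : (0:ℝ) ≤ t := ht
    have h1 : t < θ + 1 := ht'
    simp only [Real.norm_eq_abs, Real.abs_exp]
    rcases le_total 0 (X 1 ω - 1) with h | h
    · have : Real.exp (-(t * (X 1 ω - 1))) ≤ 1 := Real.exp_le_one_iff.2 (by nlinarith)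
      linarith [Real.exp_pos (-((θ+1) * (X 1 ω - 1)))]
    · have : Real.exp (-(t * (X 1 ω - 1))) ≤ Real.exp (-((θ+1) * (X 1 ω - 1))) :=
        Real.exp_le_exp.2 (by nlinarith)
      linarith
  · refine ae_of_all _ fun ω => ?_
    have : Continuous fun t : ℝ => Real.exp (-(t * (X 1 ω - 1))) := by fun_prop
    exact this.continuousWithinAt

lemma psi_inv (H : Lev μ X) {q : ℝ} (hq : 0 < q) :
    0 < sSup {θ : ℝ | 0 ≤ θ ∧ psi μ X θ = q} ∧ psi μ X (sSup {θ : ℝ | 0 ≤ θ ∧ psi μ X θ = q}) = q := by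
  set S := {θ : ℝ | 0 ≤ θ ∧ psi μ X θ = q} with hS
  have h0 : psi μ X 0 = 0 := by simp [psi]
  have hne : S.Nonempty := by
    have := intermediate_value_Icc hq.le ((psi_cont H).mono Icc_subset_Ici_self)
    obtain ⟨θ, hθ, he⟩ := this ⟨h0.trans_le hq.le, psi_ge H hq.le⟩
    exact ⟨θ, hθ.1, he⟩
  have hbd : BddAbove S := ⟨q, fun θ hθ => by rw [← hθ.2]; exact psi_ge H hθ.1⟩
  have hcl : IsClosed S := by
    have := (psi_cont H).preimage_isClosed_of_isClosed isClosed_Ici (isClosed_singleton (x := q))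
    exact this
  have hmem := hcl.csSup_mem hne hbd
  refine ⟨lt_of_le_of_ne hmem.1 fun h => ?_, hmem.2⟩
  have := hmem.2
  rw [← h, h0] at this
  exact hq.ne this

end J

section LevyB
variable {Ω : Type*} [MeasurableSpace Ω] {μ : Measure Ω} [IsProbabilityMeasure μ]
variable {X : ℝ → Ω → ℝ}

lemma inv_two_pow_tendsto : Tendsto (fun n : ℕ => ((2:ℝ)^n)⁻¹) atTop (nhdsWithin 0 {0}ᶜ) := by
  refine tendsto_nhdsWithin_iff.2 ⟨?_, Eventually.of_forall fun n => ?_⟩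
  · have := tendsto_pow_atTop_nhds_zero_of_lt_one (r := (2:ℝ)⁻¹) (by norm_num) (by norm_num)
    simpa [inv_pow] using this
  · simp

lemma exp_scaled (a : ℝ) :
    Tendsto (fun n : ℕ => (2:ℝ)^n * (Real.exp (a/2^n) - 1)) atTop (nhds a) := by
  have h : HasDerivAt (fun t : ℝ => Real.exp (a * t)) a 0 := by
    have := ((hasDerivAt_id (0:ℝ)).const_mul a).exp
    simpa using this
  have h2 := h.tendsto_slope_zero.comp inv_two_pow_tendsto
  refine h2.congr fun n => ?_
  simp [Function.comp, div_eq_mul_inv]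

lemma B_lim (H : Lev μ X) {x : ℝ} (hx : 0 < x) :
    Tendsto (fun n : ℕ => ∫ ω, Real.exp (-(x * ⨆ k, RS (LI X n) k ω)) ∂μ) atTop
      (nhds (x / psi μ X x)) := by
  have hψ : 0 < psi μ X x := hx.trans_le (psi_ge H hx.le)
  set c := fun n : ℕ => ∫ ω, Real.exp (-(x * ⨆ k, RS (LI X n) k ω)) ∂μ with hc
  set A := fun n : ℕ => (2:ℝ)^n * (Real.exp (psi μ X x/2^n) - 1) with hA
  have hAl : Tendsto A atTop (nhds (psi μ X x)) := exp_scaled _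
  have hb : ∀ ε : ℝ, 0 < ε → ∀ n : ℕ, x ≤ c n * A n ∧ c n * A n ≤ x * Real.exp (x*ε) +
      (2:ℝ)^n * ∫ ω in {ω | LI X n 0 ω < -ε}, Real.exp (-(x * LI X n 0 ω)) ∂μ := by
    intro ε hε n
    have h2 : (0:ℝ) < 2^n := by positivity
    obtain ⟨h3, h4⟩ := rwB (LI_meas H n) (LI_indep H n) (LI_ident H n) (LI_int H n).1 (1/2^n)
      (by positivity) (LI_int H n).2 (fun θ hθ => (LI_mgf H n hθ).1) x hx ε _ rfl hε
    rw [(LI_mgf H n hx.le).2] at h3 h4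
    have e1 : c n * A n = 2^n * (c n * (Real.exp (psi μ X x/2^n) - 1)) := by simp only [hA]; ring
    rw [e1]
    constructor
    · calc x = 2^n * (x * (1/2^n)) := by field_simp
        _ ≤ _ := by gcongr
    · calc _ ≤ 2^n * _ := mul_le_mul_of_nonneg_left h4 h2.le
        _ = _ := by field_simp
  have hcA : Tendsto (fun n => c n * A n) atTop (nhds x) := by
    refine tendsto_order.2 ⟨fun a ha => Eventually.of_forall fun n => ha.trans_le (hb 1 one_pos n).1, ?_⟩
    intro a ha
    have h5 : Tendsto (fun ε : ℝ => x * Real.exp (x*ε)) (nhdsWithin 0 (Ioi 0)) (nhds x) := by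
      have : Continuous (fun ε : ℝ => x * Real.exp (x*ε)) := by fun_prop
      have h6 := this.tendsto 0
      simp only [mul_zero, Real.exp_zero, mul_one] at h6
      exact h6.mono_left nhdsWithin_le_nhds
    obtain ⟨ε, h7, hε⟩ := ((h5.eventually (gt_mem_nhds ha)).and self_mem_nhdsWithin).exists
    have h8 := (LI_eta H (ε := ε) hε hx).const_add (x * Real.exp (x*ε))
    rw [add_zero] at h8
    filter_upwards [h8.eventually (gt_mem_nhds h7)] with n hn
    exact (hb ε hε n).2.trans_lt hn
  refine (hcA.div hAl hψ.ne').congr' ?_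
  filter_upwards [hAl.eventually (lt_mem_nhds hψ)] with n hn
  exact mul_div_cancel_right₀ _ hn.ne'

lemma RS_LI_double (X : ℝ → Ω → ℝ) (n k : ℕ) (ω : Ω) :
    RS (LI X n) k ω = RS (LI X (n+1)) (2*k) ω := by
  rw [RS_LI, RS_LI]
  have : ((2*k : ℕ):ℝ)/2^(n+1) = (k:ℝ)/2^n := by
    push_cast; rw [pow_succ]; field_simp
  rw [this]

lemma B_main (H : Lev μ X) : ∃ S : Ω → ℝ, Measurable S ∧
    (∀ᵐ ω ∂μ, (⨆ r : {r : ℝ // 0 ≤ r}, (X (r : ℝ) ω - (r : ℝ))) = S ω) ∧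
    (∀ᵐ ω ∂μ, 0 ≤ S ω) ∧
    ∀ x : ℝ, 0 < x → ∫ ω, Real.exp (-(x * S ω)) ∂μ = x / psi μ X x := by
  set Q : ℕ → Ω → ℝ := fun n ω => ⨆ k, RS (LI X n) k ω with hQ
  have hQm : ∀ n, Measurable (Q n) := fun n => Measurable.iSup fun k => RS_meas (LI_meas H n) k
  have hbd : ∀ᵐ ω ∂μ, ∀ n, BddAbove (range fun k => RS (LI X n) k ω) := by
    rw [ae_all_iff]; intro n
    refine RS_bdd (LI_indep H n) (LI_ident H n) (LI_int H n).1 ?_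
    rw [(LI_int H n).2]
    have : (0:ℝ) < 1/2^n := by positivity
    linarith
  have hmono : ∀ᵐ ω ∂μ, Monotone fun n => Q n ω := by
    filter_upwards [hbd] with ω hω
    refine monotone_nat_of_le_succ fun n => ciSup_le fun k => ?_
    rw [RS_LI_double]
    exact le_ciSup (hω (n+1)) (2*k)
  have hQ0 : ∀ᵐ ω ∂μ, ∀ n, 0 ≤ Q n ω := by
    filter_upwards [hbd] with ω hω n
    have := le_ciSup (hω n) 0
    simpa [RS_zero] using this
  set S : Ω → ℝ := fun ω => ⨆ n, Q n ω with hS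
  have hSm : Measurable S := Measurable.iSup hQm
  set B := {ω | BddAbove (range fun n => Q n ω)} with hB
  have hBm : MeasurableSet B := measurableSet_bddAbove_range hQm
  have hI : ∀ x : ℝ, 0 < x → ∫ ω, B.indicator (fun ω => Real.exp (-(x * S ω))) ω ∂μ = x / psi μ X x := by
    intro x hx
    refine tendsto_nhds_unique ?_ (B_lim H hx)
    refine tendsto_integral_of_dominated_convergence (fun _ => (1:ℝ)) ?_ (integrable_const _) ?_ ?_
    · intro n
      exact (Real.measurable_exp.comp ((hQm n).const_mul x).neg).aestronglyMeasurable
    · intro n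
      filter_upwards [hQ0] with ω hω
      rw [Real.norm_eq_abs, Real.abs_exp, Real.exp_le_one_iff]
      have := mul_nonneg hx.le (hω n)
      simp only [hQ] at this
      linarith
    · filter_upwards [hmono] with ω hω
      by_cases h : ω ∈ B
      · rw [indicator_of_mem h]
        have := tendsto_atTop_ciSup hω h
        exact (Real.continuous_exp.tendsto _).comp ((this.const_mul x).neg)
      · rw [indicator_of_notMem h]
        have := tendsto_atTop_atTop_of_monotone' hω h
        exact Real.tendsto_exp_atBot.comp (tendsto_neg_atTop_atBot.comp (this.const_mul_atTop hx))
  have hS0 : ∀ᵐ ω ∂μ, 0 ≤ S ω := by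
    filter_upwards [hQ0] with ω hω
    exact Real.iSup_nonneg hω
  have hBge : ∀ x : ℝ, 0 < x → x / psi μ X x ≤ μ.real B := by
    intro x hx
    rw [← hI x hx, ← integral_indicator_one hBm]
    refine integral_mono_ae ?_ ((integrable_const (1:ℝ)).indicator hBm) ?_
    · refine Integrable.indicator ?_ hBm
      refine (integrable_const (1:ℝ)).mono' (Real.measurable_exp.comp (hSm.const_mul x).neg).aestronglyMeasurable ?_
      filter_upwards [hS0] with ω hω
      rw [Real.norm_eq_abs, Real.abs_exp, Real.exp_le_one_iff]
      nlinarith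
    · filter_upwards [hS0] with ω hω
      refine indicator_le_indicator ?_
      simp only [Pi.one_apply, Real.exp_le_one_iff]
      nlinarith
  have hB1 : μ.real B = 1 := by
    refine le_antisymm measureReal_le_one ?_
    refine le_of_tendsto (psi_div H) ?_
    filter_upwards [self_mem_nhdsWithin] with x hx using hBge x hx
  have hBae : ∀ᵐ ω ∂μ, ω ∈ B := by
    refine (mem_ae_iff_prob_eq_one hBm).2 ?_
    exact (ENNReal.toReal_eq_one_iff _).1 hB1
  refine ⟨S, hSm, ?_, hS0, ?_⟩
  · filter_upwards [hbd, hBae, H.hX0, H.hgood, hS0] with ω h1 h2 h3 h4 h5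
    have hval : ∀ n k : ℕ, X ((k:ℝ)/2^n) ω - (k:ℝ)/2^n = RS (LI X n) k ω := by
      intro n k; rw [RS_LI, h3]; ring
    have hle : ∀ n k : ℕ, X ((k:ℝ)/2^n) ω - (k:ℝ)/2^n ≤ S ω := by
      intro n k; rw [hval]
      exact (le_ciSup (h1 n) k).trans (le_ciSup h2 n)
    have hall : ∀ s : ℝ, 0 ≤ s → X s ω - s ≤ S ω := fun s hs => h4.sub_id.sup_le hle s hs
    have : Nonempty {r : ℝ // 0 ≤ r} := ⟨⟨0, le_rfl⟩⟩
    refine le_antisymm (ciSup_le fun r => hall r r.2) ?_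
    refine ciSup_le fun n => ciSup_le fun k => ?_
    rw [← hval]
    exact le_ciSup (f := fun r : {r : ℝ // 0 ≤ r} => X (r:ℝ) ω - (r:ℝ))
      ⟨S ω, by rintro _ ⟨r, rfl⟩; exact hall r r.2⟩ ⟨(k:ℝ)/2^n, by positivity⟩
  · intro x hx
    rw [← hI x hx]
    refine integral_congr_ae ?_
    filter_upwards [hBae] with ω hω
    rw [indicator_of_mem hω]

end LevyB

section LevyA
variable {Ω : Type*} [MeasurableSpace Ω] {μ : Measure Ω} [IsProbabilityMeasure μ]
variable {X : ℝ → Ω → ℝ}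

/-- Countable version of the running infimum. -/
noncomputable def JI (p : ℝ × (ℝ → ℝ)) : ℝ :=
  ⨅ m : ℕ × ℕ, if (m.2:ℝ)/2^m.1 < p.1 then p.2 ((m.2:ℝ)/2^m.1) - (m.2:ℝ)/2^m.1 else 0

lemma JI_meas : Measurable JI := by
  refine Measurable.iInf fun m => Measurable.ite ?_ ?_ measurable_const
  · exact measurableSet_lt measurable_const measurable_fst
  · exact ((measurable_pi_apply _).comp measurable_snd).sub_const _

lemma JI_lt {t : ℝ} {f : ℝ → ℝ} (hf : GoodPath f) (h0 : f 0 = 0) (ht : 0 < t) (y : ℝ) :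
    JI (t, f) < y ↔ ∃ n k : ℕ, (k:ℝ)/2^n < t ∧ f ((k:ℝ)/2^n) - (k:ℝ)/2^n < y := by
  have hb : BddBelow (range fun m : ℕ × ℕ => if (m.2:ℝ)/2^m.1 < t then
      f ((m.2:ℝ)/2^m.1) - (m.2:ℝ)/2^m.1 else 0) := by
    obtain ⟨C, hC⟩ := hf.sub_id.bddBelow t
    refine ⟨min C 0, ?_⟩
    rintro _ ⟨m, rfl⟩
    simp only
    split_ifs with h
    · exact (min_le_left _ _).trans (hC ⟨_, ⟨by positivity, h.le⟩, rfl⟩)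
    · exact min_le_right _ _
  unfold JI
  rw [ciInf_lt_iff hb]
  constructor
  · rintro ⟨m, hm⟩
    split_ifs at hm with h
    · exact ⟨m.1, m.2, h, hm⟩
    · exact ⟨0, 0, by simpa using ht, by simpa [h0] using hm⟩
  · rintro ⟨n, k, h1, h2⟩
    refine ⟨(n, k), ?_⟩
    simp only [if_pos h1]
    exact h2

lemma JI_eq {t : ℝ} {f : ℝ → ℝ} (hf : GoodPath f) (h0 : f 0 = 0) (ht : 0 < t) :
    (⨅ s : Icc (0:ℝ) t, (f (s:ℝ) - (s:ℝ))) = JI (t, f) := by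
  refine eq_of_forall_gt_iff fun y => ?_
  rw [JI_lt hf h0 ht y]
  exact hf.sub_id.inf_lt_iff ht y

lemma A_main (H : Lev μ X) {q Φ : ℝ} (hq : 0 < q) (hΦ : 0 < Φ) (hψ : psi μ X Φ = q)
    {e : Ω → ℝ} (he : Measurable e)
    (hexp : ∀ y : ℝ, 0 ≤ y → μ {ω | y < e ω} = ENNReal.ofReal (Real.exp (-(q * y))))
    (hind : IndepFun e (fun ω => fun t : ℝ => X t ω) μ) :
    (∀ᵐ ω ∂μ, 0 < e ω) ∧
    ∀ y : ℝ, 0 ≤ y → μ.real {ω | JI (e ω, fun t => X t ω) < -y} = Real.exp (-(Φ * y)) := by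
  have hpos : ∀ᵐ ω ∂μ, 0 < e ω := by
    refine (mem_ae_iff_prob_eq_one (measurableSet_lt measurable_const he)).2 ?_
    have := hexp 0 le_rfl
    simpa using this
  refine ⟨hpos, fun y hy => ?_⟩
  set E : ℕ → Set Ω := fun n => {ω | ∃ k : ℕ, (k:ℝ) * (1/2^n) < e ω ∧ RS (LI X n) k ω < -y} with hE
  have hEmono : Monotone E := by
    refine monotone_nat_of_le_succ fun n => ?_
    rintro ω ⟨k, h1, h2⟩
    refine ⟨2*k, ?_, ?_⟩
    · convert h1 using 1
      push_cast; rw [pow_succ]; field_simp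
    · rwa [← RS_LI_double]
  have hU : μ.real {ω | JI (e ω, fun t => X t ω) < -y} = μ.real (⋃ n, E n) := by
    refine measureReal_congr ?_
    filter_upwards [hpos, H.hX0, H.hgood] with ω h1 h2 h3
    refine propext ?_
    change JI (e ω, fun t => X t ω) < -y ↔ ω ∈ ⋃ n, E n
    rw [JI_lt h3 h2 h1, mem_iUnion]
    refine exists_congr fun n => exists_congr fun k => ?_
    rw [RS_LI, h2, mul_one_div, sub_zero]
  have hlim : Tendsto (fun n => μ.real (E n)) atTop (nhds (μ.real (⋃ n, E n))) :=
    (ENNReal.tendsto_toReal (measure_ne_top _ _)).comp (tendsto_measure_iUnion_atTop hEmono)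
  have hb : ∀ ε : ℝ, ∀ n : ℕ, μ.real (E n) ≤ Real.exp (-(Φ*y)) ∧
      Real.exp (-(Φ*y)) ≤ Real.exp (Φ*ε) * μ.real (E n) +
        (∫ ω in {ω | LI X n 0 ω < -ε}, Real.exp (-(Φ * LI X n 0 ω)) ∂μ) / (1 - Real.exp (-q/2^n)) := by
    intro ε n
    have h2n : (0:ℝ) < 2^n := by positivity
    refine rwA (LI_meas H n) (LI_indep H n) Φ (Real.exp (-q/2^n)) hΦ (Real.exp_pos _) ?_
      (fun k => (LI_mgf' H n k hΦ.le).1) ?_ y hy ε _ ?_ (1/2^n) (by positivity) e he ?_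
    · rw [Real.exp_lt_one_iff]
      exact div_neg_of_neg_of_pos (by linarith) h2n
    · intro k
      rw [(LI_mgf' H n k hΦ.le).2, hψ, ← Real.exp_add, neg_div, neg_add_cancel, Real.exp_zero]
    · intro k
      have hid := LI_ident H n k
      have := (hid.comp (u := (Iio (-ε)).indicator fun u : ℝ => Real.exp (-(Φ * u)))
        ((by fun_prop : Measurable fun u : ℝ => Real.exp (-(Φ * u))).indicator measurableSet_Iio)).integral_eq
      rw [← integral_indicator (measurableSet_lt (LI_meas H n k) measurable_const),
        ← integral_indicator (measurableSet_lt (LI_meas H n 0) measurable_const)]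
      exact this
    · intro k
      have hA : RA (LI X n) y k = (fun ω => fun t : ℝ => X t ω) ⁻¹'
          (RA (LI (fun (t : ℝ) (f : ℝ → ℝ) => f t) n) y k) := rfl
      have hLm : ∀ k, Measurable (LI (fun (t : ℝ) (f : ℝ → ℝ) => f t) n k) := fun k =>
        ((measurable_pi_apply (((k+1 : ℕ) : ℝ) / 2^n)).sub
          (measurable_pi_apply ((k:ℝ) / 2^n))).sub_const (1 / 2^n)
      have h1 := hind.measure_inter_preimage_eq_mul (Ioi ((k:ℝ) * (1/2^n)))
        (RA (LI (fun (t : ℝ) (f : ℝ → ℝ) => f t) n) y k) measurableSet_Ioi (RA_meas hLm y k)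
      rw [hA]
      have h3 : e ⁻¹' Ioi ((k:ℝ) * (1/2^n)) = {ω | (k:ℝ) * (1/2^n) < e ω} := rfl
      rw [h3] at h1
      unfold Measure.real
      rw [h1, hexp _ (by positivity), ENNReal.toReal_mul, ENNReal.toReal_ofReal (Real.exp_pos _).le,
        ← Real.exp_nat_mul]
      congr 2
      ring
  rw [hU]
  refine le_antisymm (le_of_tendsto' hlim fun n => (hb 1 n).1) ?_
  have hε : ∀ ε : ℝ, 0 < ε → Real.exp (-(Φ*y)) ≤ Real.exp (Φ*ε) * μ.real (⋃ n, E n) := by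
    intro ε hε
    have hden : Tendsto (fun n : ℕ => (2:ℝ)^n * (1 - Real.exp (-q/2^n))) atTop (nhds q) := by
      have := (exp_scaled (-q)).neg
      rw [neg_neg] at this
      refine this.congr fun n => by ring
    have h1 := (LI_eta H (ε := ε) hε hΦ).div hden hq.ne'
    rw [zero_div] at h1
    have h2 := (hlim.const_mul (Real.exp (Φ*ε))).add h1
    rw [add_zero] at h2
    refine ge_of_tendsto' h2 fun n => ?_
    refine (hb ε n).2.trans_eq ?_
    congr 1
    exact (mul_div_mul_left _ _ (by positivity)).symm
  have h5 : Tendsto (fun ε : ℝ => Real.exp (Φ*ε) * μ.real (⋃ n, E n)) (nhdsWithin 0 (Ioi 0))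
      (nhds (μ.real (⋃ n, E n))) := by
    have : Continuous (fun ε : ℝ => Real.exp (Φ*ε) * μ.real (⋃ n, E n)) := by fun_prop
    have h6 := this.tendsto 0
    simp only [mul_zero, Real.exp_zero, one_mul] at h6
    exact h6.mono_left nhdsWithin_le_nhds
  refine ge_of_tendsto h5 ?_
  filter_upwards [self_mem_nhdsWithin] with ε h using hε ε h

end LevyA

lemma exp_interval {c : ℝ} (hc : c ≠ 0) (u : ℝ) :
    ∫ d in (0:ℝ)..u, Real.exp (c * d) = (Real.exp (c*u) - Real.exp (c*0)) / c := by
  rw [intervalIntegral.integral_comp_mul_left (fun d => Real.exp d) hc, integral_exp, smul_eq_mul]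
  field_simp

lemma exp_part {Φ x u : ℝ} (hΦ : 0 < Φ) (hne : x ≠ Φ) (hu : 0 ≤ u) :
    ∫ d, Real.exp (-(x * max 0 (u - d))) ∂(expMeasure Φ)
      = (Φ * Real.exp (-(x*u)) - x * Real.exp (-(Φ*u))) / (Φ - x) := by
  have hm : Measurable (exponentialPDF Φ) := (measurable_exponentialPDFReal Φ).ennreal_ofReal
  have h0 : ∫ d, Real.exp (-(x * max 0 (u - d))) ∂(expMeasure Φ) =
      ∫ d, (exponentialPDF Φ d).toReal • Real.exp (-(x * max 0 (u - d))) :=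
    integral_withDensity_eq_integral_toReal_smul hm (ae_of_all _ fun _ => ENNReal.ofReal_lt_top) _
  rw [h0]
  have h1 : (fun d => (exponentialPDF Φ d).toReal • Real.exp (-(x * max 0 (u - d)))) =
      (Ici (0:ℝ)).indicator (fun d => Φ * Real.exp (-(Φ*d)) * Real.exp (-(x * max 0 (u - d)))) := by
    ext d
    rw [exponentialPDF_eq]
    by_cases h : 0 ≤ d
    · rw [indicator_of_mem (by exact h), if_pos h, ENNReal.toReal_ofReal (by positivity), smul_eq_mul]
    · rw [indicator_of_notMem (by exact h), if_neg h]; simp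
  rw [h1, integral_indicator measurableSet_Ici, integral_Ici_eq_integral_Ioi]
  set g : ℝ → ℝ := fun d => Φ * Real.exp (-(Φ*d)) * Real.exp (-(x * max 0 (u - d))) with hg
  have hgc : Continuous g := by fun_prop
  have hIoi : EqOn g (fun d => Φ * Real.exp ((-Φ)*d)) (Ioi u) := by
    intro d hd
    have : u < d := hd
    simp only [hg]
    rw [max_eq_left (by linarith)]; simp
  have hIoc : EqOn g (fun d => Φ * Real.exp (-(x*u)) * Real.exp ((x-Φ)*d)) (Ioc 0 u) := by
    intro d hd
    simp only [hg]
    rw [max_eq_right (by linarith [hd.2]), mul_assoc, mul_assoc, ← Real.exp_add, ← Real.exp_add]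
    congr 2; ring
  have hi2 : IntegrableOn g (Ioi u) := by
    rw [integrableOn_congr_fun hIoi measurableSet_Ioi]
    exact (integrableOn_exp_mul_Ioi (by linarith) u).const_mul Φ
  have hi1 : IntegrableOn g (Ioc 0 u) :=
    (hgc.integrableOn_Icc (a := 0) (b := u)).mono_set Ioc_subset_Icc_self
  rw [← Ioc_union_Ioi_eq_Ioi hu, setIntegral_union Ioc_disjoint_Ioi_same measurableSet_Ioi hi1 hi2,
    setIntegral_congr_fun measurableSet_Ioi hIoi, setIntegral_congr_fun measurableSet_Ioc hIoc,
    integral_const_mul, integral_const_mul, integral_exp_mul_Ioi (by linarith),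
    ← intervalIntegral.integral_of_le hu, exp_interval (sub_ne_zero.2 hne)]
  have e1 : Real.exp ((x-Φ)*u) = Real.exp (x*u) * Real.exp (-(Φ*u)) := by
    rw [← Real.exp_add]; congr 1; ring
  have e2 : Real.exp (-(x*u)) * Real.exp (x*u) = 1 := by rw [← Real.exp_add]; simp
  have e3 : Real.exp (-Φ*u) = Real.exp (-(Φ*u)) := by rw [neg_mul]
  have n1 : x - Φ ≠ 0 := sub_ne_zero.2 hne
  have n2 : Φ - x ≠ 0 := sub_ne_zero.2 hne.symm
  rw [e1, e3, mul_zero, Real.exp_zero]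
  have e4 : Φ * Real.exp (-(x*u)) * ((Real.exp (x*u) * Real.exp (-(Φ*u)) - 1)/(x-Φ)) =
     Φ * (Real.exp (-(Φ*u)) - Real.exp (-(x*u)))/(x-Φ) := by
    rw [mul_div_assoc', mul_assoc, mul_sub, ← mul_assoc (Real.exp (-(x*u))), e2]
    ring
  rw [e4]
  have : x - Φ = -(Φ - x) := by ring
  rw [this]
  field_simp
  ring

section Fin
variable {Ω : Type*} [MeasurableSpace Ω] {μ : Measure Ω} [IsProbabilityMeasure μ]

lemma law_D {D : Ω → ℝ} (hD : Measurable D) {Φ : ℝ} (hΦ : 0 < Φ)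
    (h : ∀ y : ℝ, 0 ≤ y → μ.real {ω | y < D ω} = Real.exp (-(Φ * y))) :
    Measure.map D μ = expMeasure Φ := by
  have : IsProbabilityMeasure (Measure.map D μ) := Measure.isProbabilityMeasure_map hD.aemeasurable
  have : IsProbabilityMeasure (expMeasure Φ) := isProbabilityMeasure_expMeasure hΦ
  refine Measure.eq_of_cdf _ _ ?_
  ext y
  rw [cdf_expMeasure_eq hΦ, cdf_eq_real, map_measureReal_apply hD measurableSet_Iic]
  have h1 : ∀ y : ℝ, μ.real (D ⁻¹' Iic y) = 1 - μ.real {ω | y < D ω} := by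
    intro y
    rw [← probReal_compl_eq_one_sub (measurableSet_lt measurable_const hD)]
    congr 1
    ext ω; simp
  split_ifs with hy
  · rw [h1, h y hy]
  · refine le_antisymm ?_ measureReal_nonneg
    have h2 := h1 0
    rw [h 0 le_rfl] at h2
    simp only [mul_zero, neg_zero, Real.exp_zero, sub_self] at h2
    rw [← h2]
    refine measureReal_mono ?_
    exact preimage_mono (Iic_subset_Iic.2 (not_le.1 hy).le)

lemma indep_swap {α β γ : Type*} [MeasurableSpace α] [MeasurableSpace β] [MeasurableSpace γ]
    {A : Ω → α} {B : Ω → β} {C : Ω → γ} (hA : Measurable A) (hB : Measurable B) (hC : Measurable C)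
    (h1 : IndepFun A (fun ω => (B ω, C ω)) μ) (h2 : IndepFun B C μ) :
    IndepFun B (fun ω => (A ω, C ω)) μ := by
  have h3 : IndepFun A C μ := h1.comp measurable_id measurable_snd
  have pA : IsProbabilityMeasure (Measure.map A μ) := Measure.isProbabilityMeasure_map hA.aemeasurable
  have pB : IsProbabilityMeasure (Measure.map B μ) := Measure.isProbabilityMeasure_map hB.aemeasurable
  have pC : IsProbabilityMeasure (Measure.map C μ) := Measure.isProbabilityMeasure_map hC.aemeasurable
  rw [indepFun_iff_map_prod_eq_prod_map_map hA.aemeasurable (hB.prodMk hC).aemeasurable,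
    (indepFun_iff_map_prod_eq_prod_map_map hB.aemeasurable hC.aemeasurable).1 h2] at h1
  rw [indepFun_iff_map_prod_eq_prod_map_map hB.aemeasurable (hA.prodMk hC).aemeasurable,
    (indepFun_iff_map_prod_eq_prod_map_map hA.aemeasurable hC.aemeasurable).1 h3]
  have m1 := (measurePreserving_prodAssoc (Measure.map A μ) (Measure.map B μ) (Measure.map C μ)).symm
  have m2 : MeasurePreserving (Prod.map Prod.swap id)
      (((Measure.map A μ).prod (Measure.map B μ)).prod (Measure.map C μ))
      (((Measure.map B μ).prod (Measure.map A μ)).prod (Measure.map C μ)) :=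
    Measure.measurePreserving_swap.prod (MeasurePreserving.id _)
  have m3 := measurePreserving_prodAssoc (Measure.map B μ) (Measure.map A μ) (Measure.map C μ)
  have m4 := m3.comp (m2.comp m1)
  rw [← m4.map_eq, ← h1, Measure.map_map m4.measurable (hA.prodMk (hB.prodMk hC))]
  rfl

lemma final_int {Q D : Ω → ℝ} (hQ : Measurable Q) (hD : Measurable D) (hQ0 : ∀ᵐ ω ∂μ, 0 ≤ Q ω)
    (hind : IndepFun Q D μ) {Φ x : ℝ} (hΦ : 0 < Φ) (hx : 0 < x) (hne : x ≠ Φ)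
    (hlaw : Measure.map D μ = expMeasure Φ) :
    ∫ ω, Real.exp (-(x * max 0 (Q ω - D ω))) ∂μ =
      (Φ * (∫ ω, Real.exp (-(x * Q ω)) ∂μ) - x * ∫ ω, Real.exp (-(Φ * Q ω)) ∂μ) / (Φ - x) := by
  have pQ : IsProbabilityMeasure (Measure.map Q μ) := Measure.isProbabilityMeasure_map hQ.aemeasurable
  have pD : IsProbabilityMeasure (expMeasure Φ) := isProbabilityMeasure_expMeasure hΦ
  have hF : Continuous (fun p : ℝ × ℝ => Real.exp (-(x * max 0 (p.1 - p.2)))) := by fun_prop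
  have hj := (indepFun_iff_map_prod_eq_prod_map_map hQ.aemeasurable hD.aemeasurable).1 hind
  rw [hlaw] at hj
  have e1 : ∫ ω, Real.exp (-(x * max 0 (Q ω - D ω))) ∂μ =
      ∫ p, Real.exp (-(x * max 0 (p.1 - p.2))) ∂((Measure.map Q μ).prod (expMeasure Φ)) := by
    rw [← hj, integral_map (hQ.prodMk hD).aemeasurable hF.aestronglyMeasurable]
  have hFi : Integrable (fun p : ℝ × ℝ => Real.exp (-(x * max 0 (p.1 - p.2))))
      ((Measure.map Q μ).prod (expMeasure Φ)) := by
    refine (integrable_const (1:ℝ)).mono' hF.aestronglyMeasurable (ae_of_all _ fun p => ?_)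
    rw [Real.norm_eq_abs, Real.abs_exp, Real.exp_le_one_iff]
    have := mul_nonneg hx.le (le_max_left 0 (p.1 - p.2))
    linarith
  have hE : ∀ θ : ℝ, 0 < θ → Integrable (fun ω => Real.exp (-(θ * Q ω))) μ := by
    intro θ hθ
    refine (integrable_const (1:ℝ)).mono' (Real.measurable_exp.comp (hQ.const_mul θ).neg).aestronglyMeasurable ?_
    filter_upwards [hQ0] with ω hω
    rw [Real.norm_eq_abs, Real.abs_exp, Real.exp_le_one_iff]
    nlinarith
  rw [e1, integral_prod _ hFi, integral_map hQ.aemeasurable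
    hFi.aestronglyMeasurable.integral_prod_right']
  have e2 : ∫ ω, (∫ d, Real.exp (-(x * max 0 (Q ω - d))) ∂(expMeasure Φ)) ∂μ =
      ∫ ω, (Φ * Real.exp (-(x*Q ω)) - x * Real.exp (-(Φ*Q ω))) / (Φ - x) ∂μ := by
    refine integral_congr_ae ?_
    filter_upwards [hQ0] with ω hω
    exact exp_part hΦ hne hω
  refine e2.trans ?_
  rw [integral_div, integral_sub ((hE x hx).const_mul _) ((hE Φ hΦ).const_mul _),
    integral_const_mul, integral_const_mul]

end Fin

/-- **Theorem 2.2** (spectrally positive case): double transform of `M(e_q)`. -/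
theorem transform_inf_reflected_spectrally_positive
    {Ω : Type*} [MeasureSpace Ω] [IsProbabilityMeasure (ℙ : Measure Ω)]
    (X : ℝ → Ω → ℝ)
    (hmeas : ∀ t : ℝ, Measurable (X t))
    (hX0 : ∀ᵐ ω ∂ℙ, X 0 ω = 0)
    (hpath : ∀ᵐ ω ∂ℙ, ∀ t : ℝ, 0 ≤ t →
      ContinuousWithinAt (fun s => X s ω) (Set.Ici t) t ∧
      (0 < t → ∃ l : ℝ, Tendsto (fun s => X s ω) (nhdsWithin t (Set.Iio t)) (nhds l)))
    (hstat : ∀ s t : ℝ, 0 ≤ s → s ≤ t →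
      Measure.map (fun ω => X t ω - X s ω) ℙ = Measure.map (X (t - s)) ℙ)
    (hincr : ∀ (n : ℕ) (t : Fin (n + 1) → ℝ), (∀ i, 0 ≤ t i) → StrictMono t →
      iIndepFun
        (fun i : Fin n => fun ω => X (t i.succ) ω - X (t i.castSucc) ω) ℙ)
    (hint : Integrable (X 1) ℙ)
    (hmean : ∫ ω, X 1 ω ∂ℙ = 0)
    (Qe : Ω → ℝ) (hQe_meas : Measurable Qe)
    (hQe_dist : Measure.map Qe ℙ
      = Measure.map (fun ω => ⨆ r : {r : ℝ // 0 ≤ r}, (X (r : ℝ) ω - (r : ℝ))) ℙ)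
    (hQe_indep : IndepFun Qe (fun ω => fun t : ℝ => X t ω) ℙ)
    (hSP : ∀ᵐ ω ∂ℙ, ∀ t : ℝ, 0 < t → ∀ l : ℝ,
      Tendsto (fun s => X s ω) (nhdsWithin t (Set.Iio t)) (nhds l) → l ≤ X t ω)
    (hNI : ¬ (∀ᵐ ω ∂ℙ, ∀ s t : ℝ, 0 ≤ s → s ≤ t → X s ω ≤ X t ω))
    (ψh : ℝ → ℝ)
    (hψh : ∀ θ : ℝ, ψh θ = Real.log (∫ ω, Real.exp (-(θ * (X 1 ω - 1))) ∂ℙ))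
    (hψh_fin : ∀ θ : ℝ, 0 ≤ θ → Integrable (fun ω => Real.exp (-(θ * (X 1 ω - 1)))) ℙ)
    (Φh : ℝ → ℝ) (hΦh : ∀ q : ℝ, Φh q = sSup {θ : ℝ | 0 ≤ θ ∧ ψh θ = q})
    (x q : ℝ) (hx : 0 < x) (hq : 0 < q) (hxq : x ≠ Φh q)
    (e : Ω → ℝ) (he_meas : Measurable e)
    (he_exp : ∀ y : ℝ, 0 ≤ y → ℙ {ω | y < e ω} = ENNReal.ofReal (Real.exp (-(q * y))))
    (he_indep : IndepFun e (fun ω => (Qe ω, fun t : ℝ => X t ω)) ℙ) :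
    ∫ ω, Real.exp (-x * max 0
        (Qe ω + ⨅ s : Set.Icc (0:ℝ) (e ω), (X (s : ℝ) ω - (s : ℝ)))) ∂ℙ
      = (x / ψh x) * (Φh q / q) * ((q - ψh x) / (Φh q - x)) := by
  have H : Lev (ℙ : Measure Ω) X :=
    { hmeas := hmeas
      hX0 := hX0
      hgood := by
        filter_upwards [hpath, hSP] with ω h1 h2
        exact ⟨fun t ht => (h1 t ht).1, fun t ht => by
          obtain ⟨l, hl⟩ := (h1 t ht.le).2 ht
          exact ⟨l, hl, h2 t ht l hl⟩⟩
      hstat := hstat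
      hincr := hincr
      hint := hint
      hmean := hmean
      hfin := hψh_fin }
  have hψ : ψh = psi ℙ X := funext fun θ => hψh θ
  obtain ⟨hΦ0, hΦq⟩ := psi_inv H hq
  rw [← hψ, ← hΦh q] at hΦ0
  rw [← hψ, ← hΦh q, hψ] at hΦq
  have hXm : Measurable (fun ω => fun t : ℝ => X t ω) := measurable_pi_lambda _ hmeas
  obtain ⟨S, hSm, hSeq, hS0, hSint⟩ := B_main H
  have hQS : Measure.map Qe ℙ = Measure.map S ℙ := by
    rw [hQe_dist]
    exact Measure.map_congr hSeq
  have hQ0 : ∀ᵐ ω ∂(ℙ : Measure Ω), 0 ≤ Qe ω := by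
    have h1 : ∀ᵐ z ∂(Measure.map S ℙ), (0:ℝ) ≤ z :=
      (ae_map_iff hSm.aemeasurable measurableSet_Ici).2 hS0
    rw [← hQS] at h1
    exact (ae_map_iff hQe_meas.aemeasurable measurableSet_Ici).1 h1
  have hQint : ∀ θ : ℝ, 0 < θ → ∫ ω, Real.exp (-(θ * Qe ω)) ∂ℙ = θ / psi ℙ X θ := by
    intro θ hθ
    rw [← hSint θ hθ]
    have hc : Continuous (fun z : ℝ => Real.exp (-(θ * z))) := by fun_prop
    rw [← integral_map (φ := Qe) hQe_meas.aemeasurable (f := fun z : ℝ => Real.exp (-(θ * z)))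
      hc.aestronglyMeasurable, hQS, integral_map hSm.aemeasurable hc.aestronglyMeasurable]
  have heX : IndepFun e (fun ω => fun t : ℝ => X t ω) ℙ :=
    he_indep.comp measurable_id measurable_snd
  obtain ⟨hepos, hA⟩ := A_main H hq hΦ0 hΦq he_meas he_exp heX
  set D : Ω → ℝ := fun ω => -JI (e ω, fun t => X t ω) with hD
  have hDm : Measurable D := (JI_meas.comp (he_meas.prodMk hXm)).neg
  have hlaw : Measure.map D ℙ = expMeasure (Φh q) := by
    refine law_D hDm hΦ0 fun y hy => ?_
    rw [← hA y hy]
    congr 1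
    ext ω
    exact (lt_neg : y < -JI (e ω, fun t => X t ω) ↔ _)
  have hQD : IndepFun Qe D ℙ := by
    have h1 := indep_swap he_meas hQe_meas hXm he_indep hQe_indep
    exact h1.comp measurable_id JI_meas.neg
  have hfin := final_int hQe_meas hDm hQ0 hQD hΦ0 hx hxq hlaw
  rw [hQint x hx, hQint _ hΦ0, hΦq] at hfin
  have hlhs : ∫ ω, Real.exp (-x * max 0
        (Qe ω + ⨅ s : Set.Icc (0:ℝ) (e ω), (X (s : ℝ) ω - (s : ℝ)))) ∂ℙ
      = ∫ ω, Real.exp (-(x * max 0 (Qe ω - D ω))) ∂ℙ := by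
    refine integral_congr_ae ?_
    filter_upwards [hepos, H.hX0, H.hgood] with ω h1 h2 h3
    have h4 := JI_eq h3 h2 h1
    rw [h4, hD]
    simp only [sub_neg_eq_add, neg_mul]
  rw [hlhs, hfin, ← hψ]
  have hψx : 0 < ψh x := by
    rw [hψ]; exact hx.trans_le (psi_ge H hx.le)
  have hne : Φh q - x ≠ 0 := sub_ne_zero.2 hxq.symm
  field_simp
end

section
/- Let Q be an exponentially distributed random variable with rate 2 (mean 1/2), independent of B. Then for every t > 0 and every u > 0: P(Q + inf_{s∈[0,t]} (B(s) − s) > u) = e^{−2u} · (2(1 + t)Ψ(√t) − √(2t/π) · e^{−t/2}). -/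
open MeasureTheory ProbabilityTheory Filter Set
open scoped NNReal ENNReal Topology

lemma rb_pdf (v : ℝ≥0) (y : ℝ) :
    gaussianPDFReal (-(v:ℝ)) v y = gaussianPDFReal v v y * Real.exp (-2 * y) := by
  by_cases hv : v = 0
  · simp [hv]
  have : (v:ℝ) ≠ 0 := by exact_mod_cast hv
  simp only [gaussianPDFReal, mul_assoc, ← Real.exp_add]
  congr 3
  field_simp
  ring

lemma rb_tilt (v : ℝ≥0) (A : Set ℝ) (hA : MeasurableSet A) :
    ∫⁻ y in A, ENNReal.ofReal (Real.exp (-2 * y)) ∂(gaussianReal v v) = gaussianReal (-v) v A := by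
  by_cases hv : v = 0
  · subst hv
    rw [← lintegral_indicator hA]
    simp only [NNReal.coe_zero, gaussianReal_zero_var, lintegral_dirac]
    by_cases h0 : (0:ℝ) ∈ A <;> simp [h0, hA]
  rw [gaussianReal_apply _ hv, gaussianReal_of_var_ne_zero _ hv,
    setLIntegral_withDensity_eq_setLIntegral_mul _ (by fun_prop) (by fun_prop) hA]
  apply lintegral_congr
  intro y
  simp only [Pi.mul_apply, gaussianPDF, rb_pdf]
  rw [ENNReal.ofReal_mul (gaussianPDFReal_nonneg _ _ _)]

lemma rb_flip (v : ℝ≥0) (c : ℝ) :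
    gaussianReal v v (Iic (-c)) = ∫⁻ y in Ici c, ENNReal.ofReal (Real.exp (-2 * y)) ∂(gaussianReal v v) := by
  rw [rb_tilt _ _ measurableSet_Ici, ← gaussianReal_map_neg, Measure.map_apply (by fun_prop) measurableSet_Ici]
  congr 1
  ext x
  simp

lemma rb_indep {Ω α : Type*} [MeasurableSpace Ω] [MeasurableSpace α] (P : Measure Ω) [IsProbabilityMeasure P]
    (Z : Ω → α) (Y : Ω → ℝ) (hZ : Measurable Z) (hY : Measurable Y) (h : IndepFun Z Y P) (v : ℝ≥0)
    (hYl : P.map Y = gaussianReal v v) (p : Set α) (hp : MeasurableSet p) (g : α → ℝ) (hg : Measurable g) (a : ℝ) :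
    P {ω | Z ω ∈ p ∧ g (Z ω) + Y ω ≤ a} =
      ∫⁻ ω, {ω | Z ω ∈ p ∧ g (Z ω) - a ≤ Y ω}.indicator (fun ω => ENNReal.ofReal (Real.exp (-2 * Y ω))) ω ∂P := by
  have hm := (indepFun_iff_map_prod_eq_prod_map_map hZ.aemeasurable hY.aemeasurable).1 h
  rw [hYl] at hm
  have hS : MeasurableSet {q : α × ℝ | q.1 ∈ p ∧ g q.1 + q.2 ≤ a} :=
    (hp.preimage measurable_fst).inter
      (measurableSet_le (f := fun q : α × ℝ => g q.1 + q.2) (g := fun _ => a) (by fun_prop) (by fun_prop))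
  have hT : MeasurableSet {q : α × ℝ | q.1 ∈ p ∧ g q.1 - a ≤ q.2} :=
    (hp.preimage measurable_fst).inter
      (measurableSet_le (f := fun q : α × ℝ => g q.1 - a) (g := fun q => q.2) (by fun_prop) (by fun_prop))
  have e1 : P {ω | Z ω ∈ p ∧ g (Z ω) + Y ω ≤ a} = (P.map (fun ω => (Z ω, Y ω))) {q : α × ℝ | q.1 ∈ p ∧ g q.1 + q.2 ≤ a} := by
    rw [Measure.map_apply (by fun_prop) hS]; rfl
  have hf : Measurable ({q : α × ℝ | q.1 ∈ p ∧ g q.1 - a ≤ q.2}.indicator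
      (fun q => ENNReal.ofReal (Real.exp (-2 * q.2)))) := Measurable.indicator (by fun_prop) hT
  have e2 : ∫⁻ ω, {ω | Z ω ∈ p ∧ g (Z ω) - a ≤ Y ω}.indicator (fun ω => ENNReal.ofReal (Real.exp (-2 * Y ω))) ω ∂P
     = ∫⁻ q, {q : α × ℝ | q.1 ∈ p ∧ g q.1 - a ≤ q.2}.indicator (fun q => ENNReal.ofReal (Real.exp (-2 * q.2))) q
        ∂(P.map (fun ω => (Z ω, Y ω))) := by
    rw [lintegral_map hf (by fun_prop)]; rfl
  rw [e1, e2, hm, Measure.prod_apply hS, lintegral_prod _ hf.aemeasurable]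
  apply lintegral_congr
  intro z
  by_cases hz : z ∈ p
  · have := rb_flip v (g z - a)
    rw [← lintegral_indicator measurableSet_Ici] at this
    convert this using 2
    · ext y; simp [hz]; constructor <;> intro <;> linarith
    · ext y; simp [hz, indicator]
  · simp [hz, indicator]

lemma rb_past {Ω : Type*} [MeasurableSpace Ω] (P : Measure Ω) [IsProbabilityMeasure P]
    (X : ℝ → Ω → ℝ) (hX : ∀ s, Measurable (X s)) (hX0 : ∀ ω, X 0 ω = 0)
    (hincr : ∀ (n : ℕ) (t : Fin (n + 1) → ℝ), (∀ i, 0 ≤ t i) → StrictMono t →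
      iIndepFun (fun i : Fin n => fun ω => X (t i.succ) ω - X (t i.castSucc) ω) P)
    (s : ℕ → ℝ) (hs0 : s 0 = 0) (hs : StrictMono s) (k : ℕ) (t : ℝ) (hk : s k ≤ t) :
    IndepFun (fun ω (j : Fin (k+1)) => X (s j) ω) (fun ω => X t ω - X (s k) ω) P := by
  rcases hk.eq_or_lt with rfl | hk
  · simp only [sub_self]
    exact indepFun_const_right _ _
  let r : Fin (k+1+1) → ℝ := fun i => if i.val ≤ k then s i.val else t
  have hr : StrictMono r := by
    intro i j hij
    have hij' : i.val < j.val := hij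
    have := j.2
    simp only [r]
    split_ifs with h1 h2
    · exact hs hij'
    · exact lt_of_le_of_lt (hs.monotone h1) hk
    · omega
    · omega
  have hr0 : ∀ i, 0 ≤ r i := by
    intro i
    have : r 0 ≤ r i := hr.monotone (Fin.zero_le i)
    simpa [r, hs0] using this
  have hI := hincr (k+1) r hr0 hr
  have hI2 := hI.indepFun_finset (Finset.univ.filter (fun i => i.val < k)) {Fin.last k}
    (by simp) (fun i => (hX _).sub (hX _))
  let φ : (↥(Finset.univ.filter (fun i : Fin (k+1) => i.val < k)) → ℝ) → (Fin (k+1) → ℝ) :=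
    fun x j => ∑ i : ↥(Finset.univ.filter (fun i : Fin (k+1) => i.val < k)), if i.1.val < j.val then x i else 0
  have hφ : Measurable φ := by
    rw [measurable_pi_iff]; intro j
    apply Finset.measurable_sum
    intro i _
    split_ifs <;> fun_prop
  have := hI2.comp hφ (measurable_pi_apply ⟨Fin.last k, by simp⟩)
  convert this using 1
  · ext ω j
    simp only [φ, Function.comp]
    have hj : j.val ≤ k := by omega
    have h3 : X (s j) ω = ∑ i ∈ Finset.range j.val, (X (s (i+1)) ω - X (s i) ω) := by
      rw [Finset.sum_range_sub (fun i => X (s i) ω)]; simp [hs0, hX0]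
    rw [h3, Finset.sum_coe_sort _ (fun i : Fin (k+1) => if i.val < j.val then X (r i.succ) ω - X (r i.castSucc) ω else 0),
      Finset.sum_filter, Finset.sum_fin_eq_sum_range]
    rw [← Finset.sum_subset (Finset.range_subset_range.2 (show j.val ≤ k+1 by omega))]
    · apply Finset.sum_congr rfl
      intro i hi
      have hi := Finset.mem_range.1 hi
      have h4 : i < k + 1 := by omega
      have h5 : i < k := by omega
      have h6 : i ≤ k := by omega
      have h7 : i + 1 ≤ k := by omega
      simp [h4, h5, hi, r, h6, h7]
    · intro i hi hi2
      have hi2 : ¬ i < j.val := fun h => hi2 (Finset.mem_range.2 h)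
      simp [hi2]
  · ext ω
    simp [r]

noncomputable def rbGrid (t : ℝ) (n k : ℕ) : ℝ := t * (k / (n + 1 : ℝ))

lemma rbGrid_mono (t : ℝ) (ht : 0 < t) (n : ℕ) : StrictMono (rbGrid t n) := by
  intro i j hij
  unfold rbGrid
  have : (i:ℝ) < j := by exact_mod_cast hij
  have : (0:ℝ) < n + 1 := by positivity
  gcongr

lemma rbGrid_zero (t : ℝ) (n : ℕ) : rbGrid t n 0 = 0 := by simp [rbGrid]

lemma rbGrid_last (t : ℝ) (n : ℕ) : rbGrid t n (n+1) = t := by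
  unfold rbGrid
  have : (0:ℝ) < n + 1 := by positivity
  push_cast
  field_simp

def rbHit (a : ℝ) (x : ℝ → ℝ) (s : ℕ → ℝ) (k : ℕ) : Prop := (∀ j < k, x (s j) ≤ a) ∧ a < x (s k)

lemma rbHit_unique {a : ℝ} {x : ℝ → ℝ} {s : ℕ → ℝ} {k l : ℕ} (h : rbHit a x s k) (h' : rbHit a x s l) : k = l := by
  rcases lt_trichotomy k l with hl | hl | hl
  · exact absurd (h'.1 k hl) (not_le.2 h.2)
  · exact hl
  · exact absurd (h.1 l hl) (not_le.2 h'.2)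

lemma rbHit_exists {a : ℝ} {x : ℝ → ℝ} {s : ℕ → ℝ} {k : ℕ} (h : a < x (s k)) : ∃ l ≤ k, rbHit a x s l := by
  classical
  have hex : ∃ k, a < x (s k) := ⟨k, h⟩
  exact ⟨Nat.find hex, Nat.find_min' hex h, fun j hj => not_lt.1 (Nat.find_min hex hj), Nat.find_spec hex⟩

open Classical in
noncomputable def rbF (a : ℝ) (x : ℝ → ℝ) (t : ℝ) (s : ℕ → ℝ) (k : ℕ) : ℝ≥0∞ :=
  if rbHit a x s k ∧ x (s k) - a ≤ x t - x (s k) then ENNReal.ofReal (Real.exp (-2 * (x t - x (s k)))) else 0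

open Classical in
lemma rb_path (a : ℝ) (ha : 0 ≤ a) (x : ℝ → ℝ) (hx : Continuous x) (hx0 : x 0 = 0) (t : ℝ) (ht : 0 < t) :
    Tendsto (fun n : ℕ => ∑ k ∈ Finset.range (n+2), rbF a x t (rbGrid t n) k) atTop
      (𝓝 (if a < x t then ENNReal.ofReal (Real.exp (-2 * (x t - a))) else 0)) := by
  split_ifs with hat
  · have hex : ∀ n : ℕ, ∃ l ≤ n+1, rbHit a x (rbGrid t n) l := fun n =>
      rbHit_exists (by rw [rbGrid_last]; exact hat)
    choose l hl hl2 using hex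
    have hlim : Tendsto (fun n => x (rbGrid t n (l n))) atTop (𝓝 a) := by
      have hu := isCompact_Icc.uniformContinuousOn_of_continuous (hx.continuousOn (s := Icc 0 t))
      rw [Metric.uniformContinuousOn_iff] at hu
      rw [Metric.tendsto_atTop]
      intro ε hε
      obtain ⟨δ, hδ, hδ2⟩ := hu ε hε
      obtain ⟨N, hN⟩ := exists_nat_gt (t / δ)
      refine ⟨N, fun n hn => ?_⟩
      have hl0 : l n ≠ 0 := by
        intro h0
        have := (hl2 n).2
        rw [h0, rbGrid_zero, hx0] at this
        linarith
      obtain ⟨m, hm⟩ := Nat.exists_eq_succ_of_ne_zero hl0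
      have h1 := (hl2 n).1 m (by omega)
      have h2 := (hl2 n).2
      have hin : ∀ j ≤ n + 1, rbGrid t n j ∈ Icc 0 t := by
        intro j hj
        constructor
        · unfold rbGrid; positivity
        · conv_rhs => rw [← rbGrid_last t n]
          exact (rbGrid_mono t ht n).monotone hj
      have h3 := hδ2 (rbGrid t n (l n)) (hin _ (hl n)) (rbGrid t n m) (hin _ (by have := hl n; omega)) (by
        rw [Real.dist_eq, hm]
        have hn1 : (0:ℝ) < n + 1 := by positivity
        have : rbGrid t n (m.succ) - rbGrid t n m = t / (n+1) := by
          unfold rbGrid; push_cast; field_simp; ring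
        rw [this, abs_of_pos (by positivity), div_lt_iff₀ hn1]
        rw [div_lt_iff₀ hδ] at hN
        have : (N:ℝ) ≤ n := by exact_mod_cast hn
        nlinarith)
      rw [Real.dist_eq] at h3 ⊢
      rw [abs_lt] at h3 ⊢
      constructor <;> linarith
    have hsum : ∀ n, ∑ k ∈ Finset.range (n+2), rbF a x t (rbGrid t n) k = rbF a x t (rbGrid t n) (l n) := by
      intro n
      apply Finset.sum_eq_single
      · intro b _ hb
        unfold rbF
        rw [if_neg]
        rintro ⟨h, -⟩
        exact hb (rbHit_unique h (hl2 n))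
      · intro h
        exact absurd (Finset.mem_range.2 (by have := hl n; omega)) h
    simp_rw [hsum]
    have hl3 : Tendsto (fun n => ENNReal.ofReal (Real.exp (-2 * (x t - x (rbGrid t n (l n)))))) atTop
        (𝓝 (ENNReal.ofReal (Real.exp (-2 * (x t - a))))) := by
      apply ENNReal.tendsto_ofReal
      apply (Real.continuous_exp.tendsto _).comp
      exact (hlim.const_sub _).const_mul _
    apply hl3.congr'
    have hev : ∀ᶠ n in atTop, x (rbGrid t n (l n)) < (x t + a) / 2 :=
      hlim.eventually_lt_const (by linarith)
    filter_upwards [hev] with n hn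
    unfold rbF
    rw [if_pos ⟨hl2 n, by linarith⟩]
  · apply tendsto_const_nhds.congr
    intro n
    symm
    apply Finset.sum_eq_zero
    intro k _
    unfold rbF
    rw [if_neg]
    rintro ⟨h, h'⟩
    have := h.2
    linarith

abbrev RbI := {q : ℚ // 0 ≤ q ∧ q ≤ 1}

open Classical in
lemma rb_path2 (a : ℝ) (x : ℝ → ℝ) (hx : Continuous x) (t : ℝ) :
    Tendsto (fun n : ℕ => if (∃ k ≤ n+1, a < x (rbGrid t n k)) then (1:ℝ≥0∞) else 0) atTop
      (𝓝 (if ∃ q : RbI, a < x (t * (q.1:ℝ)) then 1 else 0)) := by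
  split_ifs with h
  · obtain ⟨q, hq⟩ := h
    apply tendsto_const_nhds.congr'
    have hq0 : (0:ℝ) ≤ q.1 := by exact_mod_cast q.2.1
    have hq1 : (q.1:ℝ) ≤ 1 := by exact_mod_cast q.2.2
    have hc : Tendsto (fun n : ℕ => ((n:ℝ) + 1)) atTop atTop :=
      tendsto_atTop_add_const_right _ _ tendsto_natCast_atTop_atTop
    have h1 := (tendsto_nat_floor_mul_div_atTop hq0).comp hc
    have h2 : Tendsto (fun n : ℕ => x (rbGrid t n ⌊(q.1:ℝ) * (n+1)⌋₊)) atTop (𝓝 (x (t * q.1))) := by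
      apply (hx.tendsto _).comp
      exact h1.const_mul t
    filter_upwards [h2.eventually_const_lt hq] with n hn
    rw [if_pos]
    refine ⟨_, ?_, hn⟩
    apply Nat.floor_le_of_le
    push_cast
    nlinarith [(n.cast_nonneg : (0:ℝ) ≤ n)]
  · apply tendsto_const_nhds.congr
    intro n
    rw [if_neg]
    rintro ⟨k, hk, hk2⟩
    apply h
    have hn1 : (0:ℚ) < n + 1 := by positivity
    refine ⟨⟨k / (n+1), by positivity, ?_⟩, ?_⟩
    · rw [div_le_one hn1]; exact_mod_cast hk
    · push_cast
      exact hk2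

lemma rb_discrete {Ω : Type*} [MeasurableSpace Ω] (P : Measure Ω) [IsProbabilityMeasure P]
    (X : ℝ → Ω → ℝ) (hX : ∀ s, Measurable (X s)) (hX0 : ∀ ω, X 0 ω = 0)
    (hincr : ∀ (n : ℕ) (t : Fin (n + 1) → ℝ), (∀ i, 0 ≤ t i) → StrictMono t →
      iIndepFun (fun i : Fin n => fun ω => X (t i.succ) ω - X (t i.castSucc) ω) P)
    (hlaw : ∀ s t : ℝ, 0 ≤ s → s ≤ t → P.map (fun ω => X t ω - X s ω) =
      gaussianReal ((t - s).toNNReal : ℝ) (t - s).toNNReal)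
    (t : ℝ) (ht : 0 < t) (a : ℝ) (n : ℕ) :
    P {ω | (∃ k ≤ n+1, a < X (rbGrid t n k) ω) ∧ X t ω ≤ a} =
      ∫⁻ ω, ∑ k ∈ Finset.range (n+2), rbF a (fun s => X s ω) t (rbGrid t n) k ∂P ∧
    (∀ k, Measurable (fun ω => rbF a (fun s => X s ω) t (rbGrid t n) k)) := by
  have hH : ∀ k, MeasurableSet {ω | rbHit a (fun s => X s ω) (rbGrid t n) k} := by
    intro k
    unfold rbHit
    apply MeasurableSet.inter
    · have : {ω | ∀ j < k, X (rbGrid t n j) ω ≤ a} = ⋂ j, ⋂ (_ : j < k), {ω | X (rbGrid t n j) ω ≤ a} := by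
        ext; simp
      change MeasurableSet {ω | ∀ j < k, X (rbGrid t n j) ω ≤ a}
      rw [this]
      exact MeasurableSet.iInter fun j => MeasurableSet.iInter fun _ => measurableSet_le (hX _) measurable_const
    · exact measurableSet_lt measurable_const (hX _)
  have hmeas : (∀ k, Measurable (fun ω => rbF a (fun s => X s ω) t (rbGrid t n) k)) := by
    intro k
    unfold rbF
    have := hX t
    have := hX (rbGrid t n k)
    apply Measurable.ite _ (by fun_prop) measurable_const
    exact (hH k).inter (measurableSet_le (f := fun ω => X (rbGrid t n k) ω - a)
      (g := fun ω => X t ω - X (rbGrid t n k) ω) (by fun_prop) (by fun_prop))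
  refine ⟨?_, hmeas⟩
  rw [lintegral_finsetSum _ (fun k _ => hmeas k)]
  have hU : {ω | (∃ k ≤ n+1, a < X (rbGrid t n k) ω) ∧ X t ω ≤ a} =
      ⋃ k ∈ Finset.range (n+2), {ω | rbHit a (fun s => X s ω) (rbGrid t n) k ∧ X t ω ≤ a} := by
    ext ω
    simp only [mem_ofPred_eq, mem_iUnion, Finset.mem_range, exists_prop]
    constructor
    · rintro ⟨⟨k, hk, h⟩, h'⟩
      obtain ⟨l, hl, hl2⟩ := rbHit_exists (x := fun s => X s ω) (s := rbGrid t n) h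
      exact ⟨l, by omega, hl2, h'⟩
    · rintro ⟨k, hk, h, h'⟩
      exact ⟨⟨k, by omega, h.2⟩, h'⟩
  rw [hU, measure_biUnion_finset]
  · apply Finset.sum_congr rfl
    intro k hk
    have hk : k ≤ n + 1 := by have := Finset.mem_range.1 hk; omega
    have hgk : rbGrid t n k ≤ t := by
      conv_rhs => rw [← rbGrid_last t n]
      exact (rbGrid_mono t ht n).monotone hk
    have hg0 : 0 ≤ rbGrid t n k := by unfold rbGrid; positivity
    have hind := rb_past P X hX hX0 hincr (rbGrid t n) (rbGrid_zero t n) (rbGrid_mono t ht n) k t hgk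
    have := rb_indep P _ _ (measurable_pi_iff.2 fun j => hX _) ((hX _).sub (hX _)) hind _ (hlaw _ _ hg0 hgk)
      {z : Fin (k+1) → ℝ | (∀ j : Fin (k+1), j.val < k → z j ≤ a) ∧ a < z (Fin.last k)} (by
        apply MeasurableSet.inter
        · have : {z : Fin (k+1) → ℝ | ∀ j : Fin (k+1), j.val < k → z j ≤ a} = ⋂ j : Fin (k+1), ⋂ (_ : j.val < k), {z | z j ≤ a} := by
            ext; simp
          change MeasurableSet {z : Fin (k+1) → ℝ | ∀ j : Fin (k+1), j.val < k → z j ≤ a}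
          rw [this]
          exact MeasurableSet.iInter fun j => MeasurableSet.iInter fun _ => measurableSet_le (measurable_pi_apply _) measurable_const
        · exact measurableSet_lt measurable_const (measurable_pi_apply _)) (fun z => z (Fin.last k)) (measurable_pi_apply _) a
    have hiff : ∀ ω, ((fun (j : Fin (k+1)) => X (rbGrid t n j) ω) ∈ {z : Fin (k+1) → ℝ | (∀ j : Fin (k+1), j.val < k → z j ≤ a) ∧ a < z (Fin.last k)})
        ↔ rbHit a (fun s => X s ω) (rbGrid t n) k := by
      intro ω
      simp only [mem_ofPred_eq, rbHit, Fin.val_last]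
      refine and_congr_left fun _ => ⟨fun h j hj => h ⟨j, by omega⟩ hj, fun h j hj => h j hj⟩
    simp only [hiff, Fin.val_last, Pi.sub_apply, add_sub_cancel] at this
    rw [this]
    apply lintegral_congr
    intro ω
    simp only [rbF, indicator, mem_ofPred_eq]
    congr 1
  · intro k _ l _ hkl
    rw [Function.onFun, Set.disjoint_left]
    rintro ω ⟨h, -⟩ ⟨h', -⟩
    exact hkl (rbHit_unique h h')
  · intro k _
    exact (hH k).inter (measurableSet_le (hX _) measurable_const)

lemma rb_hit {Ω : Type*} [MeasurableSpace Ω] (P : Measure Ω) [IsProbabilityMeasure P]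
    (X : ℝ → Ω → ℝ) (hX : ∀ s, Measurable (X s)) (hX0 : ∀ ω, X 0 ω = 0)
    (hcont : ∀ᵐ ω ∂P, Continuous fun s => X s ω)
    (hincr : ∀ (n : ℕ) (t : Fin (n + 1) → ℝ), (∀ i, 0 ≤ t i) → StrictMono t →
      iIndepFun (fun i : Fin n => fun ω => X (t i.succ) ω - X (t i.castSucc) ω) P)
    (hlaw : ∀ s t : ℝ, 0 ≤ s → s ≤ t → P.map (fun ω => X t ω - X s ω) =
      gaussianReal ((t - s).toNNReal : ℝ) (t - s).toNNReal)
    (t : ℝ) (ht : 0 < t) (a : ℝ) (ha : 0 ≤ a) :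
    P {ω | ∃ q : RbI, a < X (t * (q.1:ℝ)) ω} =
      gaussianReal (t.toNNReal : ℝ) t.toNNReal (Ioi a) +
      ENNReal.ofReal (Real.exp (2 * a)) * gaussianReal (-(t.toNNReal : ℝ)) t.toNNReal (Ioi a) := by
  classical
  have hXt : P.map (X t) = gaussianReal (t.toNNReal : ℝ) t.toNNReal := by
    have := hlaw 0 t le_rfl ht.le
    simpa [hX0] using this
  have hmE : MeasurableSet {ω | ∃ q : RbI, a < X (t * (q.1:ℝ)) ω} := by
    have : {ω | ∃ q : RbI, a < X (t * (q.1:ℝ)) ω} = ⋃ q : RbI, {ω | a < X (t * (q.1:ℝ)) ω} := by ext; simp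
    rw [this]
    exact MeasurableSet.iUnion fun q => measurableSet_lt measurable_const (hX _)
  have hmL : MeasurableSet {ω | X t ω ≤ a} := measurableSet_le (hX _) measurable_const
  have hmG : MeasurableSet {ω | a < X t ω} := measurableSet_lt measurable_const (hX _)
  have hmn : ∀ n, MeasurableSet {ω | ∃ k ≤ n+1, a < X (rbGrid t n k) ω} := by
    intro n
    have : {ω | ∃ k ≤ n+1, a < X (rbGrid t n k) ω} = ⋃ k, ⋃ (_ : k ≤ n+1), {ω | a < X (rbGrid t n k) ω} := by ext; simp
    rw [this]
    exact MeasurableSet.iUnion fun q => MeasurableSet.iUnion fun _ => measurableSet_lt measurable_const (hX _)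
  have hd := rb_discrete P X hX hX0 hincr hlaw t ht a
  -- left limit
  have lim1 : Tendsto (fun n : ℕ => P {ω | (∃ k ≤ n+1, a < X (rbGrid t n k) ω) ∧ X t ω ≤ a}) atTop
      (𝓝 (P {ω | (∃ q : RbI, a < X (t * (q.1:ℝ)) ω) ∧ X t ω ≤ a})) := by
    have e1 : ∀ n : ℕ, P {ω | (∃ k ≤ n+1, a < X (rbGrid t n k) ω) ∧ X t ω ≤ a} =
        ∫⁻ ω in {ω | X t ω ≤ a}, (if (∃ k ≤ n+1, a < X (rbGrid t n k) ω) then (1:ℝ≥0∞) else 0) ∂P := by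
      intro n
      have := lintegral_indicator_one (μ := P.restrict {ω | X t ω ≤ a}) (hmn n)
      rw [Measure.restrict_apply (hmn n)] at this
      refine this.symm.trans (lintegral_congr fun ω => ?_)
      simp only [indicator, mem_ofPred_eq, Pi.one_apply]
    have e2 : P {ω | (∃ q : RbI, a < X (t * (q.1:ℝ)) ω) ∧ X t ω ≤ a} =
        ∫⁻ ω in {ω | X t ω ≤ a}, (if (∃ q : RbI, a < X (t * (q.1:ℝ)) ω) then (1:ℝ≥0∞) else 0) ∂P := by
      have := lintegral_indicator_one (μ := P.restrict {ω | X t ω ≤ a}) hmE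
      rw [Measure.restrict_apply hmE] at this
      refine this.symm.trans (lintegral_congr fun ω => ?_)
      simp only [indicator, mem_ofPred_eq, Pi.one_apply]
    simp_rw [e1, e2]
    apply tendsto_lintegral_of_dominated_convergence (fun _ => 1)
    · intro n
      exact Measurable.ite (hmn n) measurable_const measurable_const
    · intro n
      apply ae_of_all
      intro ω
      dsimp only
      split_ifs <;> simp
    · simp
    · filter_upwards [ae_restrict_of_ae hcont] with ω hω
      exact rb_path2 a (fun s => X s ω) hω t
  have lim2 : Tendsto (fun n : ℕ => P {ω | (∃ k ≤ n+1, a < X (rbGrid t n k) ω) ∧ X t ω ≤ a}) atTop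
      (𝓝 (∫⁻ ω, (if a < X t ω then ENNReal.ofReal (Real.exp (-2 * (X t ω - a))) else 0) ∂P)) := by
    simp_rw [fun n => (hd n).1]
    apply tendsto_lintegral_of_dominated_convergence (fun _ => 1)
    · intro n
      exact Finset.measurable_sum _ fun k _ => (hd n).2 k
    · intro n
      apply ae_of_all
      intro ω
      by_cases h : ∃ k, rbHit a (fun s => X s ω) (rbGrid t n) k
      · obtain ⟨k, hk⟩ := h
        refine (Finset.sum_le_sum (g := fun j => if j = k then 1 else 0) ?_).trans ?_
        · intro j _
          unfold rbF
          split_ifs with h1 h2 h2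
          · rw [ENNReal.ofReal_le_one]
            apply Real.exp_le_one_iff.2
            have := h1.1.2
            linarith [h1.2]
          · exact absurd (rbHit_unique h1.1 hk) h2
          · simp
          · simp
        · rw [Finset.sum_ite_eq']
          split_ifs <;> simp
      · dsimp only
        rw [Finset.sum_eq_zero]
        · simp
        · intro k _
          unfold rbF
          rw [if_neg]
          exact fun h' => h ⟨k, h'.1⟩
    · simp
    · filter_upwards [hcont] with ω hω
      exact rb_path a ha (fun s => X s ω) hω (hX0 ω) t ht
  have key := tendsto_nhds_unique lim1 lim2
  have e3 : ∫⁻ ω, (if a < X t ω then ENNReal.ofReal (Real.exp (-2 * (X t ω - a))) else 0) ∂P =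
      ENNReal.ofReal (Real.exp (2 * a)) * gaussianReal (-(t.toNNReal : ℝ)) t.toNNReal (Ioi a) := by
    rw [← rb_tilt _ _ measurableSet_Ioi, ← lintegral_const_mul _ (by fun_prop),
      ← lintegral_indicator measurableSet_Ioi, ← hXt, lintegral_map _ (hX t)]
    · apply lintegral_congr
      intro ω
      simp only [indicator, mem_Ioi]
      split_ifs
      · rw [← ENNReal.ofReal_mul (by positivity), ← Real.exp_add]
        congr 2; ring
      · rfl
    · exact Measurable.indicator (by fun_prop) measurableSet_Ioi
  rw [← e3, ← key, ← hXt, Measure.map_apply (hX t) measurableSet_Ioi]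
  rw [← measure_inter_add_sdiff _ hmG]
  congr 2
  · ext ω
    simp only [mem_inter_iff, mem_ofPred_eq, mem_preimage, mem_Ioi]
    constructor
    · exact fun h => h.2
    · intro h
      refine ⟨⟨⟨1, by norm_num⟩, by simpa using h⟩, h⟩
  · ext ω
    simp

lemma rb_gauss_mean (v : ℝ≥0) (hv : v ≠ 0) :
    ∫⁻ x, ENNReal.ofReal (max x 0) ∂(gaussianReal (-(v:ℝ)) v) =
      ENNReal.ofReal (v * gaussianPDFReal (-(v:ℝ)) v 0 - v * (gaussianReal (-(v:ℝ)) v (Ioi 0)).toReal) ∧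
    0 ≤ v * gaussianPDFReal (-(v:ℝ)) v 0 - v * (gaussianReal (-(v:ℝ)) v (Ioi 0)).toReal := by
  have hv' : (v:ℝ) ≠ 0 := by exact_mod_cast hv
  set γ := gaussianReal (-(v:ℝ)) v with hγ
  set f := gaussianPDFReal (-(v:ℝ)) v with hf
  have hid : Integrable (fun x : ℝ => x) γ := by
    have := memLp_id_gaussianReal (μ := -(v:ℝ)) (v := v) 1
    exact (memLp_one_iff_integrable.1 this)
  have hint : Integrable (fun x : ℝ => max x 0) γ := hid.pos_part
  rw [← ofReal_integral_eq_lintegral_ofReal hint (ae_of_all _ fun x => le_max_right _ _)]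
  suffices hs : ∫ x, max x 0 ∂γ = v * f 0 - v * (γ (Ioi 0)).toReal by
    rw [← hs]
    exact ⟨rfl, integral_nonneg fun x => le_max_right _ _⟩
  have hfx : Integrable (fun x => x * f x) volume := by
    have h1 := hid
    rw [hγ, gaussianReal_of_var_ne_zero _ hv,
      integrable_withDensity_iff (measurable_gaussianPDF _ _) (ae_of_all _ fun _ => gaussianPDF_lt_top)] at h1
    simpa [toReal_gaussianPDF] using h1
  have hfi : Integrable f volume := integrable_gaussianPDFReal _ _
  have e1 : ∫ x, max x 0 ∂γ = ∫ x in Ioi 0, x * f x := by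
    rw [hγ, integral_gaussianReal_eq_integral_smul hv, ← integral_indicator measurableSet_Ioi]
    congr 1
    ext x
    simp only [indicator, mem_Ioi, smul_eq_mul]
    split_ifs with h
    · rw [max_eq_left h.le, mul_comm]
    · rw [max_eq_right (not_lt.1 h), mul_zero]
  have e2 : (γ (Ioi 0)).toReal = ∫ x in Ioi 0, f x := by
    rw [hγ, gaussianReal_apply_eq_integral _ hv, ENNReal.toReal_ofReal]
    exact integral_nonneg fun x => gaussianPDFReal_nonneg _ _ _
  have hder : ∀ x ∈ Ici (0:ℝ), HasDerivAt (fun x => -(v:ℝ) * f x) ((x + v) * f x) x := by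
    intro x _
    have h1 : HasDerivAt (fun x : ℝ => -(x - -(v:ℝ))^2 / (2 * v)) (-(2 * (x - -(v:ℝ))) / (2*v)) x := by
      have := (((hasDerivAt_id x).sub_const (-(v:ℝ))).pow 2).neg.div_const (2 * (v:ℝ))
      exact HasDerivAt.congr_deriv (show HasDerivAt (fun x : ℝ => -(x - -(v:ℝ))^2 / (2 * v)) _ x from this) (by simp)
    have h2 := (h1.exp.const_mul ((√(2 * Real.pi * v))⁻¹)).const_mul (-(v:ℝ))
    refine HasDerivAt.congr_deriv (show HasDerivAt (fun x => -(v:ℝ) * f x) _ x from h2) ?_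
    rw [hf]
    simp only [gaussianPDFReal]
    field_simp
    ring
  have hI : IntegrableOn (fun x => (x + v) * f x) (Ioi 0) := by
    have : Integrable (fun x => x * f x + v * f x) := hfx.add (hfi.const_mul _)
    simp_rw [add_mul]
    exact this.integrableOn
  have hlim : Tendsto (fun x => -(v:ℝ) * f x) atTop (𝓝 0) := by
    have : Tendsto f atTop (𝓝 0) := by
      rw [hf]
      unfold gaussianPDFReal
      rw [← mul_zero ((√(2 * Real.pi * v))⁻¹)]
      apply Tendsto.const_mul
      apply Real.tendsto_exp_atBot.comp
      have h1 : Tendsto (fun x : ℝ => x - -(v:ℝ)) atTop atTop := tendsto_atTop_add_const_right _ _ tendsto_id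
      have h2 := (tendsto_pow_atTop (two_ne_zero)).comp h1
      have h3 := (tendsto_neg_atTop_atBot.comp h2).atBot_div_const (r := 2 * (v:ℝ)) (by positivity)
      exact h3
    simpa using this.const_mul (-(v:ℝ))
  have h := integral_Ioi_of_hasDerivAt_of_tendsto' hder hI hlim
  have h' : ∫ x in Ioi 0, (x + v) * f x = (∫ x in Ioi 0, x * f x) + v * ∫ x in Ioi 0, f x := by
    rw [← integral_const_mul, ← integral_add hfx.integrableOn (hfi.const_mul _).integrableOn]
    congr 1; ext x; ring
  rw [e1, e2]
  linarith

lemma rb_gauss_tail (v : ℝ≥0) (hv : v ≠ 0) :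
    gaussianReal (-(v:ℝ)) v (Ioi 0) = gaussianReal 0 1 (Ioi (√v)) := by
  have hvp : (0:ℝ) < v := by positivity
  have h1 : (gaussianReal 0 1).map (fun x => √v * x) = gaussianReal 0 v := by
    rw [gaussianReal_map_const_mul]
    congr 1
    · simp
    · ext; simp
  have h2 : (gaussianReal 0 v).map (fun x => x - (v:ℝ)) = gaussianReal (-(v:ℝ)) v := by
    rw [gaussianReal_map_sub_const]; simp
  rw [← h2, Measure.map_apply (by fun_prop) measurableSet_Ioi, ← h1, Measure.map_apply (by fun_prop) (measurableSet_Ioi.preimage (by fun_prop))]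
  congr 1
  ext x
  simp only [mem_preimage, mem_Ioi, sub_pos]
  have : (0:ℝ) < √v := Real.sqrt_pos.2 hvp
  have h3 : (v:ℝ) = √v * √v := (Real.mul_self_sqrt hvp.le).symm
  conv_lhs => lhs; rw [h3]
  exact mul_lt_mul_iff_right₀ this

lemma rb_lc {α : Type*} [MeasurableSpace α] (μ : Measure α) (f : α → ℝ) (hf : Measurable f)
    (hf0 : ∀ᵐ x ∂μ, 0 ≤ f x) :
    ∫⁻ x, ENNReal.ofReal (1 - Real.exp (-2 * f x)) ∂μ =
      ∫⁻ a in Ioi 0, μ {x | a < f x} * ENNReal.ofReal (2 * Real.exp (-2 * a)) := by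
  rw [← lintegral_comp_eq_lintegral_meas_lt_mul μ hf0 hf.aemeasurable]
  · apply lintegral_congr
    intro x
    congr 1
    have : ∀ y ∈ uIcc 0 (f x), HasDerivAt (fun y : ℝ => -Real.exp (-2 * y)) (2 * Real.exp (-2 * y)) y := by
      intro y _
      have := (((hasDerivAt_id y).const_mul (-2)).exp).neg
      exact HasDerivAt.congr_deriv (show HasDerivAt (fun y : ℝ => -Real.exp (-2 * y)) _ y from this)
        (by simp; ring)
    rw [intervalIntegral.integral_eq_sub_of_hasDerivAt this (Continuous.intervalIntegrable (by fun_prop) _ _)]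
    simp; ring
  · intro t _
    exact Continuous.intervalIntegrable (by fun_prop) _ _
  · exact ae_of_all _ fun a => by positivity

lemma rb_compl {α : Type*} [MeasurableSpace α] (μ : Measure α) [IsProbabilityMeasure μ] (f : α → ℝ)
    (hf : Measurable f) (hf0 : ∀ᵐ x ∂μ, 0 ≤ f x) :
    ∫⁻ x, ENNReal.ofReal (Real.exp (-2 * f x)) ∂μ + ∫⁻ x, ENNReal.ofReal (1 - Real.exp (-2 * f x)) ∂μ = 1 := by
  rw [← lintegral_add_left (by fun_prop)]
  have : ∀ᵐ x ∂μ, ENNReal.ofReal (Real.exp (-2 * f x)) + ENNReal.ofReal (1 - Real.exp (-2 * f x)) = 1 := by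
    filter_upwards [hf0] with x hx
    have : Real.exp (-2 * f x) ≤ 1 := Real.exp_le_one_iff.2 (by linarith)
    rw [← ENNReal.ofReal_add (by positivity) (by linarith)]
    simp
  rw [lintegral_congr_ae this]
  simp

noncomputable def rbM {Ω : Type*} (X : ℝ → Ω → ℝ) (t : ℝ) (ω : Ω) : ℝ := ⨆ q : RbI, X (t * (q.1:ℝ)) ω

lemma rbM_bdd (x : ℝ → ℝ) (hx : Continuous x) (t : ℝ) (ht : 0 < t) :
    BddAbove (range fun q : RbI => x (t * (q.1:ℝ))) := by
  apply (isCompact_Icc.bddAbove_image (hx.continuousOn (s := Icc 0 t))).mono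
  rintro _ ⟨q, rfl⟩
  have hq0 : (0:ℝ) ≤ q.1 := by exact_mod_cast q.2.1
  have hq1 : (q.1:ℝ) ≤ 1 := by exact_mod_cast q.2.2
  exact ⟨_, ⟨by positivity, by nlinarith⟩, rfl⟩

instance : Nonempty RbI := ⟨⟨0, by norm_num⟩⟩

lemma rb_laplace {Ω : Type*} [MeasurableSpace Ω] (P : Measure Ω) [IsProbabilityMeasure P]
    (X : ℝ → Ω → ℝ) (hX : ∀ s, Measurable (X s)) (hX0 : ∀ ω, X 0 ω = 0)
    (hcont : ∀ᵐ ω ∂P, Continuous fun s => X s ω)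
    (hincr : ∀ (n : ℕ) (t : Fin (n + 1) → ℝ), (∀ i, 0 ≤ t i) → StrictMono t →
      iIndepFun (fun i : Fin n => fun ω => X (t i.succ) ω - X (t i.castSucc) ω) P)
    (hlaw : ∀ s t : ℝ, 0 ≤ s → s ≤ t → P.map (fun ω => X t ω - X s ω) =
      gaussianReal ((t - s).toNNReal : ℝ) (t - s).toNNReal)
    (t : ℝ) (ht : 0 < t) :
    Measurable (rbM X t) ∧ (∀ᵐ ω ∂P, 0 ≤ rbM X t ω) ∧
    ∫⁻ ω, ENNReal.ofReal (Real.exp (-2 * rbM X t ω)) ∂P =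
      ENNReal.ofReal (2 * (1 + t) * (gaussianReal 0 1 (Ioi (√t))).toReal
        - Real.sqrt (2 * t / Real.pi) * Real.exp (-(t / 2))) := by
  have hM : Measurable (rbM X t) := Measurable.iSup fun q => hX _
  have hM0 : ∀ᵐ ω ∂P, 0 ≤ rbM X t ω := by
    filter_upwards [hcont] with ω hω
    have := le_ciSup (rbM_bdd _ hω t ht) ⟨0, by norm_num⟩
    simpa [hX0, rbM] using this
  refine ⟨hM, hM0, ?_⟩
  have hlt : ∀ a, P {ω | a < rbM X t ω} = P {ω | ∃ q : RbI, a < X (t * (q.1:ℝ)) ω} := by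
    intro a
    apply measure_congr
    filter_upwards [hcont] with ω hω
    exact propext (lt_ciSup_iff (rbM_bdd _ hω t ht))
  set v := t.toNNReal with hvdef
  have hvt : (v:ℝ) = t := Real.coe_toNNReal t ht.le
  have hv : v ≠ 0 := by
    intro h; rw [h] at hvt; simp at hvt; linarith
  set γ := gaussianReal (v:ℝ) v with hγ
  set γ' := gaussianReal (-(v:ℝ)) v with hγ'
  have hmax : ∀ a : ℝ, 0 < a → {x : ℝ | a < max x 0} = Ioi a := by
    intro a ha
    ext x
    simp [ha.not_gt]
  have S : ∫⁻ ω, ENNReal.ofReal (1 - Real.exp (-2 * rbM X t ω)) ∂P =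
      ∫⁻ x, ENNReal.ofReal (1 - Real.exp (-2 * max x 0)) ∂γ + 2 * ∫⁻ x, ENNReal.ofReal (max x 0) ∂γ' := by
    rw [rb_lc P _ hM hM0, rb_lc γ (fun x => max x 0) (by fun_prop) (ae_of_all _ fun x => le_max_right _ _),
      lintegral_eq_lintegral_meas_lt γ' (f := fun x => max x 0) (ae_of_all _ fun x => le_max_right _ _) (by fun_prop),
      ← lintegral_const_mul' _ _ (by simp)]
    have hmeas1 : Measurable (fun a : ℝ => γ {x | a < max x 0}) := by
      apply Antitone.measurable
      intro a b hab
      apply measure_mono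
      intro x hx
      exact lt_of_le_of_lt hab hx
    have hmeas2 : Measurable (fun a : ℝ => γ {x | a < max x 0} * ENNReal.ofReal (2 * Real.exp (-2 * a))) :=
      hmeas1.mul (by fun_prop)
    rw [← lintegral_add_left hmeas2]
    apply setLIntegral_congr_fun measurableSet_Ioi
    intro a ha
    have ha : 0 < a := ha
    simp only
    rw [hlt, rb_hit P X hX hX0 hcont hincr hlaw t ht a ha.le, hmax a ha, add_mul]
    congr 1
    rw [mul_right_comm, ← ENNReal.ofReal_mul (by positivity)]
    congr 1
    have : Real.exp (2 * a) * (2 * Real.exp (-2 * a)) = 2 := by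
      rw [mul_left_comm, ← Real.exp_add]; simp
    rw [this]; simp
  have c1 := rb_compl P _ hM hM0
  have c2 := rb_compl γ (fun x => max x 0) (by fun_prop) (ae_of_all _ fun x => le_max_right _ _)
  have hψ := rb_gauss_tail v hv
  have hI1 : ∫⁻ x, ENNReal.ofReal (Real.exp (-2 * max x 0)) ∂γ = 2 * γ' (Ioi 0) := by
    rw [← lintegral_add_compl _ (measurableSet_Ioi (a := (0:ℝ))), two_mul]
    congr 1
    · rw [hγ', ← rb_tilt _ _ measurableSet_Ioi]
      apply setLIntegral_congr_fun measurableSet_Ioi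
      intro x hx
      have hx : 0 < x := hx
      simp [max_eq_left hx.le]
    · have h1 : ∫⁻ x in (Ioi 0)ᶜ, ENNReal.ofReal (Real.exp (-2 * max x 0)) ∂γ = ∫⁻ x in (Ioi (0:ℝ))ᶜ, 1 ∂γ := by
        apply setLIntegral_congr_fun measurableSet_Ioi.compl
        intro x hx
        have hx : x ≤ 0 := by simpa using hx
        simp [max_eq_right hx]
      rw [h1, setLIntegral_one, compl_Ioi]
      have h2 := rb_flip v 0
      rw [rb_tilt _ _ measurableSet_Ici, neg_zero] at h2
      rw [hγ, h2]
      have := nullSingletonClass_gaussianReal (μ := -(v:ℝ)) hv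
      exact (measure_congr Ioi_ae_eq_Ici).symm
  obtain ⟨hm, hr⟩ := rb_gauss_mean v hv
  set r := v * gaussianPDFReal (-(v:ℝ)) v 0 - v * (gaussianReal (-(v:ℝ)) v (Ioi 0)).toReal with hrdef
  rw [S, hm, ← c2, hI1] at c1
  have hfin : ∫⁻ x, ENNReal.ofReal (1 - Real.exp (-2 * max x 0)) ∂γ ≠ ∞ := by
    intro h; rw [h] at c2; simp at c2
  rw [add_comm (∫⁻ x, ENNReal.ofReal (1 - Real.exp (-2 * max x 0)) ∂γ), ← add_assoc] at c1
  have c3 := (ENNReal.add_left_inj hfin).1 c1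
  have c4 : (2:ℝ≥0∞) * ENNReal.ofReal r = ENNReal.ofReal (2 * r) := by
    rw [ENNReal.ofReal_mul (by norm_num)]; simp
  have c5 : (2:ℝ≥0∞) * γ' (Ioi 0) = ENNReal.ofReal (2 * (γ' (Ioi 0)).toReal) := by
    rw [ENNReal.ofReal_mul (by norm_num), ENNReal.ofReal_toReal (measure_ne_top _ _)]; simp
  rw [c4, c5] at c3
  rw [ENNReal.eq_sub_of_add_eq ENNReal.ofReal_ne_top c3, ← ENNReal.ofReal_sub _ (by positivity)]
  congr 1
  have hp : 2 * (t * gaussianPDFReal (-t) v 0) = √(2 * t / Real.pi) * Real.exp (-(t/2)) := by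
    unfold gaussianPDFReal
    rw [hvt]
    have e1 : -(0 - -t)^2 / (2 * t) = -(t/2) := by field_simp; ring
    rw [e1, ← mul_assoc, ← mul_assoc]
    congr 1
    have hpi := Real.pi_pos
    symm
    rw [Real.sqrt_eq_iff_mul_self_eq (by positivity) (by positivity)]
    field_simp
    exact Real.sq_sqrt (by positivity)
  rw [hrdef, hγ', hψ, hvt, ← hp]
  ring

lemma rb_inf (b : ℝ → ℝ) (hb : Continuous b) (t : ℝ) (ht : 0 < t) :
    (⨅ s : Set.Icc (0:ℝ) t, (b (s : ℝ) - (s : ℝ))) = - ⨆ q : RbI, ((t * (q.1:ℝ)) - b (t * (q.1:ℝ))) := by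
  have hc : Continuous (fun s => s - b s) := by fun_prop
  have hbd := rbM_bdd _ hc t ht
  have : Nonempty (Set.Icc (0:ℝ) t) := ⟨⟨0, le_rfl, ht.le⟩⟩
  apply le_antisymm
  · rw [le_neg]
    apply ciSup_le
    intro q
    have hq0 : (0:ℝ) ≤ q.1 := by exact_mod_cast q.2.1
    have hq1 : (q.1:ℝ) ≤ 1 := by exact_mod_cast q.2.2
    have hbb : BddBelow (range fun s : Set.Icc (0:ℝ) t => b (s:ℝ) - (s:ℝ)) := by
      apply (isCompact_Icc.bddBelow_image ((hb.sub continuous_id).continuousOn (s := Icc 0 t))).mono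
      rintro _ ⟨s, rfl⟩
      exact ⟨s.1, s.2, rfl⟩
    have := ciInf_le hbb ⟨t * q.1, by positivity, by nlinarith⟩
    dsimp only at this
    linarith
  · apply le_ciInf
    intro ⟨s, hs0, hst⟩
    dsimp only
    have hq0 : 0 ≤ s / t := by positivity
    have hq1 : s / t ≤ 1 := (div_le_one ht).2 hst
    have hcc : Tendsto (fun n : ℕ => ((n:ℝ) + 1)) atTop atTop :=
      tendsto_atTop_add_const_right _ _ tendsto_natCast_atTop_atTop
    have h1 := ((tendsto_nat_floor_mul_div_atTop hq0).comp hcc).const_mul t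
    have h2 := (hc.tendsto _).comp h1
    have h3 : t * (s / t) = s := by field_simp
    rw [h3] at h2
    have := le_of_tendsto' h2 (b := ⨆ q : RbI, ((t * (q.1:ℝ)) - b (t * (q.1:ℝ)))) (by
      intro n
      have hn1 : (0:ℚ) < n + 1 := by positivity
      have h4 : ⌊s / t * ((n:ℝ)+1)⌋₊ ≤ n + 1 := by
        apply Nat.floor_le_of_le
        push_cast
        nlinarith [(n.cast_nonneg : (0:ℝ) ≤ n)]
      have := le_ciSup hbd ⟨(⌊s / t * ((n:ℝ)+1)⌋₊ : ℚ) / (n+1), by positivity, by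
        rw [div_le_one hn1]; exact_mod_cast h4⟩
      simp only [Function.comp]
      push_cast at this
      exact this)
    linarith

/-- **Theorem 2.3**: `P(M(t) > u)` for reflected Brownian motion. -/
theorem inf_reflected_brownian_tail
    {Ω : Type*} [MeasureSpace Ω] [IsProbabilityMeasure (ℙ : Measure Ω)]
    (B : ℝ → Ω → ℝ)
    (hmeas : ∀ t : ℝ, Measurable (B t))
    (hB0 : ∀ᵐ ω ∂ℙ, B 0 ω = 0)
    (hcont : ∀ᵐ ω ∂ℙ, Continuous fun s => B s ω)
    (hincr : ∀ (n : ℕ) (t : Fin (n + 1) → ℝ), (∀ i, 0 ≤ t i) → StrictMono t →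
      iIndepFun
        (fun i : Fin n => fun ω => B (t i.succ) ω - B (t i.castSucc) ω) ℙ)
    (hgauss : ∀ s t : ℝ, 0 ≤ s → s ≤ t →
      Measure.map (fun ω => B t ω - B s ω) ℙ = gaussianReal 0 (Real.toNNReal (t - s)))
    (Ψ : ℝ → ℝ) (hΨ : ∀ x : ℝ, Ψ x = (gaussianReal 0 1 (Set.Ioi x)).toReal)
    (Q : Ω → ℝ) (hQ_meas : Measurable Q)
    (hQ_exp : ∀ y : ℝ, 0 ≤ y → ℙ {ω | y < Q ω} = ENNReal.ofReal (Real.exp (-2 * y)))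
    (hQ_indep : IndepFun Q (fun ω => fun t : ℝ => B t ω) ℙ)
    (t u : ℝ) (ht : 0 < t) (hu : 0 < u) :
    ℙ {ω | u < Q ω + ⨅ s : Set.Icc (0:ℝ) t, (B (s : ℝ) ω - (s : ℝ))}
      = ENNReal.ofReal (Real.exp (-2 * u) *
          (2 * (1 + t) * Ψ (Real.sqrt t)
            - Real.sqrt (2 * t / Real.pi) * Real.exp (-(t / 2)))) := by
  set X : ℝ → Ω → ℝ := fun s ω => s - (B s ω - B 0 ω) with hXdef
  have hX : ∀ s, Measurable (X s) := fun s => measurable_const.sub ((hmeas s).sub (hmeas 0))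
  have hX0 : ∀ ω, X 0 ω = 0 := fun ω => by simp [hXdef]
  have hXc : ∀ᵐ ω ∂ℙ, Continuous fun s => X s ω := by
    filter_upwards [hcont] with ω hω
    exact continuous_id.sub (hω.sub continuous_const)
  have hXi : ∀ (n : ℕ) (t : Fin (n + 1) → ℝ), (∀ i, 0 ≤ t i) → StrictMono t →
      iIndepFun (fun i : Fin n => fun ω => X (t i.succ) ω - X (t i.castSucc) ω) ℙ := by
    intro n r h0 hr
    have := (hincr n r h0 hr).comp (fun i x => (r i.succ - r i.castSucc) - x) (fun i => by fun_prop)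
    convert this using 2 with i
    ext ω
    simp only [hXdef, Function.comp]
    ring
  have hXl : ∀ s t : ℝ, 0 ≤ s → s ≤ t → (ℙ : Measure Ω).map (fun ω => X t ω - X s ω) =
      gaussianReal ((t - s).toNNReal : ℝ) (t - s).toNNReal := by
    intro s r hs hsr
    have h1 : (fun ω => X r ω - X s ω) = (fun x => (r - s) - x) ∘ (fun ω => B r ω - B s ω) := by
      ext ω
      simp only [hXdef, Function.comp]
      ring
    have h3 : Measurable (fun ω => B r ω - B s ω) := (hmeas r).sub (hmeas s)
    rw [h1, ← Measure.map_map (by fun_prop) h3]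
    have h2 := hgauss s r hs hsr
    change Measure.map (fun x => (r - s) - x) (Measure.map (fun ω => B r ω - B s ω) ℙ) = _
    rw [h2, gaussianReal_map_const_sub, Real.coe_toNNReal _ (by linarith)]
    simp
  obtain ⟨hM, hM0, hL⟩ := rb_laplace ℙ X hX hX0 hXc hXi hXl t ht
  have hset : ℙ {ω | u < Q ω + ⨅ s : Set.Icc (0:ℝ) t, (B (s : ℝ) ω - (s : ℝ))} =
      ℙ {ω | u + rbM X t ω < Q ω} := by
    apply measure_congr
    filter_upwards [hcont, hB0] with ω hω h0
    apply propext
    change (u < Q ω + ⨅ s : Set.Icc (0:ℝ) t, (B (s : ℝ) ω - (s : ℝ))) ↔ u + rbM X t ω < Q ω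
    rw [rb_inf (fun s => B s ω) hω t ht]
    have : rbM X t ω = ⨆ q : RbI, ((t * (q.1:ℝ)) - B (t * (q.1:ℝ)) ω) := by
      simp only [rbM, hXdef, h0, sub_zero]
    rw [this]
    constructor <;> intro h <;> linarith
  have hind : IndepFun (rbM X t) Q ℙ := by
    have hΦ : Measurable (fun b : ℝ → ℝ => ⨆ q : RbI, (t * (q.1:ℝ) - (b (t * (q.1:ℝ)) - b 0))) :=
      Measurable.iSup fun q => by fun_prop
    exact (hQ_indep.comp measurable_id hΦ).symm
  have hprod := (indepFun_iff_map_prod_eq_prod_map_map hM.aemeasurable hQ_meas.aemeasurable).1 hind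
  have hS : MeasurableSet {p : ℝ × ℝ | u + p.1 < p.2} :=
    measurableSet_lt (by fun_prop) (by fun_prop)
  have e1 : ℙ {ω | u + rbM X t ω < Q ω} =
      ((ℙ : Measure Ω).map (fun ω => (rbM X t ω, Q ω))) {p : ℝ × ℝ | u + p.1 < p.2} := by
    rw [Measure.map_apply (hM.prodMk hQ_meas) hS]; rfl
  have e2 : ℙ {ω | u + rbM X t ω < Q ω} =
      ∫⁻ ω, ENNReal.ofReal (Real.exp (-2 * u)) * ENNReal.ofReal (Real.exp (-2 * rbM X t ω)) ∂ℙ := by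
    rw [e1, hprod, Measure.prod_apply hS, lintegral_map (measurable_measure_prodMk_left hS) hM]
    apply lintegral_congr_ae
    filter_upwards [hM0] with ω hω
    rw [Measure.map_apply hQ_meas (hS.preimage (by fun_prop)), ← ENNReal.ofReal_mul (by positivity),
      ← Real.exp_add]
    have := hQ_exp (u + rbM X t ω) (by linarith)
    rw [mul_add] at this
    exact this
  rw [hset, e2, lintegral_const_mul _ (by fun_prop), hL, ← ENNReal.ofReal_mul (by positivity), hΨ]
end

section
/- For every t > 0: E[exp(−2 · sup_{s∈[0,t]} (B(s) + s))] = 2(1 + t)Ψ(√t) − √(2t/π) · e^{−t/2}. -/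
open MeasureTheory ProbabilityTheory Filter Set

section aux
open Topology
open scoped ENNReal NNReal

def FH (x : ℝ) (w : ℕ → ℝ) (k : ℕ) : Prop := x ≤ w k ∧ ∀ j < k, w j < x

lemma FH_unique {x : ℝ} {w : ℕ → ℝ} {k l : ℕ} (hk : FH x w k) (hl : FH x w l) : k = l := by
  rcases lt_trichotomy k l with h | h | h
  · exact absurd (hl.2 k h) (not_lt.2 hk.1)
  · exact h
  · exact absurd (hk.2 l h) (not_lt.2 hl.1)

open Classical in
noncomputable def hsum (x : ℝ) (w : ℕ → ℝ) (n : ℕ) (f : ℝ → ℝ≥0∞) : ℝ≥0∞ :=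
  ∑ k ∈ Finset.range n, if FH x w k then f (w k) else 0

lemma hsum_eq {x : ℝ} {w : ℕ → ℝ} {n k : ℕ} (f : ℝ → ℝ≥0∞) (hk : FH x w k) (hkn : k < n) :
    hsum x w n f = f (w k) := by
  unfold hsum
  rw [Finset.sum_eq_single k]
  · simp [hk]
  · intro b _ hb
    rw [if_neg]
    intro h
    exact hb (FH_unique h hk)
  · intro h
    simp [hkn] at h

lemma hsum_eq_zero {x : ℝ} {w : ℕ → ℝ} {n : ℕ} (f : ℝ → ℝ≥0∞) (h : ∀ k < n, ¬ FH x w k) :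
    hsum x w n f = 0 := by
  unfold hsum
  apply Finset.sum_eq_zero
  intro k hk
  rw [if_neg (h k (by simpa using hk))]

lemma hsum_le_one {x : ℝ} {w : ℕ → ℝ} {n : ℕ} (f : ℝ → ℝ≥0∞) (hf : ∀ a, x ≤ a → f a ≤ 1) :
    hsum x w n f ≤ 1 := by
  by_cases h : ∃ k < n, FH x w k
  · obtain ⟨k, hk, hF⟩ := h
    rw [hsum_eq f hF hk]
    exact hf _ hF.1
  · push Not at h
    rw [hsum_eq_zero f h]
    simp

lemma exists_FH {x : ℝ} {w : ℕ → ℝ} {m : ℕ} (h : x ≤ w m) : ∃ k ≤ m, FH x w k := by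
  classical
  have hex : ∃ m, x ≤ w m := ⟨m, h⟩
  exact ⟨Nat.find hex, Nat.find_min' hex h, Nat.find_spec hex, fun j hj => not_le.1 (Nat.find_min hex hj)⟩

lemma hsum_tendsto (w : ℝ → ℝ) (hw : Continuous w) (t x : ℝ) (ht : 0 < t) (h0 : w 0 < x)
    (hs : ∃ s ∈ Icc 0 t, x < w s) (f : ℝ → ℝ≥0∞) (hf : ContinuousAt f x) :
    Tendsto (fun n : ℕ => hsum x (fun k => w (k * (t / (n + 1)))) (n + 1) f) atTop (𝓝 (f x)) := by
  -- a point strictly before t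
  obtain ⟨s, ⟨hs0, hst⟩, hxs⟩ : ∃ s ∈ Ico 0 t, x < w s := by
    obtain ⟨s, ⟨hs0, hst⟩, hxs⟩ := hs
    rcases hst.lt_or_eq with h | h
    · exact ⟨s, ⟨hs0, h⟩, hxs⟩
    · have h1 : ∀ᶠ y in 𝓝[<] t, x < w y := by
        apply (hw.continuousAt.tendsto.mono_left nhdsWithin_le_nhds).eventually
        rw [← h]
        exact lt_mem_nhds hxs
      have h2 : ∀ᶠ y in 𝓝[<] t, y ∈ Ioo 0 t := Ioo_mem_nhdsLT ht
      obtain ⟨y, hy1, hy2⟩ := (h1.and h2).exists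
      exact ⟨y, ⟨hy2.1.le, hy2.2⟩, hy1⟩
  have hev1 : ∀ᶠ n : ℕ in atTop, ∃ m < n + 1, x ≤ w (m * (t / (n + 1))) := by
    have hlim : Tendsto (fun n : ℕ => (⌊(s / t) * ((n : ℝ) + 1)⌋₊ : ℝ) * (t / (n + 1))) atTop (𝓝 s) := by
      have h1 : Tendsto (fun n : ℕ => (⌊(s / t) * ((n : ℝ) + 1)⌋₊ : ℝ) / ((n : ℝ) + 1)) atTop (𝓝 (s / t)) :=
        (tendsto_nat_floor_mul_div_atTop (by positivity)).comp
          (tendsto_atTop_add_const_right _ 1 tendsto_natCast_atTop_atTop)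
      have h2 := h1.mul_const t
      rw [div_mul_cancel₀ _ ht.ne'] at h2
      refine h2.congr fun n => ?_
      ring
    have h3 := (hw.continuousAt.tendsto.comp hlim).eventually (lt_mem_nhds hxs)
    filter_upwards [h3] with n hn
    refine ⟨_, ?_, hn.le⟩
    rw [Nat.floor_lt (by positivity)]
    push_cast
    have : s / t < 1 := (div_lt_one ht).2 hst
    have : (0:ℝ) < n + 1 := by positivity
    nlinarith
  rw [Filter.tendsto_def]
  intro U hU
  have hU' := hf hU
  rw [Filter.mem_map, Metric.mem_nhds_iff] at hU'
  obtain ⟨ε, hε, hball⟩ := hU'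
  have huc := (isCompact_Icc (a := (0:ℝ)) (b := t)).uniformContinuousOn_of_continuous hw.continuousOn
  rw [Metric.uniformContinuousOn_iff] at huc
  obtain ⟨δ, hδ, huc⟩ := huc ε hε
  have hev2 : ∀ᶠ n : ℕ in atTop, t / ((n : ℝ) + 1) < δ := by
    have : Tendsto (fun n : ℕ => t / ((n : ℝ) + 1)) atTop (𝓝 0) :=
      tendsto_const_nhds.div_atTop (tendsto_atTop_add_const_right _ 1 tendsto_natCast_atTop_atTop)
    exact this.eventually (gt_mem_nhds hδ)
  filter_upwards [hev1, hev2] with n ⟨m, hmn, hm⟩ hn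
  obtain ⟨k, hkm, hF⟩ := exists_FH (w := fun k : ℕ => w (k * (t / (n + 1)))) hm
  rw [mem_preimage, hsum_eq f hF (lt_of_le_of_lt hkm hmn)]
  apply hball
  have hk0 : k ≠ 0 := by
    rintro rfl
    have := hF.1
    simp at this
    linarith
  obtain ⟨j, rfl⟩ := Nat.exists_eq_succ_of_ne_zero hk0
  have h1 := hF.1
  have h2 := hF.2 j (Nat.lt_succ_self j)
  simp only at h1 h2
  have hpos : (0:ℝ) < n + 1 := by positivity
  have hd : (0:ℝ) < t / (n + 1) := by positivity
  have hjn : ((j:ℝ) + 1) ≤ n + 1 := by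
    have : j + 1 ≤ n + 1 := by omega
    exact_mod_cast this
  have hle : ((j:ℝ) + 1) * (t / (n + 1)) ≤ t := by
    calc ((j:ℝ) + 1) * (t / (n + 1)) ≤ (n + 1) * (t / (n + 1)) := by gcongr
      _ = t := by field_simp
  have h3 := huc (((j + 1 : ℕ) : ℝ) * (t / (n + 1))) ⟨by positivity, by push_cast; exact hle⟩
    ((j : ℝ) * (t / (n + 1))) ⟨by positivity, by nlinarith⟩ (by
      rw [Real.dist_eq, show ((j + 1 : ℕ) : ℝ) * (t / (n + 1)) - (j : ℝ) * (t / (n + 1)) = t / (n+1) by push_cast; ring,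
        abs_of_pos hd]; exact hn)
  rw [Real.dist_eq, abs_lt] at h3
  rw [Metric.mem_ball, Real.dist_eq, abs_lt]
  constructor <;> simp only [Nat.succ_eq_add_one] at * <;> linarith

lemma pdf_flip {v : ℝ} (hv : 0 < v) (y : ℝ) :
    gaussianPDFReal v v.toNNReal (-y) = gaussianPDFReal v v.toNNReal y * Real.exp (-2 * y) := by
  unfold gaussianPDFReal
  rw [mul_assoc (_ : ℝ)⁻¹ (Real.exp _), ← Real.exp_add, Real.coe_toNNReal _ hv.le]
  congr 2
  field_simp
  ring

lemma gauss_flip {v : ℝ} (hv : 0 < v) (g : ℝ → ℝ≥0∞) (hg : Measurable g) :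
    ∫⁻ y, g y ∂(gaussianReal v v.toNNReal)
      = ∫⁻ y, g (-y) * ENNReal.ofReal (Real.exp (-2 * y)) ∂(gaussianReal v v.toNNReal) := by
  have hv' : v.toNNReal ≠ 0 := by simpa using hv
  rw [gaussianReal_of_var_ne_zero _ hv',
    lintegral_withDensity_eq_lintegral_mul _ (measurable_gaussianPDF _ _) hg,
    lintegral_withDensity_eq_lintegral_mul _ (measurable_gaussianPDF _ _) (by fun_prop),
    ← lintegral_neg_eq_self]
  congr 1
  ext y
  simp only [Pi.mul_apply]
  have : gaussianPDF v v.toNNReal (-y) = gaussianPDF v v.toNNReal y * ENNReal.ofReal (Real.exp (-2 * y)) := by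
    unfold gaussianPDF
    rw [← ENNReal.ofReal_mul (gaussianPDFReal_nonneg _ _ _)]
    rw [pdf_flip hv]
  rw [this]
  ring


lemma indep_grid {Ω : Type*} [MeasureSpace Ω] [IsProbabilityMeasure (ℙ : Measure Ω)]
    (B : ℝ → Ω → ℝ) (hmeas : ∀ t : ℝ, Measurable (B t))
    (hincr : ∀ (n : ℕ) (t : Fin (n + 1) → ℝ), (∀ i, 0 ≤ t i) → StrictMono t →
      iIndepFun
        (fun i : Fin n => fun ω => B (t i.succ) ω - B (t i.castSucc) ω) ℙ)
    (h : ℝ) (hh : 0 < h) (n k : ℕ) (hk : k ≤ n) (W : ℝ → Ω → ℝ)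
    (hW : ∀ s ω, W s ω = B s ω - B 0 ω + s) :
    IndepFun (fun ω (j : ℕ) => W ((min j k : ℕ) * h) ω) (fun ω => W (n * h) ω - W (k * h) ω) ℙ := by
  have h1 := hincr n (fun i => (i : ℝ) * h) (fun i => by positivity) (by
    intro i j hij
    have : ((i : ℕ) : ℝ) < (j : ℕ) := by exact_mod_cast hij
    simp only
    gcongr)
  simp only [Fin.val_succ, Fin.val_castSucc] at h1
  let S : Finset (Fin n) := Finset.univ.filter (fun i => (i : ℕ) < k)
  let T : Finset (Fin n) := Finset.univ.filter (fun i => ¬ (i : ℕ) < k)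
  have h2 := h1.indepFun_finset S T (Finset.disjoint_filter_filter_not _ _ _)
    (fun i => (hmeas _).sub (hmeas _))
  have h3 := h2.comp
    (φ := fun z (j : ℕ) => (∑ i : S, if ((i : Fin n) : ℕ) < j then z i else 0) + ((min j k : ℕ) : ℝ) * h)
    (ψ := fun z => (∑ i : T, z i) + ((n : ℝ) - k) * h)
    (by
      refine measurable_pi_lambda _ fun j => Measurable.add_const (Finset.measurable_sum _ fun i _ => ?_) _
      split_ifs <;> fun_prop)
    (by fun_prop)
  convert h3 using 1
  · ext ω j
    simp only [Function.comp]
    rw [Finset.sum_coe_sort S (fun i : Fin n => if (i : ℕ) < j then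
      B (((i : ℕ) + 1 : ℕ) * h) ω - B ((i : ℕ) * h) ω else 0), Finset.sum_filter,
      Fin.sum_univ_eq_sum_range (fun i => if i < k then if i < j then
      B (((i : ℕ) + 1 : ℕ) * h) ω - B ((i : ℕ) * h) ω else 0 else 0) n]
    have : ∀ i ∈ Finset.range n, (if i < k then if i < j then
      B (((i : ℕ) + 1 : ℕ) * h) ω - B ((i : ℕ) * h) ω else 0 else 0)
      = if i < min j k then B (((i : ℕ) + 1 : ℕ) * h) ω - B ((i : ℕ) * h) ω else 0 := by
      intro i _
      by_cases h1 : i < k <;> by_cases h2 : i < j <;> simp [h1, h2]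
    rw [Finset.sum_congr rfl this, ← Finset.sum_filter,
      show (Finset.range n).filter (fun i => i < min j k) = Finset.range (min j k) by
        ext i; simp; omega,
      Finset.sum_range_sub (fun i : ℕ => B ((i : ℕ) * h) ω), hW]
    simp
  · ext ω
    simp only [Function.comp]
    rw [Finset.sum_coe_sort T (fun i : Fin n => 
      B (((i : ℕ) + 1 : ℕ) * h) ω - B ((i : ℕ) * h) ω), Finset.sum_filter,
      Fin.sum_univ_eq_sum_range (fun i => if ¬ i < k then 
      B (((i : ℕ) + 1 : ℕ) * h) ω - B ((i : ℕ) * h) ω else 0) n, ← Finset.sum_filter,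
      show (Finset.range n).filter (fun i => ¬ i < k) = Finset.Ico k n by
        ext i; simp; omega,
      Finset.sum_Ico_sub (fun i : ℕ => B ((i : ℕ) * h) ω) hk, hW, hW]
    ring

open Classical in
lemma step_flip {Ω : Type*} [MeasureSpace Ω] [IsProbabilityMeasure (ℙ : Measure Ω)]
    (V : Ω → ℕ → ℝ) (R : Ω → ℝ) (hV : Measurable V) (hR : Measurable R) (hind : IndepFun V R ℙ)
    (v : ℝ) (hv : 0 < v) (hlaw : Measure.map R ℙ = gaussianReal v v.toNNReal)
    (F : (ℕ → ℝ) → ℝ → ℝ≥0∞) (hF : Measurable (Function.uncurry F)) :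
    ∫⁻ ω, F (V ω) (R ω) ∂ℙ = ∫⁻ ω, F (V ω) (- R ω) * ENNReal.ofReal (Real.exp (-2 * R ω)) ∂ℙ := by
  have hm := (indepFun_iff_map_prod_eq_prod_map_map hV.aemeasurable hR.aemeasurable).1 hind
  have hG : Measurable (fun p : (ℕ → ℝ) × ℝ => F p.1 (-p.2) * ENNReal.ofReal (Real.exp (-2 * p.2))) := by
    refine Measurable.mul ?_ (by fun_prop)
    exact hF.comp (measurable_fst.prodMk measurable_snd.neg)
  have e1 : ∫⁻ ω, F (V ω) (R ω) ∂ℙ = ∫⁻ p, F p.1 p.2 ∂(Measure.map (fun ω => (V ω, R ω)) ℙ) :=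
    (lintegral_map hF (hV.prodMk hR)).symm
  have e2 : ∫⁻ ω, F (V ω) (- R ω) * ENNReal.ofReal (Real.exp (-2 * R ω)) ∂ℙ
      = ∫⁻ p, F p.1 (-p.2) * ENNReal.ofReal (Real.exp (-2 * p.2)) ∂(Measure.map (fun ω => (V ω, R ω)) ℙ) :=
    (lintegral_map hG (hV.prodMk hR)).symm
  have : IsProbabilityMeasure (Measure.map V ℙ) := Measure.isProbabilityMeasure_map hV.aemeasurable
  rw [e1, e2, hm, hlaw, lintegral_prod (fun p : (ℕ → ℝ) × ℝ => F p.1 p.2) hF.aemeasurable, lintegral_prod _ hG.aemeasurable]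
  refine lintegral_congr fun a => ?_
  exact gauss_flip hv (F a) (hF.comp (measurable_const.prodMk measurable_id))

lemma measurableSet_FH (x : ℝ) (k : ℕ) : MeasurableSet {w : ℕ → ℝ | FH x w k} := by
  unfold FH
  refine MeasurableSet.inter (measurableSet_le measurable_const (measurable_pi_apply k)) ?_
  have : {w : ℕ → ℝ | ∀ j < k, w j < x} = ⋂ j, ⋂ (_ : j < k), {w : ℕ → ℝ | w j < x} := by
    ext w; simp
  change MeasurableSet {w : ℕ → ℝ | ∀ j < k, w j < x}
  rw [this]
  exact MeasurableSet.iInter fun j => MeasurableSet.iInter fun _ =>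
    measurableSet_lt (measurable_pi_apply j) measurable_const

lemma FH_min (x : ℝ) (w : ℕ → ℝ) (k : ℕ) : FH x (fun j => w (min j k)) k ↔ FH x w k := by
  unfold FH
  simp only [min_self]
  refine and_congr Iff.rfl (forall_congr' fun j => imp_congr_right fun hj => ?_)
  rw [min_eq_left hj.le]

noncomputable def fA (x y : ℝ) : ℝ → ℝ≥0∞ := fun _ => (Iio x).indicator 1 y
noncomputable def fC (x y : ℝ) : ℝ → ℝ≥0∞ :=
  fun a => (Iio x).indicator 1 (2 * a - y) * ENNReal.ofReal (Real.exp (-2 * (y - a)))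

lemma measurable_W {Ω : Type*} [MeasureSpace Ω] (B : ℝ → Ω → ℝ) (hmeas : ∀ t : ℝ, Measurable (B t))
    (W : ℝ → Ω → ℝ) (hW : ∀ s ω, W s ω = B s ω - B 0 ω + s) (s : ℝ) : Measurable (W s) := by
  have : W s = fun ω => B s ω - B 0 ω + s := funext (hW s)
  rw [this]
  exact ((hmeas s).sub (hmeas 0)).add_const s

lemma fC_meas (x : ℝ) : Measurable (fun p : ℝ × ℝ => fC x p.1 p.2) := by
  unfold fC
  refine Measurable.mul ?_ (by fun_prop)
  exact (measurable_one.indicator measurableSet_Iio).comp (by fun_prop)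

lemma fA_meas (x : ℝ) : Measurable (fun p : ℝ × ℝ => fA x p.1 p.2) := by
  unfold fA
  exact (measurable_one.indicator measurableSet_Iio).comp (by fun_prop)

lemma hsum_meas {Ω : Type*} [MeasureSpace Ω] (w : ℕ → Ω → ℝ) (y : Ω → ℝ) (hw : ∀ k, Measurable (w k))
    (hy : Measurable y) (x : ℝ) (n : ℕ) (f : ℝ → ℝ → ℝ≥0∞) (hf : Measurable (fun p : ℝ × ℝ => f p.1 p.2)) :
    Measurable (fun ω => hsum x (fun k => w k ω) n (f (y ω))) := by
  unfold hsum
  refine Finset.measurable_sum _ fun k _ => ?_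
  refine Measurable.ite ?_ (hf.comp (hy.prodMk (hw k))) measurable_const
  exact (measurable_pi_lambda (fun ω k => w k ω) hw) (measurableSet_FH x k)

open Classical in
lemma discrete_reflection {Ω : Type*} [MeasureSpace Ω] [IsProbabilityMeasure (ℙ : Measure Ω)]
    (B : ℝ → Ω → ℝ) (hmeas : ∀ t : ℝ, Measurable (B t))
    (hincr : ∀ (n : ℕ) (t : Fin (n + 1) → ℝ), (∀ i, 0 ≤ t i) → StrictMono t →
      iIndepFun
        (fun i : Fin n => fun ω => B (t i.succ) ω - B (t i.castSucc) ω) ℙ)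
    (hgauss : ∀ s t : ℝ, 0 ≤ s → s ≤ t →
      Measure.map (fun ω => B t ω - B s ω) ℙ = gaussianReal 0 (Real.toNNReal (t - s)))
    (W : ℝ → Ω → ℝ) (hW : ∀ s ω, W s ω = B s ω - B 0 ω + s) (x : ℝ)
    (h : ℝ) (hh : 0 < h) (n : ℕ) :
    ∫⁻ ω, hsum x (fun k => W (k * h) ω) n (fA x (W (n * h) ω)) ∂ℙ
      = ∫⁻ ω, hsum x (fun k => W (k * h) ω) n (fC x (W (n * h) ω)) ∂ℙ := by
  have hWm := measurable_W B hmeas W hW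
  have hset : ∀ k : ℕ, MeasurableSet {ω | FH x (fun k : ℕ => W (k * h) ω) k} := fun k =>
    (measurable_pi_lambda (fun ω (k : ℕ) => W (k * h) ω) (fun k => hWm _)) (measurableSet_FH x k)
  unfold hsum
  rw [lintegral_finsetSum, lintegral_finsetSum]
  rotate_left
  · intro k _
    exact Measurable.ite (hset k) ((fC_meas x).comp ((hWm _).prodMk (hWm _))) measurable_const
  · intro k _
    exact Measurable.ite (hset k) ((fA_meas x).comp ((hWm _).prodMk (hWm (k * h)))) measurable_const
  refine Finset.sum_congr rfl fun k hk => ?_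
  have hkn : k < n := by simpa using hk
  have hkn' : (k : ℝ) < n := by exact_mod_cast hkn
  have hv : 0 < (n - k : ℝ) * h := mul_pos (by linarith) hh
  have hind := indep_grid B hmeas hincr h hh n k hkn.le W hW
  have hlaw : Measure.map (fun ω => W (n * h) ω - W (k * h) ω) ℙ
      = gaussianReal ((n - k : ℝ) * h) ((n - k : ℝ) * h).toNNReal := by
    have h1 := hgauss (k * h) (n * h) (by positivity) (by gcongr)
    have h2 : (fun ω => W (n * h) ω - W (k * h) ω)
        = (fun y => y + (n - k : ℝ) * h) ∘ (fun ω => B (n * h) ω - B (k * h) ω) := by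
      ext ω; simp only [Function.comp, hW]; ring
    rw [h2, ← Measure.map_map (g := fun y : ℝ => y + (n - k : ℝ) * h) (by fun_prop)
      (show Measurable fun ω => B (n * h) ω - B (k * h) ω from (hmeas (n * h)).sub (hmeas (k * h))), h1, gaussianReal_map_add_const,
      zero_add, ← sub_mul]
  have key := step_flip (fun ω (j : ℕ) => W ((min j k : ℕ) * h) ω) (fun ω => W (n * h) ω - W (k * h) ω)
    (measurable_pi_lambda _ fun j => hWm _) ((hWm _).sub (hWm _)) hind _ hv hlaw
    (fun w r => if FH x w k then (Iio x).indicator 1 (w k + r) else 0) (by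
      refine Measurable.ite (measurable_fst (measurableSet_FH x k)) ?_ measurable_const
      exact (measurable_one.indicator measurableSet_Iio).comp
        (((measurable_pi_apply k).comp measurable_fst).add measurable_snd))
  have hmin : ∀ ω, FH x (fun j : ℕ => W ((min j k : ℕ) * h) ω) k ↔ FH x (fun j : ℕ => W (j * h) ω) k :=
    fun ω => FH_min x (fun j : ℕ => W (j * h) ω) k
  simp only [hmin, min_self] at key
  convert key using 3 with ω ω
  · simp [fA]
  · rw [fC, ite_mul, zero_mul]
    simp only
    rw [show W (k * h) ω + -(W (n * h) ω - W (k * h) ω) = 2 * W (k * h) ω - W (n * h) ω by ring]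

lemma max_law {Ω : Type*} [MeasureSpace Ω] [IsProbabilityMeasure (ℙ : Measure Ω)]
    (B : ℝ → Ω → ℝ) (hmeas : ∀ t : ℝ, Measurable (B t))
    (hcont : ∀ᵐ ω ∂ℙ, Continuous fun s => B s ω)
    (hincr : ∀ (n : ℕ) (t : Fin (n + 1) → ℝ), (∀ i, 0 ≤ t i) → StrictMono t →
      iIndepFun
        (fun i : Fin n => fun ω => B (t i.succ) ω - B (t i.castSucc) ω) ℙ)
    (hgauss : ∀ s t : ℝ, 0 ≤ s → s ≤ t →
      Measure.map (fun ω => B t ω - B s ω) ℙ = gaussianReal 0 (Real.toNNReal (t - s)))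
    (W : ℝ → Ω → ℝ) (hW : ∀ s ω, W s ω = B s ω - B 0 ω + s) (t : ℝ) (ht : 0 < t)
    (M : Ω → ℝ) (hM : AEMeasurable M ℙ)
    (hlub : ∀ᵐ ω ∂ℙ, IsLUB ((fun s => W s ω) '' Icc 0 t) (M ω))
    (hWlaw : Measure.map (W t) ℙ = gaussianReal t t.toNNReal)
    (x : ℝ) (hx : 0 < x) (hnull : ℙ {ω | M ω = x} = 0) :
    ℙ {ω | x < M ω} = ∫⁻ y, (Ioi x).indicator (fun y => 1 + ENNReal.ofReal (Real.exp (-2 * (y - x)))) y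
      ∂(gaussianReal t t.toNNReal) := by
  classical
  have hWm := measurable_W B hmeas W hW
  have ht' : t.toNNReal ≠ 0 := by simpa using ht
  have hne1 : ∀ᵐ ω ∂ℙ, M ω ≠ x := by rw [ae_iff]; simpa using hnull
  have hne2 : ∀ᵐ ω ∂ℙ, W t ω ≠ x := by
    have : NullSingletonClass (gaussianReal t t.toNNReal) := nullSingletonClass_gaussianReal ht'
    have h1 : ∀ᵐ y ∂(gaussianReal t t.toNNReal), y ≠ x := by
      rw [ae_iff]; simp
    rw [← hWlaw] at h1
    exact ae_of_ae_map (hWm t).aemeasurable h1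
  have hcW : ∀ᵐ ω ∂ℙ, Continuous fun s => W s ω := by
    filter_upwards [hcont] with ω hω
    simp only [hW]
    fun_prop
  have hW0 : ∀ ω, W 0 ω = 0 := fun ω => by simp [hW]
  have hnt : ∀ n : ℕ, ((n + 1 : ℕ) : ℝ) * (t / ((n : ℝ) + 1)) = t := fun n => by
    push_cast; field_simp
  have hfC1 : ∀ y a, x ≤ a → fC x y a ≤ 1 := by
    intro y a ha
    unfold fC
    by_cases hy : 2 * a - y ∈ Iio x
    · rw [indicator_of_mem hy]
      have h1 : 2 * a - y < x := hy
      simp only [Pi.one_apply, one_mul]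
      rw [ENNReal.ofReal_le_one, Real.exp_le_one_iff]
      linarith
    · rw [indicator_of_notMem hy]; simp
  have hfA1 : ∀ y a, fA x y a ≤ 1 := by
    intro y a
    unfold fA
    exact indicator_le (fun _ _ => le_rfl) y
  -- limits
  have limA : Tendsto (fun n : ℕ => ∫⁻ ω, hsum x (fun k => W (k * (t / (n + 1))) ω) (n + 1) (fA x (W t ω)) ∂ℙ)
      atTop (𝓝 (∫⁻ ω, (if x < M ω then fA x (W t ω) x else 0) ∂ℙ)) := by
    refine tendsto_lintegral_of_dominated_convergence (fun _ => 1) (fun n => ?_) (fun n => ?_) (by simp) ?_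
    · exact hsum_meas (fun k ω => W (k * (t / (n + 1))) ω) (W t) (fun k => hWm _) (hWm t) x (n + 1) (fA x) (fA_meas x)
    · exact Eventually.of_forall fun ω => hsum_le_one _ fun a _ => hfA1 _ a
    · filter_upwards [hne1, hcW, hlub] with ω h1 h2 h3
      by_cases hxM : x < M ω
      · rw [if_pos hxM]
        obtain ⟨_, ⟨s, hs, rfl⟩, hxs⟩ := (lt_isLUB_iff h3).1 hxM
        exact hsum_tendsto (fun s => W s ω) h2 t x ht (by simp only [hW0]; exact hx) ⟨s, hs, hxs⟩ _
          continuousAt_const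
      · rw [if_neg hxM]
        refine tendsto_const_nhds.congr fun n => (hsum_eq_zero _ fun k hk hF => ?_).symm
        have h4 : W (k * (t / (n + 1))) ω ≤ M ω := h3.1 ⟨_, ⟨by positivity, by
          rw [← hnt n]
          have : (k : ℝ) ≤ (n + 1 : ℕ) := by exact_mod_cast hk.le
          nth_rewrite 1 [hnt n]
          gcongr⟩, rfl⟩
        exact hxM (lt_of_le_of_ne (hF.1.trans h4) (Ne.symm h1))
  have limC : Tendsto (fun n : ℕ => ∫⁻ ω, hsum x (fun k => W (k * (t / (n + 1))) ω) (n + 1) (fC x (W t ω)) ∂ℙ)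
      atTop (𝓝 (∫⁻ ω, fC x (W t ω) x ∂ℙ)) := by
    refine tendsto_lintegral_of_dominated_convergence (fun _ => 1) (fun n => ?_) (fun n => ?_) (by simp) ?_
    · exact hsum_meas (fun k ω => W (k * (t / (n + 1))) ω) (W t) (fun k => hWm _) (hWm t) x (n + 1) (fC x) (fC_meas x)
    · exact Eventually.of_forall fun ω => hsum_le_one _ fun a ha => hfC1 _ a ha
    · filter_upwards [hne1, hcW, hlub, hne2] with ω h1 h2 h3 h5
      by_cases hxM : x < M ω
      · obtain ⟨_, ⟨s, hs, rfl⟩, hxs⟩ := (lt_isLUB_iff h3).1 hxM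
        refine hsum_tendsto (fun s => W s ω) h2 t x ht (by simp only [hW0]; exact hx) ⟨s, hs, hxs⟩ _ ?_
        rcases lt_or_gt_of_ne h5 with h | h
        · have : fC x (W t ω) =ᶠ[𝓝 x] fun _ => 0 := by
            filter_upwards [lt_mem_nhds (show (x + W t ω) / 2 < x by linarith)] with a ha
            unfold fC
            rw [indicator_of_notMem, zero_mul]
            simp only [mem_Iio, not_lt]
            linarith
          exact continuousAt_const.congr this.symm
        · have : fC x (W t ω) =ᶠ[𝓝 x] fun a => ENNReal.ofReal (Real.exp (-2 * (W t ω - a))) := by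
            filter_upwards [gt_mem_nhds (show x < (x + W t ω) / 2 by linarith)] with a ha
            unfold fC
            rw [indicator_of_mem, Pi.one_apply, one_mul]
            simp only [mem_Iio]
            linarith
          refine ContinuousAt.congr ?_ this.symm
          exact (ENNReal.continuous_ofReal.comp (by fun_prop)).continuousAt
      · have h6 : W t ω ≤ M ω := h3.1 ⟨t, ⟨ht.le, le_rfl⟩, rfl⟩
        have : fC x (W t ω) x = 0 := by
          unfold fC
          rw [indicator_of_notMem, zero_mul]
          simp only [mem_Iio, not_lt]
          linarith
        rw [this]
        refine tendsto_const_nhds.congr fun n => (hsum_eq_zero _ fun k hk hF => ?_).symm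
        have h4 : W (k * (t / (n + 1))) ω ≤ M ω := h3.1 ⟨_, ⟨by positivity, by
          rw [← hnt n]
          have : (k : ℝ) ≤ (n + 1 : ℕ) := by exact_mod_cast hk.le
          nth_rewrite 1 [hnt n]
          gcongr⟩, rfl⟩
        exact hxM (lt_of_le_of_ne (hF.1.trans h4) (Ne.symm h1))
  have heq : ∫⁻ ω, (if x < M ω then fA x (W t ω) x else 0) ∂ℙ = ∫⁻ ω, fC x (W t ω) x ∂ℙ := by
    refine tendsto_nhds_unique limA (limC.congr fun n => ?_)
    have := discrete_reflection B hmeas hincr hgauss W hW x (t / (n + 1)) (by positivity) (n + 1)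
    rw [hnt n] at this
    exact this.symm
  have hMset : NullMeasurableSet {ω | x < M ω} ℙ := nullMeasurableSet_lt aemeasurable_const hM
  have hind : Measurable (fun ω => (Ioi x).indicator (1 : ℝ → ℝ≥0∞) (W t ω)) :=
    (measurable_one.indicator measurableSet_Ioi).comp (hWm t)
  calc ℙ {ω | x < M ω} = ∫⁻ ω, ({ω | x < M ω}.indicator 1 ω) ∂ℙ := (lintegral_indicator_one₀ hMset).symm
    _ = ∫⁻ ω, ((if x < M ω then fA x (W t ω) x else 0) + (Ioi x).indicator 1 (W t ω)) ∂ℙ := by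
        refine lintegral_congr_ae ?_
        filter_upwards [hlub, hne2] with ω h3 h5
        have h6 : W t ω ≤ M ω := h3.1 ⟨t, ⟨ht.le, le_rfl⟩, rfl⟩
        by_cases hxM : x < M ω
        · rw [if_pos hxM, indicator_of_mem (show ω ∈ {ω | x < M ω} from hxM)]
          unfold fA
          rcases lt_or_gt_of_ne h5 with h | h
          · rw [indicator_of_mem (show W t ω ∈ Iio x from h), indicator_of_notMem (by simpa using h.le)]
            simp
          · rw [indicator_of_mem (show W t ω ∈ Ioi x from h), indicator_of_notMem (by simpa using h.le)]
            simp
        · rw [if_neg hxM, indicator_of_notMem (show ω ∉ {ω | x < M ω} from hxM), indicator_of_notMem (by simp; linarith)]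
          simp
    _ = ∫⁻ ω, fC x (W t ω) x ∂ℙ + ∫⁻ ω, (Ioi x).indicator 1 (W t ω) ∂ℙ := by
        rw [lintegral_add_right _ hind, heq]
    _ = ∫⁻ ω, (fC x (W t ω) x + (Ioi x).indicator 1 (W t ω)) ∂ℙ := by
        rw [lintegral_add_right _ hind]
    _ = ∫⁻ ω, (Ioi x).indicator (fun y => 1 + ENNReal.ofReal (Real.exp (-2 * (y - x)))) (W t ω) ∂ℙ := by
        refine lintegral_congr fun ω => ?_
        unfold fC
        by_cases h : x < W t ω
        · rw [indicator_of_mem (show W t ω ∈ Ioi x from h), indicator_of_mem (show W t ω ∈ Ioi x from h),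
            indicator_of_mem (by simp; linarith)]
          simp [add_comm]
        · rw [indicator_of_notMem (show W t ω ∉ Ioi x from h), indicator_of_notMem (show W t ω ∉ Ioi x from h),
            indicator_of_notMem (by simp; linarith)]
          simp
    _ = _ := by
        rw [← hWlaw, lintegral_map _ (hWm t)]
        exact Measurable.indicator (by fun_prop) measurableSet_Ioi

noncomputable def KK : ℝ → ℝ :=
  (Ioi 0).indicator fun y => 1 - Real.exp (-2 * y) + 2 * y * Real.exp (-2 * y)

lemma KK_meas : Measurable KK := Measurable.indicator (by fun_prop) measurableSet_Ioi

lemma layer_swap (γ : Measure ℝ) [IsProbabilityMeasure γ] :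
    ∫⁻ x in Ioi (0:ℝ), (∫⁻ y, (Ioi x).indicator (fun y => 1 + ENNReal.ofReal (Real.exp (-2 * (y - x)))) y ∂γ)
      * ENNReal.ofReal (2 * Real.exp (-2 * x)) = ∫⁻ y, ENNReal.ofReal (KK y) ∂γ := by
  have hmeas : Measurable (fun p : ℝ × ℝ => (Ioi p.1).indicator
      (fun y => 1 + ENNReal.ofReal (Real.exp (-2 * (y - p.1)))) p.2) := by
    have : (fun p : ℝ × ℝ => (Ioi p.1).indicator
      (fun y => 1 + ENNReal.ofReal (Real.exp (-2 * (y - p.1)))) p.2)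
      = {p : ℝ × ℝ | p.1 < p.2}.indicator (fun p => 1 + ENNReal.ofReal (Real.exp (-2 * (p.2 - p.1)))) := by
      ext p
      by_cases h : p.1 < p.2
      · rw [indicator_of_mem (show p.2 ∈ Ioi p.1 from h), indicator_of_mem (show p ∈ {p : ℝ × ℝ | p.1 < p.2} from h)]
      · rw [indicator_of_notMem (show p.2 ∉ Ioi p.1 from h), indicator_of_notMem (show p ∉ {p : ℝ × ℝ | p.1 < p.2} from h)]
    rw [this]
    exact Measurable.indicator (by fun_prop) (measurableSet_lt measurable_fst measurable_snd)
  have h1 : ∀ x : ℝ, (∫⁻ y, (Ioi x).indicator (fun y => 1 + ENNReal.ofReal (Real.exp (-2 * (y - x)))) y ∂γ)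
      * ENNReal.ofReal (2 * Real.exp (-2 * x)) = ∫⁻ y, (Ioi x).indicator (fun y => 1 + ENNReal.ofReal (Real.exp (-2 * (y - x)))) y
      * ENNReal.ofReal (2 * Real.exp (-2 * x)) ∂γ := fun x =>
    (lintegral_mul_const _ (Measurable.indicator (by fun_prop) measurableSet_Ioi)).symm
  simp_rw [h1]
  rw [lintegral_lintegral_swap]
  swap
  · exact (Measurable.mul hmeas (by fun_prop)).aemeasurable
  refine lintegral_congr fun y => ?_
  have h2 : ∀ x : ℝ, (Ioi x).indicator (fun y => 1 + ENNReal.ofReal (Real.exp (-2 * (y - x)))) y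
      * ENNReal.ofReal (2 * Real.exp (-2 * x))
      = (Iio y).indicator (fun x => ENNReal.ofReal (2 * Real.exp (-2 * x) + 2 * Real.exp (-2 * y))) x := by
    intro x
    by_cases h : x < y
    · rw [indicator_of_mem (show y ∈ Ioi x from h), indicator_of_mem (show x ∈ Iio y from h),
        ← ENNReal.ofReal_one, ← ENNReal.ofReal_add (by norm_num) (by positivity),
        ← ENNReal.ofReal_mul (by positivity)]
      congr 1
      rw [show Real.exp (-2 * y) = Real.exp (-2 * (y - x)) * Real.exp (-2 * x) by rw [← Real.exp_add]; ring_nf]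
      ring
    · rw [indicator_of_notMem (show y ∉ Ioi x from h), indicator_of_notMem (show x ∉ Iio y from h), zero_mul]
  simp_rw [h2]
  rw [lintegral_indicator measurableSet_Iio, Measure.restrict_restrict measurableSet_Iio, Iio_inter_Ioi]
  unfold KK
  by_cases hy : 0 < y
  · rw [indicator_of_mem (show y ∈ Ioi 0 from hy), restrict_Ioo_eq_restrict_Ioc,
      ← ofReal_integral_eq_lintegral_ofReal, ← intervalIntegral.integral_of_le hy.le]
    · congr 1
      rw [intervalIntegral.integral_eq_sub_of_hasDerivAt
        (f := fun x => - Real.exp (-2 * x) + 2 * Real.exp (-2 * y) * x)]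
      · simp; ring
      · intro x _
        have h3 : HasDerivAt (fun x : ℝ => Real.exp (-2 * x)) (Real.exp (-2 * x) * (-2 * 1)) x :=
          ((hasDerivAt_id x).const_mul (-2)).exp
        have h4 := h3.neg.add ((hasDerivAt_id x).const_mul (2 * Real.exp (-2 * y)))
        refine h4.congr_deriv ?_
        ring
      · exact Continuous.intervalIntegrable (by fun_prop) _ _
    · exact (Continuous.integrableOn_Icc (by fun_prop)).mono_set Ioc_subset_Icc_self
    · exact Eventually.of_forall fun x => by positivity
  · rw [indicator_of_notMem (show y ∉ Ioi 0 from hy), Ioo_eq_empty hy]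
    simp

lemma gauss_calc (t : ℝ) (ht : 0 < t) (Ψ : ℝ → ℝ) (hΨ : ∀ x : ℝ, Ψ x = (gaussianReal 0 1 (Set.Ioi x)).toReal) :
    ∫ y, KK y ∂(gaussianReal t t.toNNReal) = 1 - (2 * (1 + t) * Ψ (Real.sqrt t)
          - Real.sqrt (2 * t / Real.pi) * Real.exp (-(t / 2))) := by
  have ht' : t.toNNReal ≠ 0 := by simpa using ht
  set p := gaussianPDFReal t t.toNNReal with hp
  have hpint : Integrable p := integrable_gaussianPDFReal _ _
  have hpnint : Integrable (fun y => p (-y)) := hpint.comp_neg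
  have hsq : 0 < Real.sqrt t := Real.sqrt_pos.2 ht
  have hpdef : ∀ y, p y = (Real.sqrt (2 * Real.pi * t))⁻¹ * Real.exp (-(y - t) ^ 2 / (2 * t)) := by
    intro y; rw [hp, gaussianPDFReal, Real.coe_toNNReal _ ht.le]
  -- the left tail
  have htail : (gaussianReal t t.toNNReal).real (Iic 0) = Ψ (Real.sqrt t) := by
    have hmap : Measure.map (fun z => t - Real.sqrt t * z) (gaussianReal 0 1) = gaussianReal t t.toNNReal := by
      have : (fun z : ℝ => t - Real.sqrt t * z) = (fun z => t + z) ∘ (fun z => (-Real.sqrt t) * z) := by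
        ext z; simp; ring
      rw [this, ← Measure.map_map (by fun_prop) (by fun_prop), gaussianReal_map_const_mul,
        gaussianReal_map_const_add]
      congr 1
      · ring
      · ext; simp [Real.sq_sqrt ht.le, ht.le]
    have : NullSingletonClass (gaussianReal 0 1) := nullSingletonClass_gaussianReal one_ne_zero
    rw [hΨ, measureReal_def, ← hmap, Measure.map_apply (by fun_prop) measurableSet_Iic]
    have hpre : (fun z => t - Real.sqrt t * z) ⁻¹' Iic 0 = Ici (Real.sqrt t) := by
      ext z
      simp only [mem_preimage, mem_Iic, mem_Ici]
      have h2 := Real.mul_self_sqrt ht.le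
      constructor
      · intro h; nlinarith
      · intro h; nlinarith
    rw [hpre, measure_congr Ioi_ae_eq_Ici.symm]
  have hreal : ∀ s : Set ℝ, MeasurableSet s → ∫ y in s, p y = (gaussianReal t t.toNNReal).real s := by
    intro s hs
    rw [measureReal_def, gaussianReal_apply_eq_integral _ ht', ENNReal.toReal_ofReal]
    exact integral_nonneg fun y => gaussianPDFReal_nonneg _ _ _
  have i1 : ∫ y in Ioi 0, p y = 1 - Ψ (Real.sqrt t) := by
    rw [hreal _ measurableSet_Ioi, ← htail, ← probReal_compl_eq_one_sub measurableSet_Iic, compl_Iic]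
  have i2 : ∫ y in Ioi 0, p (-y) = Ψ (Real.sqrt t) := by
    rw [integral_comp_neg_Ioi, neg_zero, hreal _ measurableSet_Iic, htail]
  have hder : ∀ y ∈ Ici (0:ℝ), HasDerivAt (fun y => - t * p (-y)) ((y + t) * p (-y)) y := by
    intro y _
    have h1 : HasDerivAt (fun y : ℝ => -(-y - t) ^ 2 / (2 * t)) (-(y + t) / t) y := by
      have := (((((hasDerivAt_id y).neg).sub_const t).pow 2).neg).div_const (2 * t)
      refine this.congr_deriv ?_
      simp
      field_simp
      ring
    have h2 := (h1.exp.const_mul ((Real.sqrt (2 * Real.pi * t))⁻¹)).const_mul (-t)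
    simp only [hpdef]
    refine h2.congr_deriv ?_
    field_simp
  have hnn : ∀ y ∈ Ioi (0:ℝ), 0 ≤ (y + t) * p (-y) := fun y hy => by
    have hy' : 0 < y := hy
    have := gaussianPDFReal_nonneg t t.toNNReal (-y)
    positivity
  have hlim : Tendsto (fun y => - t * p (-y)) atTop (𝓝 0) := by
    have h1 : Tendsto (fun y : ℝ => (y + t) ^ 2 / (2 * t)) atTop atTop :=
      ((tendsto_pow_atTop two_ne_zero).comp (tendsto_atTop_add_const_right _ t tendsto_id)).atTop_div_const (by positivity)
    have h2 := (Real.tendsto_exp_neg_atTop_nhds_zero.comp h1).const_mul (-t * (Real.sqrt (2 * Real.pi * t))⁻¹)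
    rw [mul_zero] at h2
    refine h2.congr fun y => ?_
    rw [hpdef]
    simp only [Function.comp]
    rw [mul_assoc]
    congr 3
    ring
  have hint3 : IntegrableOn (fun y => (y + t) * p (-y)) (Ioi 0) :=
    integrableOn_Ioi_deriv_of_nonneg' hder hnn hlim
  have i3 : ∫ y in Ioi 0, (y + t) * p (-y) = t * p 0 := by
    rw [integral_Ioi_of_hasDerivAt_of_nonneg' hder hnn hlim]
    simp
  have hval : 2 * (t * p 0) = Real.sqrt (2 * t / Real.pi) * Real.exp (-(t / 2)) := by
    rw [hpdef, show -(0 - t) ^ 2 / (2 * t) = -(t / 2) by field_simp; ring, ← mul_assoc, ← mul_assoc]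
    congr 1
    have hpi := Real.pi_pos
    rw [eq_comm, Real.sqrt_eq_iff_mul_self_eq_of_pos (by positivity)]
    have h1 : Real.sqrt (2 * Real.pi * t) * Real.sqrt (2 * Real.pi * t) = 2 * Real.pi * t :=
      Real.mul_self_sqrt (by positivity)
    have h2 : 0 < Real.sqrt (2 * Real.pi * t) := by positivity
    have h3 : (2 * t * (Real.sqrt (2 * Real.pi * t))⁻¹) * (2 * t * (Real.sqrt (2 * Real.pi * t))⁻¹)
      = 4 * t ^ 2 / (Real.sqrt (2 * Real.pi * t) * Real.sqrt (2 * Real.pi * t)) := by field_simp; norm_num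
    rw [h3, h1]
    field_simp
    norm_num
  rw [integral_gaussianReal_eq_integral_smul ht']
  have e1 : (fun y => gaussianPDFReal t t.toNNReal y • KK y)
      = (Ioi 0).indicator (fun y => p y - (1 + 2 * t) * p (-y) + 2 * ((y + t) * p (-y))) := by
    ext y
    unfold KK
    by_cases hy : y ∈ Ioi (0:ℝ)
    · rw [indicator_of_mem hy, indicator_of_mem hy, ← hp, hp, pdf_flip ht, smul_eq_mul]
      ring
    · rw [indicator_of_notMem hy, indicator_of_notMem hy, smul_zero]
  rw [e1, integral_indicator measurableSet_Ioi, integral_add, integral_sub, integral_const_mul, integral_const_mul,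
    i1, i2, i3, hval]
  · ring
  · exact hpint.integrableOn
  · exact (hpnint.const_mul _).integrableOn
  · exact hpint.integrableOn.sub (hpnint.const_mul _).integrableOn
  · exact hint3.const_mul _

end aux

/-- Laplace transform at `2` of `sup_{s ∈ [0,t]} (B(s) + s)`. -/
theorem exp_neg_two_sup_brownian_with_drift
    {Ω : Type*} [MeasureSpace Ω] [IsProbabilityMeasure (ℙ : Measure Ω)]
    (B : ℝ → Ω → ℝ)
    (hmeas : ∀ t : ℝ, Measurable (B t))
    (hB0 : ∀ᵐ ω ∂ℙ, B 0 ω = 0)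
    (hcont : ∀ᵐ ω ∂ℙ, Continuous fun s => B s ω)
    (hincr : ∀ (n : ℕ) (t : Fin (n + 1) → ℝ), (∀ i, 0 ≤ t i) → StrictMono t →
      iIndepFun
        (fun i : Fin n => fun ω => B (t i.succ) ω - B (t i.castSucc) ω) ℙ)
    (hgauss : ∀ s t : ℝ, 0 ≤ s → s ≤ t →
      Measure.map (fun ω => B t ω - B s ω) ℙ = gaussianReal 0 (Real.toNNReal (t - s)))
    (Ψ : ℝ → ℝ) (hΨ : ∀ x : ℝ, Ψ x = (gaussianReal 0 1 (Set.Ioi x)).toReal)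
    (t : ℝ) (ht : 0 < t) :
    ∫ ω, Real.exp (-2 * ⨆ s : Set.Icc (0:ℝ) t, (B (s : ℝ) ω + (s : ℝ))) ∂ℙ
      = 2 * (1 + t) * Ψ (Real.sqrt t)
          - Real.sqrt (2 * t / Real.pi) * Real.exp (-(t / 2)) := by
  set W : ℝ → Ω → ℝ := fun s ω => B s ω - B 0 ω + s with hWdef
  have hW : ∀ s ω, W s ω = B s ω - B 0 ω + s := fun _ _ => rfl
  set M : Ω → ℝ := fun ω => ⨆ s : Set.Icc (0:ℝ) t, (B (s : ℝ) ω + (s : ℝ)) with hMdef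
  have : Nonempty (Set.Icc (0:ℝ) t) := ⟨⟨0, le_rfl, ht.le⟩⟩
  have hM : AEMeasurable M ℙ := by
    obtain ⟨D, hDc, hD⟩ := TopologicalSpace.exists_countable_dense (Set.Icc (0:ℝ) t)
    have : Countable D := hDc.to_subtype
    refine ⟨fun ω => ⨆ s : D, (B ((s : Set.Icc (0:ℝ) t) : ℝ) ω + ((s : Set.Icc (0:ℝ) t) : ℝ)),
      Measurable.iSup fun s => (hmeas _).add_const _, ?_⟩
    filter_upwards [hcont] with ω hω
    exact (hD.ciSup' (f := fun s : Set.Icc (0:ℝ) t => B (s : ℝ) ω + (s : ℝ)) (by fun_prop)).symm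
  have hlub : ∀ᵐ ω ∂ℙ, IsLUB ((fun s => W s ω) '' Icc 0 t) (M ω) := by
    filter_upwards [hcont, hB0] with ω hω h0
    have hr : (fun s => W s ω) '' Icc 0 t
        = range (fun s : Set.Icc (0:ℝ) t => B (s : ℝ) ω + (s : ℝ)) := by
      rw [image_eq_range]
      simp [hW, h0]
    rw [hr]
    exact isLUB_ciSup (isCompact_range (by fun_prop)).bddAbove
  have hWlaw : Measure.map (W t) ℙ = gaussianReal t t.toNNReal := by
    have h1 := hgauss 0 t le_rfl ht.le
    have h2 : W t = (fun y => y + t) ∘ (fun ω => B t ω - B 0 ω) := rfl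
    rw [h2, ← Measure.map_map (g := fun y : ℝ => y + t) (by fun_prop)
      (show Measurable fun ω => B t ω - B 0 ω from (hmeas t).sub (hmeas 0)), h1,
      gaussianReal_map_add_const, zero_add, sub_zero]
  have hMnn : ∀ᵐ ω ∂ℙ, 0 ≤ M ω := by
    filter_upwards [hlub] with ω h
    have := h.1 ⟨0, ⟨le_rfl, ht.le⟩, rfl⟩
    simpa [hW] using this
  have hlayer : ∫⁻ ω, ENNReal.ofReal (1 - Real.exp (-2 * M ω)) ∂ℙ
      = ∫⁻ y, ENNReal.ofReal (KK y) ∂(gaussianReal t t.toNNReal) := by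
    rw [← layer_swap]
    have h1 := lintegral_comp_eq_lintegral_meas_lt_mul (f := M) (g := fun x => 2 * Real.exp (-2 * x)) ℙ
      hMnn hM (fun _ _ => Continuous.intervalIntegrable (by fun_prop) _ _)
      (Eventually.of_forall fun x => by positivity)
    have h2 : ∀ a : ℝ, ∫ x in (0:ℝ)..a, 2 * Real.exp (-2 * x) = 1 - Real.exp (-2 * a) := by
      intro a
      rw [intervalIntegral.integral_eq_sub_of_hasDerivAt (f := fun x => - Real.exp (-2 * x))]
      · simp; ring
      · intro x _
        have h3 : HasDerivAt (fun x : ℝ => Real.exp (-2 * x)) (Real.exp (-2 * x) * (-2 * 1)) x :=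
          ((hasDerivAt_id x).const_mul (-2)).exp
        refine h3.neg.congr_deriv ?_
        ring
      · exact Continuous.intervalIntegrable (by fun_prop) _ _
    simp only [h2] at h1
    rw [h1]
    have hcount : {x : ℝ | 0 < ℙ {ω | M ω = x}}.Countable :=
      Measure.countable_meas_level_set_pos₀ hM.nullMeasurable
    have hae : ∀ᵐ x ∂(volume : Measure ℝ), x ∉ {x : ℝ | 0 < ℙ {ω | M ω = x}} := hcount.ae_notMem _
    refine setLIntegral_congr_fun_ae measurableSet_Ioi ?_
    filter_upwards [hae] with x hx hx0
    rw [max_law B hmeas hcont hincr hgauss W hW t ht M hM hlub hWlaw x hx0 (by simpa using hx)]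
  have hKnn : ∀ y, 0 ≤ KK y := by
    intro y
    refine indicator_nonneg (fun y hy => ?_) y
    have hy' : 0 < y := hy
    have : Real.exp (-2 * y) ≤ 1 := Real.exp_le_one_iff.2 (by linarith)
    have : 0 ≤ 2 * y * Real.exp (-2 * y) := by positivity
    linarith
  have hexpm : AEStronglyMeasurable (fun ω => Real.exp (-2 * M ω)) ℙ :=
    (Real.measurable_exp.comp_aemeasurable (hM.const_mul (-2))).aestronglyMeasurable
  have hle : ∀ᵐ ω ∂ℙ, Real.exp (-2 * M ω) ≤ 1 := by
    filter_upwards [hMnn] with ω h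
    exact Real.exp_le_one_iff.2 (by linarith)
  have hint : Integrable (fun ω => Real.exp (-2 * M ω)) ℙ := by
    refine Integrable.of_bound hexpm 1 ?_
    filter_upwards [hle] with ω h
    rw [Real.norm_eq_abs, abs_of_pos (Real.exp_pos _)]
    exact h
  have hfin : ∫ ω, (1 - Real.exp (-2 * M ω)) ∂ℙ = ∫ y, KK y ∂(gaussianReal t t.toNNReal) := by
    rw [integral_eq_lintegral_of_nonneg_ae (f := fun ω => 1 - Real.exp (-2 * M ω)) _ (aestronglyMeasurable_const.sub hexpm), hlayer,
      integral_eq_lintegral_of_nonneg_ae (Eventually.of_forall hKnn) KK_meas.aestronglyMeasurable]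
    filter_upwards [hle] with ω h
    simpa using h
  rw [integral_sub (integrable_const _) hint, gauss_calc t ht Ψ hΨ] at hfin
  simp only [integral_const, probReal_univ, smul_eq_mul, one_mul] at hfin
  linarith
end
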